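/- arXiv:2410.17121 — 2 statements merged into one kernel-verified Lean document; each statement's English description precedes it below -/
import Mathlib

section
/- Let K be a finite-dimensional simplicial complex and 𝒫 = (P_v)_{v ∈ V(K)} a family of non-empty sets. Then the inflation (K, 𝒫) is Cohen–Macaulay of dimension d if and only if K is Cohen–Macaulay of dimension d. -/
open scoped Classical

noncomputable section

universe u v

/-- An abstract simplicial complex on a vertex type `V`, given by its set of
faces (finite subsets of `V`), closed under taking subsets. -/
structure AbsSC (V : Type u) where
  faces : Set (Finset V)
  down_closed : ∀ s ∈ faces, ∀ t ⊆ s, t ∈ faces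

namespace AbsSC

/-- The geometric realization of an abstract simplicial complex: the space of
convex-combination functions supported on a face of the complex. -/
def realization {V : Type u} (K : AbsSC V) : Type u :=
  {f : V → ℝ // ∃ s ∈ K.faces, (∀ v ∉ s, f v = 0) ∧ (∀ v, 0 ≤ f v) ∧ ∑ v ∈ s, f v = 1}

instance {V : Type u} (K : AbsSC V) : TopologicalSpace (realization K) :=
  inferInstanceAs (TopologicalSpace {_f : V → ℝ // _})

end AbsSC

/-- The order complex of a poset: its simplices are the finite chains. -/
def orderComplex (X : Type u) [Preorder X] : AbsSC X where
  faces := {s | IsChain (· ≤ ·) (↑s : Set X)}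
  down_closed := fun _s hs _t hts => hs.mono (Finset.coe_subset.mpr hts)

/-- `n`-connectedness of a topological space: every space is `n`-connected for
`n ≤ -2`, a space is `(-1)`-connected iff it is non-empty, and for `n ≥ 0` it is
`n`-connected iff it is non-empty and all homotopy groups in degrees `≤ n` vanish
(for every basepoint). -/
def NConnected (n : ℤ) (X : Type u) [TopologicalSpace X] : Prop :=
  (-1 ≤ n → Nonempty X) ∧
    ∀ m : ℕ, (m : ℤ) ≤ n → ∀ x : X, Subsingleton (HomotopyGroup (Fin m) X x)

/-- The faces of the inflation of a simplicial complex `K` by a family of sets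
`P`: sets `{(v₀,p₀),…,(v_k,p_k)}` such that `{v₀,…,v_k}` is a face of `K` and
`pᵢ ∈ P vᵢ` for each `i`. -/
def inflationFaces {V : Type u} (K : AbsSC V) (P : V → Type v) :
    Set (Finset ((v : V) × P v)) :=
  {s | s.image Sigma.fst ∈ K.faces ∧ ∀ a ∈ s, ∀ b ∈ s, a.1 = b.1 → a = b}

/-- The inflation of the simplicial complex `K` by the family `P`. -/
def inflation {V : Type u} (K : AbsSC V) (P : V → Type v) :
    AbsSC ((v : V) × P v) where
  faces := inflationFaces K P
  down_closed := by
    rintro s ⟨h1, h2⟩ t hts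
    exact ⟨K.down_closed _ h1 _ (Finset.image_subset_image hts),
      fun a ha b hb => h2 a (hts ha) b (hts hb)⟩

/-- The link of a simplex `σ` in the complex `K`. -/
def AbsSC.link {V : Type u} (K : AbsSC V) (σ : Finset V) : AbsSC V where
  faces := {τ | τ ∪ σ ∈ K.faces ∧ τ ∩ σ = ∅}
  down_closed := by
    rintro s ⟨h1, h2⟩ t hts
    refine ⟨K.down_closed _ h1 _ (Finset.union_subset_union_left hts), ?_⟩
    have h3 : t ∩ σ ⊆ s ∩ σ := Finset.inter_subset_inter hts (le_refl σ)
    rw [h2] at h3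
    exact Finset.subset_empty.mp h3

/-- The complex `K` is spherical of dimension `m`: it has dimension `m` and its
geometric realization is `(m-1)`-connected (equivalently, it is homotopy
equivalent to a wedge of `m`-spheres). -/
def IsSphericalDim {V : Type u} (K : AbsSC V) (m : ℤ) : Prop :=
  (∀ s ∈ K.faces, (s.card : ℤ) ≤ m + 1) ∧ (∃ s ∈ K.faces, (s.card : ℤ) = m + 1) ∧
    NConnected (m - 1) (AbsSC.realization K)

/-- The complex `K` is Cohen–Macaulay of dimension `d`: it has dimension `d`
and the link of every simplex `σ` (including the empty simplex) is spherical of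
dimension `d - dim σ - 1 = d - |σ|`. -/
def IsCM {V : Type u} (K : AbsSC V) (d : ℕ) : Prop :=
  (∀ s ∈ K.faces, s.card ≤ d + 1) ∧ (∃ s ∈ K.faces, s.card = d + 1) ∧
    ∀ σ ∈ K.faces, IsSphericalDim (K.link σ) ((d : ℤ) - σ.card)

section

open Set Metric

section

open scoped unitInterval Topology

section SphereFilling

variable {X Y : Type*} [TopologicalSpace X] [TopologicalSpace Y]

/-- Every continuous map from the unit sphere of `ℝᵏ` (with the sup norm) to `G` extends
continuously over the unit ball, with values in `G`. -/
def SphereFilling (k : ℕ) (G : Set X) : Prop :=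
  ∀ f : (Fin k → ℝ) → X, ContinuousOn f (sphere 0 1) → MapsTo f (sphere 0 1) G →
    ∃ g : (Fin k → ℝ) → X, ContinuousOn g (closedBall 0 1) ∧ MapsTo g (closedBall 0 1) G ∧
      EqOn g f (sphere 0 1)

theorem ContinuousOn.ite_of_isClosed {A B : Set Y} [∀ x, Decidable (x ∈ A)] {f g : Y → X}
    (hf : ContinuousOn f A)
    (hg : ContinuousOn g B) (hA : IsClosed A) (hB : IsClosed B) (h : EqOn f g (A ∩ B)) :
    ContinuousOn (fun x => if x ∈ A then f x else g x) (A ∪ B) := by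
  refine ContinuousOn.union_of_isClosed (hf.congr fun x hx => if_pos hx) (hg.congr fun x hx => ?_)
    hA hB
  by_cases hxA : x ∈ A
  · simpa only [if_pos hxA] using h ⟨hxA, hx⟩
  · exact if_neg hxA

theorem sphereFilling_zero [Nonempty X] {G : Set X} : SphereFilling 0 G ↔ G.Nonempty := by
  have hS : sphere (0 : Fin 0 → ℝ) 1 = ∅ := sphere_eq_empty_of_subsingleton one_ne_zero
  constructor
  · intro h
    obtain ⟨g, -, hg, -⟩ := h (fun _ => Classical.arbitrary X) continuousOn_const
      (hS ▸ mapsTo_empty _ _)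
    exact ⟨g 0, hg (mem_closedBall_self zero_le_one)⟩
  · rintro ⟨x, hx⟩ f - -
    exact ⟨fun _ => x, continuousOn_const, fun _ _ => hx, hS ▸ eqOn_empty _ _⟩

/-- A map that is homotopic to an extendable one is itself extendable. -/
theorem exists_extension_of_homotopy {k : ℕ} {G : Set X} {f g : (Fin k → ℝ) → X}
    {H : ℝ × (Fin k → ℝ) → X} (hH : ContinuousOn H (Icc 0 1 ×ˢ sphere 0 1))
    (hHG : MapsTo H (Icc 0 1 ×ˢ sphere 0 1) G) (h0 : ∀ x ∈ sphere 0 1, H (0, x) = f x)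
    (h1 : ∀ x ∈ sphere 0 1, H (1, x) = g x) (hg : ContinuousOn g (closedBall 0 1))
    (hgG : MapsTo g (closedBall 0 1) G) :
    ∃ g' : (Fin k → ℝ) → X, ContinuousOn g' (closedBall 0 1) ∧ MapsTo g' (closedBall 0 1) G ∧
      EqOn g' f (sphere 0 1) := by
  set A : Set (Fin k → ℝ) := closedBall 0 (1 / 2)
  set B : Set (Fin k → ℝ) := {x | 1 / 2 ≤ ‖x‖ ∧ ‖x‖ ≤ 1} with hB
  have hAB : A ∪ B = closedBall 0 1 := by
    ext x
    simp only [A, B, mem_union, mem_closedBall_zero_iff, mem_ofPred_eq]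
    constructor
    · rintro (h | h) <;> linarith
    · intro h
      rcases le_total ‖x‖ (1 / 2) with h' | h' <;> tauto
  have hgA : MapsTo (fun x : Fin k → ℝ => (2 : ℝ) • x) A (closedBall 0 1) := by
    intro x hx
    simp only [A, mem_closedBall_zero_iff, norm_smul, Real.norm_ofNat] at hx ⊢
    linarith
  have hpos : ∀ x ∈ B, ‖x‖ ≠ 0 := fun x hx => by
    have := hx.1
    linarith
  have hHB : MapsTo (fun x : Fin k → ℝ => ((2 - 2 * ‖x‖, ‖x‖⁻¹ • x) : ℝ × (Fin k → ℝ))) B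
      (Icc 0 1 ×ˢ sphere 0 1) := by
    intro x hx
    refine ⟨⟨?_, ?_⟩, ?_⟩
    · linarith [hx.2]
    · linarith [hx.1]
    · simp [norm_smul, hpos x hx]
  have hcont : ContinuousOn (fun x : Fin k → ℝ =>
      ((2 - 2 * ‖x‖, ‖x‖⁻¹ • x) : ℝ × (Fin k → ℝ))) B := by
    have hinv : ContinuousOn (fun x : Fin k → ℝ => ‖x‖⁻¹) B :=
      continuous_norm.continuousOn.inv₀ hpos
    fun_prop
  refine ⟨fun x => if x ∈ A then g ((2 : ℝ) • x) else H (2 - 2 * ‖x‖, ‖x‖⁻¹ • x), ?_, ?_, ?_⟩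
  · rw [← hAB]
    refine ContinuousOn.ite_of_isClosed (hg.comp (by fun_prop) hgA) (hH.comp hcont hHB)
      isClosed_closedBall ?_ ?_
    · exact (isClosed_le continuous_const continuous_norm).inter
        (isClosed_le continuous_norm continuous_const)
    · rintro x ⟨hxA, hxB⟩
      have hx : ‖x‖ = 1 / 2 := le_antisymm (by simpa [A] using hxA) hxB.1
      have hs : (2 : ℝ) • x ∈ sphere (0 : Fin k → ℝ) 1 := by
        simp [norm_smul, hx]
      have : H (2 - 2 * ‖x‖, ‖x‖⁻¹ • x) = H (1, (2 : ℝ) • x) := by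
        rw [hx]
        norm_num
      change g ((2 : ℝ) • x) = H (2 - 2 * ‖x‖, ‖x‖⁻¹ • x)
      rw [this, h1 _ hs]
  · intro x hx
    rw [← hAB] at hx
    by_cases hxA : x ∈ A
    · simpa only [if_pos hxA] using hgG (hgA hxA)
    · simpa only [if_neg hxA] using hHG (hHB (hx.resolve_left hxA))
  · intro x hx
    have hx1 : ‖x‖ = 1 := by simpa using hx
    have hxA : x ∉ A := by
      simp only [A, mem_closedBall_zero_iff, hx1]
      norm_num
    simp only [if_neg hxA, hx1]
    simpa using h0 x hx

/-- In a vector space, a map is extendable within `G` as soon as it is joined within `G` by line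
segments to an extendable one. -/
theorem exists_extension_of_segment {E : Type*} [AddCommGroup E] [Module ℝ E] [TopologicalSpace E]
    [ContinuousAdd E] [ContinuousSMul ℝ E] {k : ℕ} {G : Set E}
    {f g : (Fin k → ℝ) → E} (hf : ContinuousOn f (sphere 0 1))
    (hseg : ∀ x ∈ sphere 0 1, ∀ t ∈ Icc (0 : ℝ) 1, (1 - t) • f x + t • g x ∈ G)
    (hg : ContinuousOn g (closedBall 0 1)) (hgG : MapsTo g (closedBall 0 1) G) :
    ∃ g' : (Fin k → ℝ) → E, ContinuousOn g' (closedBall 0 1) ∧ MapsTo g' (closedBall 0 1) G ∧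
      EqOn g' f (sphere 0 1) := by
  have hsnd : MapsTo Prod.snd (Icc (0 : ℝ) 1 ×ˢ sphere (0 : Fin k → ℝ) 1) (sphere 0 1) :=
    fun p hp => hp.2
  have hf' := hf.comp continuousOn_snd hsnd
  have hg' := (hg.mono sphere_subset_closedBall).comp continuousOn_snd hsnd
  refine exists_extension_of_homotopy (H := fun p => (1 - p.1) • f p.2 + p.1 • g p.2) (f := f)
    (g := g) ?_ ?_ ?_ ?_ hg hgG
  · exact (ContinuousOn.smul (by fun_prop) hf').add (ContinuousOn.smul (by fun_prop) hg')
  · rintro ⟨t, x⟩ ⟨ht, hx⟩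
    exact hseg x hx t ht
  · simp
  · simp

theorem sphereFilling_of_homotopic {k : ℕ} {E : Type*} [AddCommGroup E] [Module ℝ E]
    [TopologicalSpace E] [ContinuousAdd E] [ContinuousSMul ℝ E] {G : Set E} {B : Set X}
    (hB : SphereFilling k B) (r : E → X) (i : X → E) (hr : ContinuousOn r G)
    (hi : ContinuousOn i B) (hrB : MapsTo r G B) (hiG : MapsTo i B G)
    (hseg : ∀ x ∈ G, ∀ t ∈ Icc (0 : ℝ) 1, (1 - t) • x + t • i (r x) ∈ G) : SphereFilling k G := by
  intro f hf hfG
  obtain ⟨g, hg, hgB, hgf⟩ := hB (r ∘ f) (hr.comp hf hfG) (hrB.comp hfG)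
  refine exists_extension_of_segment (g := i ∘ g) hf ?_ (hi.comp hg hgB) (hiG.comp hgB)
  intro x hx t ht
  have : (i ∘ g) x = i (r (f x)) := by simp [hgf hx]
  rw [this]
  exact hseg _ (hfG hx) t ht

end SphereFilling

section HomotopyGroups

variable {Y : Type*} [TopologicalSpace Y]

theorem norm_finCons {m : ℕ} (s : ℝ) (y : Fin m → ℝ) :
    ‖(Fin.cons s y : Fin (m + 1) → ℝ)‖ = max |s| ‖y‖ := by
  apply le_antisymm
  · refine (pi_norm_le_iff_of_nonneg (by positivity)).mpr fun i => ?_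
    refine Fin.cases ?_ (fun j => ?_) i
    · simp
    · simpa using Or.inr (norm_le_pi_norm y j)
  · refine max_le ?_ ((pi_norm_le_iff_of_nonneg (by positivity)).mpr fun j => ?_)
    · simpa using norm_le_pi_norm (Fin.cons s y : Fin (m + 1) → ℝ) 0
    · simpa using norm_le_pi_norm (Fin.cons s y : Fin (m + 1) → ℝ) j.succ

theorem norm_eq_max_tail {m : ℕ} (x : Fin (m + 1) → ℝ) : ‖x‖ = max |x 0| ‖Fin.tail x‖ := by
  conv_lhs => rw [← Fin.cons_self_tail x]
  exact norm_finCons _ _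

theorem exists_abs_eq_one {k : ℕ} {x : Fin k → ℝ} (hx : ‖x‖ = 1) : ∃ i, |x i| = 1 := by
  by_contra! hne
  exact ((pi_norm_lt_iff zero_lt_one).mpr fun i =>
    lt_of_le_of_ne ((norm_le_pi_norm x i).trans hx.le) (hne i)).ne hx

/-- The weight with which `pushNorth` moves a point of the sphere: it is `0` at the centre of the
bottom face and `1` outside of the interior of the bottom face. -/
def northWeight {m : ℕ} (x : Fin (m + 1) → ℝ) : ℝ :=
  max ‖Fin.tail x‖ ((1 + x 0) / 2)

/-- The unnormalized deformation of the sphere that collapses all faces but the bottom one to a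
point. -/
def pushNorthAux {m : ℕ} (t : ℝ) (x : Fin (m + 1) → ℝ) : Fin (m + 1) → ℝ :=
  Fin.cons (x 0 + 2 * t * northWeight x) ((1 - t * northWeight x) • Fin.tail x)

/-- A deformation of the unit sphere for the sup norm that collapses all faces but the bottom one
to a point. -/
def pushNorth {m : ℕ} (t : ℝ) (x : Fin (m + 1) → ℝ) : Fin (m + 1) → ℝ :=
  ‖pushNorthAux t x‖⁻¹ • pushNorthAux t x

theorem continuous_tail {m : ℕ} :
    Continuous (Fin.tail : (Fin (m + 1) → ℝ) → (Fin m → ℝ)) :=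
  continuous_pi fun j => continuous_apply j.succ

theorem continuous_northWeight {m : ℕ} :
    Continuous (northWeight : (Fin (m + 1) → ℝ) → ℝ) := by
  unfold northWeight
  have := continuous_tail (m := m)
  fun_prop

theorem continuous_pushNorthAux {m : ℕ} :
    Continuous fun p : ℝ × (Fin (m + 1) → ℝ) => pushNorthAux p.1 p.2 := by
  have h1 := (continuous_northWeight (m := m)).comp
    (continuous_snd (X := ℝ) (Y := Fin (m + 1) → ℝ))
  have h2 := (continuous_tail (m := m)).comp
    (continuous_snd (X := ℝ) (Y := Fin (m + 1) → ℝ))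
  simp only [Function.comp_def] at h1 h2
  unfold pushNorthAux
  exact Continuous.finCons (by fun_prop) (by fun_prop)

theorem abs_le_and_tail_le {m : ℕ} {x : Fin (m + 1) → ℝ} (hx : x ∈ sphere 0 1) :
    |x 0| ≤ 1 ∧ ‖Fin.tail x‖ ≤ 1 ∧ (|x 0| = 1 ∨ ‖Fin.tail x‖ = 1) := by
  have h : max |x 0| ‖Fin.tail x‖ = 1 := by
    rw [← norm_eq_max_tail]
    simpa using hx
  refine ⟨h ▸ le_max_left _ _, h ▸ le_max_right _ _, ?_⟩
  rcases max_choice |x 0| ‖Fin.tail x‖ with h' | h' <;> rw [h] at h'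
  · exact Or.inl h'.symm
  · exact Or.inr h'.symm

theorem northWeight_mem_Icc {m : ℕ} {x : Fin (m + 1) → ℝ} (hx : x ∈ sphere 0 1) :
    northWeight x ∈ Icc (0 : ℝ) 1 := by
  obtain ⟨h1, h2, -⟩ := abs_le_and_tail_le hx
  exact ⟨(norm_nonneg _).trans (le_max_left _ _), max_le h2 (by linarith [(abs_le.mp h1).2])⟩

theorem pushNorthAux_ne_zero {m : ℕ} {t : ℝ} (ht : t ∈ Icc (0 : ℝ) 1) {x : Fin (m + 1) → ℝ}
    (hx : x ∈ sphere 0 1) : pushNorthAux t x ≠ 0 := by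
  intro h
  obtain ⟨hw0, hw1⟩ := northWeight_mem_Icc hx
  have hb : x 0 + 2 * t * northWeight x = 0 := by simpa [pushNorthAux] using congrFun h 0
  have ha : (1 - t * northWeight x) • Fin.tail x = 0 :=
    (Fin.tail_cons (α := fun _ => ℝ) _ _).symm.trans (congrArg Fin.tail h)
  have hwx : (1 + x 0) / 2 ≤ northWeight x := le_max_right _ _
  obtain ⟨h1, h2, h3⟩ := abs_le_and_tail_le hx
  have h1' := abs_le.mp h1
  rcases smul_eq_zero.mp ha with ha | ha
  · nlinarith
  · rw [ha, norm_zero] at h3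
    have h3' : |x 0| = 1 := h3.resolve_right zero_ne_one
    have hw : northWeight x = (1 + x 0) / 2 := by
      unfold northWeight
      rw [ha, norm_zero]
      exact max_eq_right (by linarith)
    rw [hw] at hb
    rcases (abs_eq zero_le_one).mp h3' with h | h <;> rw [h] at hb <;> nlinarith [ht.1]

theorem pushNorth_mem_sphere {m : ℕ} {t : ℝ} (ht : t ∈ Icc (0 : ℝ) 1) {x : Fin (m + 1) → ℝ}
    (hx : x ∈ sphere 0 1) : pushNorth t x ∈ sphere 0 1 := by
  simp [pushNorth, norm_smul, pushNorthAux_ne_zero ht hx]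

theorem continuousOn_pushNorth {m : ℕ} :
    ContinuousOn (fun p : ℝ × (Fin (m + 1) → ℝ) => pushNorth p.1 p.2)
      (Icc 0 1 ×ˢ sphere 0 1) := by
  have hc := (continuous_pushNorthAux (m := m)).continuousOn (s := Icc 0 1 ×ˢ sphere 0 1)
  exact (hc.norm.inv₀ fun p hp => norm_ne_zero_iff.mpr (pushNorthAux_ne_zero hp.1 hp.2)).smul hc

theorem pushNorth_zero {m : ℕ} {x : Fin (m + 1) → ℝ} (hx : x ∈ sphere 0 1) :
    pushNorth 0 x = x := by
  have h : pushNorthAux 0 x = x := by simp [pushNorthAux]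
  have hx' : ‖x‖ = 1 := by simpa using hx
  rw [pushNorth, h, hx', inv_one, one_smul]

theorem pushNorth_one {m : ℕ} {x : Fin (m + 1) → ℝ} (hx : x ∈ sphere 0 1)
    (h : x 0 = 1 ∨ ‖Fin.tail x‖ = 1) : pushNorth 1 x = Fin.cons 1 0 := by
  have hw : northWeight x = 1 := by
    refine le_antisymm (northWeight_mem_Icc hx).2 ?_
    rcases h with h | h
    · exact le_max_of_le_right (by rw [h]; norm_num)
    · exact le_max_of_le_left h.ge
  have h1 := (abs_le.mp (abs_le_and_tail_le hx).1).1
  have hb : 0 < x 0 + 2 := by linarith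
  have haux : pushNorthAux 1 x = Fin.cons (x 0 + 2) 0 := by simp [pushNorthAux, hw]
  rw [pushNorth, haux, norm_finCons, norm_zero, abs_of_pos hb, max_eq_left hb.le]
  ext i
  refine Fin.cases ?_ (fun j => ?_) i
  · simp [hb.ne']
  · simp

theorem sphereFilling_succ_of_homotopyGroup {m : ℕ}
    (h : ∀ p : Y, Subsingleton (HomotopyGroup (Fin m) Y p)) :
    SphereFilling (m + 1) (univ : Set Y) := by
  rintro f hf -
  set p : Y := f (Fin.cons 1 0)
  set b : (Fin m → I) → (Fin (m + 1) → ℝ) := fun u => Fin.cons (-1) fun i => 2 * (u i : ℝ) - 1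
  have hbS : ∀ u, b u ∈ sphere 0 1 := by
    intro u
    rw [mem_sphere_zero_iff_norm, norm_finCons, abs_neg, abs_one, max_eq_left]
    refine (pi_norm_le_iff_of_nonneg zero_le_one).mpr fun i => ?_
    rw [Real.norm_eq_abs, abs_le]
    constructor <;> linarith [(u i).2.1, (u i).2.2]
  have hbc : Continuous b := by
    refine Continuous.finCons continuous_const ?_
    fun_prop
  have h1 : (1 : ℝ) ∈ Icc (0 : ℝ) 1 := ⟨zero_le_one, le_rfl⟩
  have hloop : Continuous fun u => f (pushNorth 1 (b u)) := by
    refine hf.comp_continuous ?_ fun u => pushNorth_mem_sphere h1 (hbS u)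
    exact continuousOn_pushNorth.comp_continuous
      (f := fun u => ((1 : ℝ), b u)) (by fun_prop) fun u => ⟨h1, hbS u⟩
  let γ : GenLoop (Fin m) Y p := ⟨⟨fun u => f (pushNorth 1 (b u)), hloop⟩, by
    rintro u ⟨i, hi⟩
    refine congrArg f (pushNorth_one (hbS u) (Or.inr (le_antisymm ?_ ?_)))
    · exact (abs_le_and_tail_le (hbS u)).2.1
    · refine le_trans ?_ (norm_le_pi_norm _ i)
      rcases hi with hi | hi <;> norm_num [b, Fin.tail, hi]⟩
  obtain ⟨H⟩ : GenLoop.Homotopic γ GenLoop.const := Quotient.exact ((h p).elim ⟦γ⟧ ⟦GenLoop.const⟧)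
  set e : ℝ → I := fun s => projIcc 0 1 zero_le_one ((s + 1) / 2)
  have he : Continuous e := continuous_projIcc.comp (by fun_prop)
  have he' : ∀ s, |s| ≤ 1 → ((e s : I) : ℝ) = (s + 1) / 2 := fun s hs => by
    have := abs_le.mp hs
    exact congrArg Subtype.val (projIcc_of_mem zero_le_one
      (⟨by linarith, by linarith⟩ : (s + 1) / 2 ∈ Icc (0 : ℝ) 1))
  set g : (Fin (m + 1) → ℝ) → Y := fun x => H (e (x 0), fun i => e (x i.succ)) with hg
  refine exists_extension_of_homotopy (H := fun q => f (pushNorth q.1 q.2)) (g := g)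
    (hf.comp continuousOn_pushNorth fun q hq => pushNorth_mem_sphere hq.1 hq.2)
    (mapsTo_univ _ _) (fun x hx => congrArg f (pushNorth_zero hx)) ?_ ?_ (mapsTo_univ _ _)
  · intro x hx
    obtain ⟨hx0, hxt, hx1⟩ := abs_le_and_tail_le hx
    change f (pushNorth 1 x) = H (e (x 0), fun i => e (x i.succ))
    have hcases : x 0 = -1 ∨ x 0 = 1 ∨ ‖Fin.tail x‖ = 1 := by
      rcases hx1 with h | h
      · rcases (abs_eq zero_le_one).mp h with h | h <;> tauto
      · tauto
    have hxi : ∀ i : Fin m, |x i.succ| ≤ 1 := fun i => (norm_le_pi_norm (Fin.tail x) i).trans hxt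
    rcases hcases with h | h | h
    · have h0 : e (x 0) = 0 := Subtype.ext (by rw [he' _ hx0, h]; norm_num)
      rw [h0, H.apply_zero]
      change _ = f (pushNorth 1 (b _))
      congr 2
      ext i
      refine Fin.cases ?_ (fun j => ?_) i
      · simp [b, h]
      · simp [b, he' _ (hxi j), mul_div_cancel₀]
    · have h0 : e (x 0) = 1 := Subtype.ext (by rw [he' _ hx0, h]; norm_num)
      rw [h0, H.apply_one, pushNorth_one hx (Or.inl h)]
      rfl
    · rw [pushNorth_one hx (Or.inr h)]
      obtain ⟨i, hi⟩ : ∃ i, |x (Fin.succ i)| = 1 := exists_abs_eq_one h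
      have hmem : (fun i : Fin m => e (x i.succ)) ∈ Cube.boundary (Fin m) := by
        refine ⟨i, ?_⟩
        rcases (abs_eq zero_le_one).mp hi with h | h
        · exact Or.inr (Subtype.ext (by rw [he' _ (hxi i), h]; norm_num))
        · exact Or.inl (Subtype.ext (by rw [he' _ (hxi i), h]; norm_num))
      rw [H.eq_fst _ hmem]
      exact (γ.2 _ hmem).symm
  · refine Continuous.continuousOn ?_
    exact (map_continuous H).comp (by fun_prop)

theorem subsingleton_homotopyGroup_of_sphereFilling {m : ℕ}
    (h : SphereFilling (m + 1) (univ : Set Y)) (p : Y) :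
    Subsingleton (HomotopyGroup (Fin m) Y p) := by
  refine ⟨fun a b => ?_⟩
  induction a using Quotient.inductionOn with | _ f =>
  induction b using Quotient.inductionOn with | _ g =>
  refine Quotient.sound ?_
  set e : ℝ → I := fun s => projIcc 0 1 zero_le_one ((s + 1) / 2)
  have he : Continuous e := continuous_projIcc.comp (by fun_prop)
  have he' : ∀ t : I, e (2 * t - 1) = t := fun t => by
    simp [e, mul_div_cancel_left₀]
  have hbd : ∀ x : Fin (m + 1) → ℝ, ‖Fin.tail x‖ = 1 →
      (fun i : Fin m => e (x i.succ)) ∈ Cube.boundary (Fin m) := by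
    intro x h
    obtain ⟨i, hi⟩ : ∃ i, |x (Fin.succ i)| = 1 := exists_abs_eq_one h
    refine ⟨i, ?_⟩
    rcases le_abs'.mp hi.ge with h | h
    · exact Or.inl (projIcc_of_le_left _ (by linarith))
    · exact Or.inr (projIcc_of_right_le _ (by linarith))
  have hcf : Continuous fun x : Fin (m + 1) → ℝ => f fun i => e (x i.succ) :=
    (map_continuous f.1).comp (by fun_prop)
  have hcg : Continuous fun x : Fin (m + 1) → ℝ => g fun i => e (x i.succ) :=
    (map_continuous g.1).comp (by fun_prop)
  set F : (Fin (m + 1) → ℝ) → Y := fun x =>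
    if x ∈ {x : Fin (m + 1) → ℝ | x 0 ≤ 0} ∩ sphere 0 1 then f fun i => e (x i.succ)
    else g fun i => e (x i.succ) with hF
  have hFc : ContinuousOn F (sphere 0 1) := by
    have hU : ({x : Fin (m + 1) → ℝ | x 0 ≤ 0} ∩ sphere 0 1) ∪
        ({x : Fin (m + 1) → ℝ | 0 ≤ x 0} ∩ sphere 0 1) = sphere 0 1 := by
      rw [← union_inter_distrib_right, inter_eq_right]
      exact fun x _ => le_total (x 0) 0
    conv => arg 2; rw [← hU]
    refine ContinuousOn.ite_of_isClosed (A := {x : Fin (m + 1) → ℝ | x 0 ≤ 0} ∩ sphere 0 1)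
      hcf.continuousOn hcg.continuousOn
      ((isClosed_le (continuous_apply _) continuous_const).inter isClosed_sphere)
      ((isClosed_le continuous_const (continuous_apply _)).inter isClosed_sphere) ?_
    rintro x ⟨⟨hx, hxS⟩, ⟨hx', -⟩⟩
    have hx0 : x 0 = 0 := le_antisymm hx hx'
    obtain ⟨-, -, h1⟩ := abs_le_and_tail_le hxS
    have hmem := hbd x (by simpa [hx0] using h1)
    exact (f.2 _ hmem).trans (g.2 _ hmem).symm
  obtain ⟨G, hG, -, hGF⟩ := h F hFc (mapsTo_univ _ _)
  set c : I × (Fin m → I) → (Fin (m + 1) → ℝ) := fun q =>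
    Fin.cons (2 * (q.1 : ℝ) - 1) fun i => 2 * (q.2 i : ℝ) - 1
  have hcc : Continuous c := by
    refine Continuous.finCons (by fun_prop) (by fun_prop)
  have htail : ∀ u : Fin m → I, ‖fun i => 2 * (u i : ℝ) - 1‖ ≤ 1 := fun u =>
    (pi_norm_le_iff_of_nonneg zero_le_one).mpr fun i => by
      rw [Real.norm_eq_abs, abs_le]
      constructor <;> linarith [(u i).2.1, (u i).2.2]
  have habs : ∀ t : I, |2 * (t : ℝ) - 1| ≤ 1 := fun t =>
    abs_le.mpr ⟨by linarith [t.2.1], by linarith [t.2.2]⟩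
  have hcB : ∀ q, c q ∈ closedBall 0 1 := fun q => by
    rw [mem_closedBall_zero_iff, norm_finCons]
    exact max_le (habs _) (htail _)
  have hce : ∀ q : I × (Fin m → I), (fun i => e (c q (Fin.succ i))) = q.2 := fun q => by
    ext i
    simp [c, he']
  have hcS : ∀ q : I × (Fin m → I), |2 * (q.1 : ℝ) - 1| = 1 → c q ∈ sphere 0 1 := fun q hq => by
    rw [mem_sphere_zero_iff_norm, norm_finCons, hq]
    exact max_eq_left (htail _)
  refine ⟨⟨⟨⟨G ∘ c, hG.comp_continuous hcc hcB⟩, fun u => ?_, fun u => ?_⟩, fun t u hu => ?_⟩⟩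
  · have hS := hcS (0, u) (by norm_num)
    have hneg : c (0, u) 0 ≤ 0 := by norm_num [c]
    change G (c (0, u)) = f u
    rw [hGF hS]
    exact (if_pos ⟨hneg, hS⟩).trans (by rw [hce])
  · have hS := hcS (1, u) (by norm_num)
    have hpos : ¬ c (1, u) 0 ≤ 0 := by norm_num [c]
    change G (c (1, u)) = g u
    rw [hGF hS]
    exact (if_neg fun hx => hpos hx.1).trans (by rw [hce])
  · obtain ⟨i, hi⟩ := hu
    have hS : c (t, u) ∈ sphere 0 1 := by
      rw [mem_sphere_zero_iff_norm, norm_finCons]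
      have h1 : ‖fun i => 2 * (u i : ℝ) - 1‖ = 1 := by
        refine le_antisymm (htail u) (le_trans ?_ (norm_le_pi_norm _ i))
        rcases hi with hi | hi <;> norm_num [hi]
      rw [h1]
      exact max_eq_right (habs t)
    change G (c (t, u)) = f u
    rw [hGF hS]
    simp only [hF, hce (t, u)]
    split_ifs
    · rfl
    · exact (g.2 u ⟨i, hi⟩).trans (f.2 u ⟨i, hi⟩).symm

theorem sphereFilling_univ_subtype {X : Type*} [TopologicalSpace X] {k : ℕ}
    {G : Set X} (hne : G.Nonempty) : SphereFilling k (univ : Set G) ↔ SphereFilling k G := by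
  obtain ⟨x₀, hx₀⟩ := hne
  set c : X → G := fun x => if h : x ∈ G then ⟨x, h⟩ else ⟨x₀, hx₀⟩
  have hc : ∀ x ∈ G, (c x : X) = x := fun x hx => by simp [c, hx]
  have key : ∀ {S : Set (Fin k → ℝ)} {f : (Fin k → ℝ) → X}, ContinuousOn f S → MapsTo f S G →
      ContinuousOn (c ∘ f) S := fun hf hfG =>
    Topology.IsInducing.subtypeVal.continuousOn_iff.mpr (hf.congr fun x hx => hc _ (hfG hx))
  constructor
  · intro h f hf hfG
    obtain ⟨g, hg, -, hgf⟩ := h (c ∘ f) (key hf hfG) (mapsTo_univ _ _)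
    refine ⟨fun x => g x, continuous_subtype_val.comp_continuousOn hg, fun x _ => (g x).2, ?_⟩
    intro x hx
    simp only [hgf hx]
    exact hc _ (hfG hx)
  · rintro h f hf -
    obtain ⟨g, hg, hgG, hgf⟩ := h (fun x => f x) (continuous_subtype_val.comp_continuousOn hf)
      fun x _ => (f x).2
    refine ⟨c ∘ g, key hg hgG, mapsTo_univ _ _, fun x hx => Subtype.ext ?_⟩
    simp only [Function.comp_apply]
    rw [hc _ (hgG (sphere_subset_closedBall hx)), hgf hx]

theorem nConnected_coe_iff {X : Type u} [TopologicalSpace X] [Nonempty X] {G : Set X} {n : ℤ} :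
    NConnected n G ↔ ∀ k : ℕ, (k : ℤ) ≤ n + 1 → SphereFilling k G := by
  constructor
  · rintro ⟨h0, h⟩ k hk
    have hne : G.Nonempty := nonempty_coe_sort.mp (h0 (by omega))
    cases k with
    | zero => exact sphereFilling_zero.mpr hne
    | succ m =>
      push_cast at hk
      exact (sphereFilling_univ_subtype hne).mp
        (sphereFilling_succ_of_homotopyGroup (h m (by omega)))
  · intro h
    have hne : -1 ≤ n → G.Nonempty := fun hn =>
      sphereFilling_zero.mp (h 0 (by push_cast; omega))
    refine ⟨fun hn => (hne hn).to_subtype, fun m hm x => ?_⟩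
    exact subsingleton_homotopyGroup_of_sphereFilling
      ((sphereFilling_univ_subtype (hne (by omega))).mpr (h (m + 1) (by push_cast; omega))) x

end HomotopyGroups

section Grid

variable {X : Type*} [TopologicalSpace X]

/-- The closed cell of the integer grid of `ℝᵏ` with lowest corner `c.1` that extends in the
coordinate directions `c.2`. -/
def gridCell {k : ℕ} (c : (Fin k → ℤ) × Finset (Fin k)) : Set (Fin k → ℝ) :=
  {y | ∀ i, (c.1 i : ℝ) ≤ y i ∧ y i ≤ c.1 i + if i ∈ c.2 then 1 else 0}

/-- The relative boundary of a grid cell. -/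
def gridBoundary {k : ℕ} (c : (Fin k → ℤ) × Finset (Fin k)) : Set (Fin k → ℝ) :=
  {y | y ∈ gridCell c ∧ ∃ i ∈ c.2, y i = c.1 i ∨ y i = c.1 i + 1}

variable {k : ℕ} {c c' : (Fin k → ℤ) × Finset (Fin k)} {y z : Fin k → ℝ}

theorem isClosed_gridCell : IsClosed (gridCell c) := by
  simp only [gridCell, ofPred_forall]
  exact isClosed_iInter fun i => (isClosed_le continuous_const (continuous_apply i)).inter
    (isClosed_le (continuous_apply i) continuous_const)

theorem gridCell_apply_le (hy : y ∈ gridCell c) (i : Fin k) : y i ≤ c.1 i + 1 :=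
  (hy i).2.trans (by split_ifs <;> simp)

theorem corner_mem_gridCell : (fun i => (c.1 i : ℝ)) ∈ gridCell c := fun i =>
  ⟨le_rfl, by split_ifs <;> simp⟩

theorem mem_gridBoundary_of_int (hy : y ∈ gridCell c) (hz : z ∈ gridCell c) {i : Fin k} {n : ℤ}
    (hn : y i = n) (hne : z i ≠ y i) : y ∈ gridBoundary c := by
  have hy' := hy i
  have hz' := hz i
  by_cases hi : i ∈ c.2
  · refine ⟨hy, i, hi, ?_⟩
    rw [if_pos hi] at hy'
    rw [hn] at hy' ⊢
    norm_cast at hy' ⊢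
    omega
  · rw [if_neg hi, add_zero] at hy' hz'
    exact absurd (le_antisymm (hz'.2.trans hy'.1) (hy'.2.trans hz'.1)) hne

theorem mem_gridBoundary_of_not_subset (h : ¬ gridCell c ⊆ gridCell c') (hy : y ∈ gridCell c)
    (hy' : y ∈ gridCell c') : y ∈ gridBoundary c := by
  obtain ⟨z, hz, hz'⟩ := not_subset.mp h
  simp only [gridCell, mem_ofPred_eq, not_forall, not_and_or, not_le] at hz'
  obtain ⟨i, hi | hi⟩ := hz'
  · have h1 : (c.1 i : ℝ) < c'.1 i := (hz i).1.trans_lt hi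
    have h2 : ((c.1 i + 1 : ℤ) : ℝ) ≤ c'.1 i := by exact_mod_cast h1
    push_cast at h2
    have h3 := gridCell_apply_le hy i
    exact mem_gridBoundary_of_int hy hz (n := c'.1 i)
      (le_antisymm (h3.trans h2) (hy' i).1) (hi.trans_le (hy' i).1).ne
  · have h1 := hi.trans_le (gridCell_apply_le hz i)
    have hb : ((c'.1 i + if i ∈ c'.2 then 1 else 0 : ℤ) : ℝ) =
        c'.1 i + if i ∈ c'.2 then 1 else 0 := by
      push_cast
      rfl
    have h2 := (hy' i).2
    rw [← hb] at h1 hi h2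
    have h3 : ((c'.1 i + if i ∈ c'.2 then 1 else 0 : ℤ) : ℝ) ≤ c.1 i := by
      exact_mod_cast Int.lt_add_one_iff.mp (by exact_mod_cast h1)
    exact mem_gridBoundary_of_int hy hz (le_antisymm h2 (h3.trans (hy i).1))
      (h2.trans_lt hi).ne'

theorem eq_of_gridCell_subset (h : gridCell c ⊆ gridCell c') (hcard : c'.2.card ≤ c.2.card) :
    c = c' := by
  have h1 := h corner_mem_gridCell
  have h2 : (fun i => (c.1 i : ℝ) + if i ∈ c.2 then 1 else 0) ∈ gridCell c' :=
    h fun i => ⟨by split_ifs <;> simp, le_rfl⟩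
  have hsub : c.2 ⊆ c'.2 := by
    intro i hi
    by_contra hi'
    have h1i := (h1 i).1
    have h2i := (h2 i).2
    simp only [if_pos hi, if_neg hi'] at h1i h2i
    linarith
  have hs : c.2 = c'.2 := Finset.eq_of_subset_of_card_le hsub hcard
  refine Prod.ext (funext fun i => ?_) hs
  have h1i := (h1 i).1
  have h2i := (h2 i).2
  simp only [hs] at h1i h2i
  exact_mod_cast le_antisymm (by linarith : (c.1 i : ℝ) ≤ c'.1 i) h1i

theorem exists_face_of_mem_gridBoundary (hy : y ∈ gridBoundary c) :
    ∃ c' : (Fin k → ℤ) × Finset (Fin k), y ∈ gridCell c' ∧ gridCell c' ⊆ gridCell c ∧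
      c'.2.card < c.2.card := by
  obtain ⟨hyc, i, hi, h⟩ := hy
  have hcard : (c.2.erase i).card < c.2.card := Finset.card_erase_lt_of_mem hi
  rcases h with h | h
  · refine ⟨(c.1, c.2.erase i), fun j => ?_, fun z hz j => ?_, hcard⟩
    · by_cases hj : j = i
      · subst hj
        simp [h]
      · simpa [hj] using hyc j
    · refine ⟨(hz j).1, (hz j).2.trans ?_⟩
      by_cases hj : j = i <;> simp [hj, hi]
  · refine ⟨(Function.update c.1 i (c.1 i + 1), c.2.erase i), fun j => ?_, fun z hz j => ?_, hcard⟩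
    · by_cases hj : j = i
      · subst hj
        simp [h]
      · simpa [hj] using hyc j
    · have hzj := hz j
      by_cases hj : j = i
      · subst hj
        simp only [Function.update_self, Finset.mem_erase, ne_eq, not_true_eq_false, false_and,
          if_false, add_zero, Int.cast_add, Int.cast_one] at hzj
        rw [if_pos hi]
        exact ⟨by linarith, hzj.2⟩
      · simpa [hj] using hzj

theorem exists_extension_gridCell {G : Set X} (hG : SphereFilling c.2.card G)
    {f : (Fin k → ℝ) → X} (hf : ContinuousOn f (gridBoundary c))
    (hfG : MapsTo f (gridBoundary c) G) :
    ∃ g : (Fin k → ℝ) → X, ContinuousOn g (gridCell c) ∧ MapsTo g (gridCell c) G ∧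
      EqOn g f (gridBoundary c) := by
  set e := c.2.equivFin
  set φ : (Fin c.2.card → ℝ) → (Fin k → ℝ) := fun u i =>
    if h : i ∈ c.2 then c.1 i + (u (e ⟨i, h⟩) + 1) / 2 else c.1 i with hφ
  set ψ : (Fin k → ℝ) → (Fin c.2.card → ℝ) := fun x j =>
    2 * (x (e.symm j) - c.1 (e.symm j)) - 1 with hψ
  have hφc : Continuous φ := continuous_pi fun i => by
    by_cases hi : i ∈ c.2
    · simp only [hφ, dif_pos hi]
      fun_prop
    · simp only [hφ, dif_neg hi]
      fun_prop
  have hψc : Continuous ψ := by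
    simp only [hψ]
    fun_prop
  have hφcell : ∀ u ∈ closedBall (0 : Fin c.2.card → ℝ) 1, φ u ∈ gridCell c := by
    intro u hu i
    by_cases hi : i ∈ c.2
    · have := abs_le.mp ((norm_le_pi_norm u (e ⟨i, hi⟩)).trans (mem_closedBall_zero_iff.mp hu))
      simp only [hφ, dif_pos hi, if_pos hi]
      constructor <;> linarith
    · simp [hφ, hi]
  have hφbd : MapsTo φ (sphere 0 1) (gridBoundary c) := by
    intro u hu
    obtain ⟨j, hj⟩ := exists_abs_eq_one (mem_sphere_zero_iff_norm.mp hu)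
    refine ⟨hφcell u (sphere_subset_closedBall hu), e.symm j, (e.symm j).2, ?_⟩
    simp only [hφ, Finset.coe_mem, dif_pos, Subtype.coe_eta, Equiv.apply_symm_apply]
    rcases (abs_eq zero_le_one).mp hj with h | h <;> rw [h] <;> norm_num
  have hψball : MapsTo ψ (gridCell c) (closedBall 0 1) := by
    intro x hx
    rw [mem_closedBall_zero_iff, pi_norm_le_iff_of_nonneg zero_le_one]
    intro j
    have h1 := (hx (e.symm j)).1
    have h2 := gridCell_apply_le hx (e.symm j)
    rw [Real.norm_eq_abs, abs_le]
    constructor <;> simp only [hψ] <;> linarith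
  have hψsph : MapsTo ψ (gridBoundary c) (sphere 0 1) := by
    rintro x ⟨hx, i, hi, h⟩
    rw [mem_sphere_zero_iff_norm]
    refine le_antisymm (mem_closedBall_zero_iff.mp (hψball hx)) ?_
    refine le_trans ?_ (norm_le_pi_norm (ψ x) (e ⟨i, hi⟩))
    rcases h with h | h <;> simp [hψ, h]
    norm_num
  have hφψ : ∀ x ∈ gridCell c, φ (ψ x) = x := by
    intro x hx
    ext i
    by_cases hi : i ∈ c.2
    · simp [hφ, hψ, hi]
    · have := hx i
      rw [if_neg hi, add_zero] at this
      simpa [hφ, hi] using le_antisymm this.1 this.2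
  obtain ⟨g, hg, hgG, hgf⟩ := hG (f ∘ φ) (hf.comp hφc.continuousOn hφbd) (hfG.comp hφbd)
  refine ⟨g ∘ ψ, hg.comp hψc.continuousOn hψball, hgG.comp hψball, fun x hx => ?_⟩
  simp only [Function.comp_apply]
  rw [hgf (hψsph hx), Function.comp_apply, hφψ x hx.1]

/-- The carrier extension principle: a map given on a closed union `D` of cells extends to all
cells of a face-closed family `S`, sending each cell not in `D` to its carrier. -/
theorem exists_carried_extension {D : Set (Fin k → ℝ)} (hD : IsClosed D)
    {Γ : (Fin k → ℤ) × Finset (Fin k) → Set X} {f : (Fin k → ℝ) → X} (hf : ContinuousOn f D)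
    (S : Finset ((Fin k → ℤ) × Finset (Fin k)))
    (hface : ∀ c ∈ S, ∀ c', gridCell c' ⊆ gridCell c → c'.2.card < c.2.card → c' ∈ S)
    (hDbd : ∀ c ∈ S, ¬ gridCell c ⊆ D → D ∩ gridCell c ⊆ gridBoundary c)
    (hfill : ∀ c ∈ S, ¬ gridCell c ⊆ D → SphereFilling c.2.card (Γ c))
    (hfΓ : ∀ c ∈ S, ¬ gridCell c ⊆ D → MapsTo f (D ∩ gridCell c) (Γ c))
    (hmono : ∀ c ∈ S, ∀ c' ∈ S, ¬ gridCell c ⊆ D → ¬ gridCell c' ⊆ D →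
      gridCell c' ⊆ gridCell c → c'.2.card < c.2.card → Γ c' ⊆ Γ c) :
    ∃ F : (Fin k → ℝ) → X, ContinuousOn F (D ∪ ⋃ c ∈ S, gridCell c) ∧ EqOn F f D ∧
      ∀ c ∈ S, ¬ gridCell c ⊆ D → MapsTo F (gridCell c) (Γ c) := by
  induction S using Finset.strongInduction with | H S ih =>
  rcases S.eq_empty_or_nonempty with rfl | hS
  · exact ⟨f, by simpa using hf, eqOn_refl _ _, by simp⟩
  obtain ⟨c, hc, hmax⟩ := S.exists_max_image (fun c => c.2.card) hS
  have hsub : ∀ {c'}, c' ∈ S.erase c → c' ∈ S := fun h => Finset.mem_of_mem_erase h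
  obtain ⟨F, hF, hFf, hFΓ⟩ := ih (S.erase c) (Finset.erase_ssubset hc)
    (fun c₁ h₁ c₂ h₂ h₃ => Finset.mem_erase.mpr
      ⟨fun h => (hmax c₁ (hsub h₁)).not_gt (h ▸ h₃), hface c₁ (hsub h₁) c₂ h₂ h₃⟩)
    (fun c' h => hDbd c' (hsub h)) (fun c' h => hfill c' (hsub h)) (fun c' h => hfΓ c' (hsub h))
    (fun c₁ h₁ c₂ h₂ => hmono c₁ (hsub h₁) c₂ (hsub h₂))
  have hunion : (D ∪ ⋃ c' ∈ S, gridCell c') = gridCell c ∪ (D ∪ ⋃ c' ∈ S.erase c, gridCell c') := by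
    conv_lhs => rw [← Finset.insert_erase hc, Finset.set_biUnion_insert]
    rw [union_left_comm]
  by_cases hcD : gridCell c ⊆ D
  · refine ⟨F, ?_, hFf, fun c' hc' h => hFΓ c' (Finset.mem_erase.mpr ⟨?_, hc'⟩) h⟩
    · rwa [hunion, union_eq_right.mpr (hcD.trans subset_union_left)]
    · rintro rfl
      exact h hcD
  have hbd : gridBoundary c ⊆ D ∪ ⋃ c' ∈ S.erase c, gridCell c' := by
    intro y hy
    obtain ⟨c', hyc', hc', hlt⟩ := exists_face_of_mem_gridBoundary hy
    refine Or.inr (mem_biUnion (Finset.mem_erase.mpr ⟨?_, hface c hc c' hc' hlt⟩) hyc')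
    rintro rfl
    exact hlt.false
  have hinter : gridCell c ∩ (D ∪ ⋃ c' ∈ S.erase c, gridCell c') ⊆ gridBoundary c := by
    rintro y ⟨hyc, hy | hy⟩
    · exact hDbd c hc hcD ⟨hy, hyc⟩
    · obtain ⟨c', hc', hyc'⟩ := mem_iUnion₂.mp hy
      refine mem_gridBoundary_of_not_subset (fun h => ?_) hyc hyc'
      exact Finset.ne_of_mem_erase hc' (eq_of_gridCell_subset h (hmax c' (hsub hc'))).symm
  have hFbd : MapsTo F (gridBoundary c) (Γ c) := by
    intro y hy
    by_cases hyD : y ∈ D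
    · rw [hFf hyD]
      exact hfΓ c hc hcD ⟨hyD, hy.1⟩
    · obtain ⟨c', hyc', hc', hlt⟩ := exists_face_of_mem_gridBoundary hy
      have hc'S := hface c hc c' hc' hlt
      have hc'D : ¬ gridCell c' ⊆ D := fun h => hyD (h hyc')
      refine hmono c hc c' hc'S hcD hc'D hc' hlt (hFΓ c' (Finset.mem_erase.mpr ⟨?_, hc'S⟩) hc'D hyc')
      rintro rfl
      exact hlt.false
  obtain ⟨g, hg, hgΓ, hgF⟩ := exists_extension_gridCell (hfill c hc hcD) (hF.mono hbd) hFbd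
  have hclosed : IsClosed (D ∪ ⋃ c' ∈ S.erase c, gridCell c') :=
    hD.union (isClosed_biUnion_finset fun _ _ => isClosed_gridCell)
  have heq : ∀ y ∈ D ∪ ⋃ c' ∈ S.erase c, gridCell c',
      (if y ∈ gridCell c then g y else F y) = F y := fun y hy => by
    split_ifs with h
    · exact hgF (hinter ⟨h, hy⟩)
    · rfl
  refine ⟨fun y => if y ∈ gridCell c then g y else F y, ?_, ?_, ?_⟩
  · rw [hunion]
    exact ContinuousOn.ite_of_isClosed hg hF isClosed_gridCell hclosed fun y hy => hgF (hinter hy)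
  · exact fun y hy => (heq y (Or.inl hy)).trans (hFf hy)
  · intro c' hc' hc'D y hy
    by_cases h : c' = c
    · subst h
      simpa only [if_pos hy] using hgΓ hy
    · have hc'' := Finset.mem_erase.mpr ⟨h, hc'⟩
      change (if y ∈ gridCell c then g y else F y) ∈ Γ c'
      rw [heq y (Or.inr (mem_biUnion hc'' hy))]
      exact hFΓ c' hc'' hc'D hy

end Grid

section Gluing

variable {X : Type*} [TopologicalSpace X]

/-- The cells of the integer grid that are contained in a box centred at the origin. -/
def gridCells (k M : ℕ) : Finset ((Fin k → ℤ) × Finset (Fin k)) :=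
  {c ∈ (Fintype.piFinset fun _ : Fin k => Finset.Icc (-(M : ℤ)) M) ×ˢ Finset.univ |
    gridCell c ⊆ closedBall 0 M}

variable {k M : ℕ} {c c' : (Fin k → ℤ) × Finset (Fin k)} {y z : Fin k → ℝ}

theorem mem_gridCells : c ∈ gridCells k M ↔ gridCell c ⊆ closedBall 0 M := by
  simp only [gridCells, Finset.mem_filter, Finset.mem_product, Fintype.mem_piFinset,
    Finset.mem_univ, and_true, and_iff_right_iff_imp, Finset.mem_Icc]
  intro h i
  have h1 := mem_closedBall_zero_iff.mp (h corner_mem_gridCell)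
  have h2 := abs_le.mp ((norm_le_pi_norm _ i).trans h1)
  exact ⟨by exact_mod_cast h2.1, by exact_mod_cast h2.2⟩

theorem closedBall_subset_biUnion_gridCells :
    closedBall (0 : Fin k → ℝ) M ⊆ ⋃ c ∈ gridCells k M, gridCell c := by
  intro y hy
  refine mem_biUnion (x := ((fun i => ⌊y i⌋), ({i | (⌊y i⌋ : ℝ) < y i} : Finset (Fin k)))) ?_ ?_
  · refine mem_gridCells.mpr fun z hz => ?_
    rw [mem_closedBall_zero_iff] at hy ⊢
    refine (pi_norm_le_iff_of_nonneg M.cast_nonneg).mpr fun i => abs_le.mpr ?_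
    have hyi := abs_le.mp ((norm_le_pi_norm y i).trans hy)
    have hzi := hz i
    have hfl : ((-M : ℤ) : ℝ) ≤ ⌊y i⌋ := by
      exact_mod_cast Int.le_floor.mpr (by push_cast; exact hyi.1)
    push_cast at hfl
    refine ⟨hfl.trans hzi.1, hzi.2.trans ?_⟩
    simp only [Finset.mem_filter, Finset.mem_univ, true_and]
    split_ifs with h
    · have : (⌊y i⌋ : ℝ) < (M : ℤ) := by
        push_cast
        exact h.trans_le hyi.2
      exact_mod_cast this
    · rw [add_zero]
      exact (Int.floor_le _).trans hyi.2
  · intro i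
    refine ⟨Int.floor_le _, ?_⟩
    simp only [Finset.mem_filter, Finset.mem_univ, true_and]
    split_ifs with h
    · exact (Int.lt_floor_add_one _).le
    · simpa using h

theorem norm_sub_le_one_of_mem_gridCell (hy : y ∈ gridCell c) (hz : z ∈ gridCell c) :
    ‖y - z‖ ≤ 1 := by
  refine (pi_norm_le_iff_of_nonneg zero_le_one).mpr fun i => abs_le.mpr ?_
  have h1 := (hy i).1
  have h2 := (hz i).1
  have h3 := gridCell_apply_le hy i
  have h4 := gridCell_apply_le hz i
  rw [Pi.sub_apply]
  constructor <;> linarith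

theorem exists_lt_abs_of_not_subset_closedBall (h : ¬ gridCell c ⊆ closedBall 0 M) :
    ∃ z ∈ gridCell c, ∃ i, (M : ℝ) < |z i| := by
  obtain ⟨z, hz, hzM⟩ := not_subset.mp h
  refine ⟨z, hz, ?_⟩
  by_contra! hle
  exact hzM (mem_closedBall_zero_iff.mpr
    ((pi_norm_le_iff_of_nonneg M.cast_nonneg).mpr hle))

theorem le_norm_of_not_subset_closedBall (h : ¬ gridCell c ⊆ closedBall 0 M)
    (hy : y ∈ gridCell c) : (M : ℝ) ≤ ‖y‖ := by
  obtain ⟨z, hz, i, hi⟩ := exists_lt_abs_of_not_subset_closedBall h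
  refine le_trans ?_ (norm_le_pi_norm y i)
  rw [Real.norm_eq_abs]
  rcases lt_abs.mp hi with hi | hi
  · have h1 : ((M : ℤ) : ℝ) < ((c.1 i + 1 : ℤ) : ℝ) := by
      push_cast
      exact hi.trans_le (gridCell_apply_le hz i)
    have h2 : ((M : ℤ) : ℝ) ≤ c.1 i := by
      exact_mod_cast Int.lt_add_one_iff.mp (by exact_mod_cast h1)
    push_cast at h2
    exact (h2.trans (hy i).1).trans (le_abs_self _)
  · have h1 : ((c.1 i : ℤ) : ℝ) < ((-M : ℤ) : ℝ) := by
      push_cast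
      linarith [(hz i).1]
    have h2 : ((c.1 i + 1 : ℤ) : ℝ) ≤ ((-M : ℤ) : ℝ) := by exact_mod_cast h1
    push_cast at h2
    exact (by linarith [gridCell_apply_le hy i] : (M : ℝ) ≤ -y i).trans (neg_le_abs _)

theorem mem_gridBoundary_of_mem_closedBall (h : ¬ gridCell c ⊆ closedBall 0 M)
    (hy : y ∈ gridCell c) (hyM : y ∈ closedBall 0 M) : y ∈ gridBoundary c := by
  obtain ⟨z, hz, i, hi⟩ := exists_lt_abs_of_not_subset_closedBall h
  -- the coordinate of `y` at `i` is forced to be `±M`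
  have hyi : |y i| ≤ M := (norm_le_pi_norm y i).trans (mem_closedBall_zero_iff.mp hyM)
  have hne : z i ≠ y i := fun h => (h ▸ hi).not_ge hyi
  have hyi' := abs_le.mp hyi
  have h3 := hy i
  have h4 := hz i
  rcases lt_abs.mp hi with hi | hi
  · have h1 : ((M : ℤ) : ℝ) < ((c.1 i + 1 : ℤ) : ℝ) := by
      push_cast
      exact hi.trans_le (gridCell_apply_le hz i)
    have h2 : ((M : ℤ) : ℝ) ≤ c.1 i := by
      exact_mod_cast Int.lt_add_one_iff.mp (by exact_mod_cast h1)
    exact mem_gridBoundary_of_int hy hz (n := M)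
      (le_antisymm (by exact_mod_cast hyi'.2) (h2.trans h3.1)) hne
  · have h1 : ((c.1 i : ℤ) : ℝ) < ((-M : ℤ) : ℝ) := by
      push_cast
      linarith
    have h2 : ((c.1 i + 1 : ℤ) : ℝ) ≤ ((-M : ℤ) : ℝ) := by exact_mod_cast h1
    push_cast at h2
    refine mem_gridBoundary_of_int hy hz (n := -M) (le_antisymm ?_ ?_) hne
    · push_cast
      linarith [gridCell_apply_le hy i]
    · push_cast
      linarith

theorem mem_gridBoundary_of_mem_sphere (hc : gridCell c ⊆ closedBall 0 M)
    (h : ¬ gridCell c ⊆ sphere 0 M) (hM : 0 < M) (hy : y ∈ gridCell c)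
    (hyM : y ∈ sphere 0 M) : y ∈ gridBoundary c := by
  obtain ⟨z, hz, hzM⟩ := not_subset.mp h
  have hM' : (0 : ℝ) < M := by exact_mod_cast hM
  have hzlt : ‖z‖ < M := lt_of_le_of_ne (mem_closedBall_zero_iff.mp (hc hz))
    fun h => hzM (mem_sphere_zero_iff_norm.mpr h)
  obtain ⟨i, hi⟩ : ∃ i, |y i| = M := by
    by_contra! hne
    have hyn := mem_sphere_zero_iff_norm.mp hyM
    exact ((pi_norm_lt_iff hM').mpr fun i =>
      lt_of_le_of_ne ((norm_le_pi_norm y i).trans hyn.le) (hne i)).ne hyn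
  have hne : z i ≠ y i := fun h => by
    have := (norm_le_pi_norm z i).trans_lt hzlt
    rw [h, Real.norm_eq_abs, hi] at this
    exact this.false
  rcases (abs_eq hM'.le).mp hi with h | h
  · exact mem_gridBoundary_of_int hy hz (n := M) (by exact_mod_cast h) hne
  · exact mem_gridBoundary_of_int hy hz (n := -M) (by push_cast; exact h) hne

theorem norm_normalize_sub_le {E : Type*} [NormedAddCommGroup E] [NormedSpace ℝ E] {y z : E}
    (hy : 0 < ‖y‖) (hz : 0 < ‖z‖) : ‖‖y‖⁻¹ • y - ‖z‖⁻¹ • z‖ ≤ 2 * ‖y - z‖ / ‖y‖ := by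
  have h : ‖y‖⁻¹ • y - ‖z‖⁻¹ • z = ‖y‖⁻¹ • (y - z) + (‖y‖⁻¹ - ‖z‖⁻¹) • z := by
    rw [smul_sub, sub_smul]
    abel
  have h2 : ‖(‖y‖⁻¹ - ‖z‖⁻¹) • z‖ = |‖z‖ - ‖y‖| / ‖y‖ := by
    rw [norm_smul, inv_sub_inv hy.ne' hz.ne', Real.norm_eq_abs, abs_div, abs_mul, abs_norm,
      abs_norm]
    field_simp
  rw [h]
  refine (norm_add_le _ _).trans ?_
  rw [h2, norm_smul, norm_inv, norm_norm, two_mul, add_div]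
  gcongr
  · rw [inv_mul_eq_div]
  · rw [norm_sub_rev y z]
    exact abs_norm_sub_norm_le z y

/-- A fillable space covered by two relatively open fillable sets, whose intersection is fillable
in dimensions one lower, is fillable. -/
theorem sphereFilling_of_isOpen_cover {G O₁ O₂ : Set X} (hO₁ : IsOpen O₁) (hO₂ : IsOpen O₂)
    (hcover : G ⊆ O₁ ∪ O₂) (h₁ : ∀ j ≤ k, SphereFilling j (G ∩ O₁))
    (h₂ : ∀ j ≤ k, SphereFilling j (G ∩ O₂))
    (h₁₂ : ∀ j < k, SphereFilling j (G ∩ (O₁ ∩ O₂))) : SphereFilling k G := by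
  intro f hf hfG
  have : Nonempty X := ⟨f 0⟩
  rcases Nat.eq_zero_or_pos k with rfl | hk
  · have hne := (sphereFilling_zero.mp (h₁ 0 le_rfl)).mono inter_subset_left
    exact sphereFilling_zero.mpr hne f hf hfG
  obtain ⟨x₀, hx₀G, hx₀⟩ := sphereFilling_zero.mp (h₁₂ 0 hk)
  obtain ⟨u₁, hu₁, hfu₁⟩ := continuousOn_iff'.mp hf O₁ hO₁
  obtain ⟨u₂, hu₂, hfu₂⟩ := continuousOn_iff'.mp hf O₂ hO₂
  obtain ⟨δ, hδ, hball⟩ := lebesgue_number_lemma_of_metric (c := fun b : Bool => cond b u₁ u₂)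
    (isCompact_sphere (0 : Fin k → ℝ) 1) (by rintro (_ | _) <;> assumption) (by
      intro x hx
      rcases hcover (hfG hx) with h | h
      · exact mem_iUnion.mpr ⟨true, (hfu₁.subset ⟨h, hx⟩).1⟩
      · exact mem_iUnion.mpr ⟨false, (hfu₂.subset ⟨h, hx⟩).1⟩)
  obtain ⟨N, hN⟩ := exists_nat_gt (2 / δ)
  have hN0 : (0 : ℝ) < N := (by positivity : (0 : ℝ) < 2 / δ).trans hN
  have hN0' : 0 < N := by exact_mod_cast hN0
  have hNδ : 2 / (N : ℝ) < δ := by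
    rw [div_lt_iff₀ hδ] at hN
    rw [div_lt_iff₀ hN0]
    linarith
  set ρ : (Fin k → ℝ) → (Fin k → ℝ) := fun y => ‖y‖⁻¹ • y with hρ
  have hρS : ∀ y : Fin k → ℝ, N ≤ ‖y‖ → ρ y ∈ sphere 0 1 := fun y hy => by
    have : ‖y‖ ≠ 0 := (hN0.trans_le hy).ne'
    simp [hρ, norm_smul, this]
  set D : Set (Fin k → ℝ) := closedBall 0 N ∪ sphere 0 (2 * N : ℕ) with hD
  have hsph : ∀ y ∈ sphere (0 : Fin k → ℝ) (2 * N : ℕ), ‖y‖ = 2 * N := fun y hy => by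
    simpa using hy
  set f₀ : (Fin k → ℝ) → X := fun y => if y ∈ closedBall (0 : Fin k → ℝ) N then x₀ else f (ρ y)
    with hf₀
  have hf₀c : ContinuousOn f₀ D := by
    refine ContinuousOn.ite_of_isClosed continuousOn_const (hf.comp ?_ ?_) isClosed_closedBall
      isClosed_sphere ?_
    · refine ContinuousOn.smul (continuous_norm.continuousOn.inv₀ fun y hy => ?_) continuousOn_id
      rw [hsph y hy]
      positivity
    · intro y hy
      refine hρS y ?_
      rw [hsph y hy]
      linarith
    · rintro y ⟨hy, hy'⟩
      have := hsph y hy'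
      have := mem_closedBall_zero_iff.mp hy
      linarith
  set S := gridCells k (2 * N)
  have hann : ∀ c : (Fin k → ℤ) × Finset (Fin k), ¬ gridCell c ⊆ D → ∀ y ∈ gridCell c, N ≤ ‖y‖ :=
    fun c hc y hy => le_norm_of_not_subset_closedBall (fun h => hc (h.trans subset_union_left)) hy
  have hsmall : ∀ c : (Fin k → ℤ) × Finset (Fin k), ¬ gridCell c ⊆ D →
      MapsTo (f ∘ ρ) (gridCell c) O₁ ∨ MapsTo (f ∘ ρ) (gridCell c) O₂ := by
    intro c hc
    have hcorner := hann c hc _ corner_mem_gridCell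
    have hclose : ∀ y ∈ gridCell c, ρ y ∈ ball (ρ fun i => (c.1 i : ℝ)) δ := fun y hy => by
      rw [mem_ball, dist_eq_norm]
      have hyN := hann c hc y hy
      refine (norm_normalize_sub_le (hN0.trans_le hyN) (hN0.trans_le hcorner)).trans_lt
        (lt_of_le_of_lt ?_ hNδ)
      have := norm_sub_le_one_of_mem_gridCell hy corner_mem_gridCell
      gcongr
      linarith
    obtain ⟨b, hb⟩ := hball _ (hρS _ hcorner)
    cases b
    · exact Or.inr fun y hy => (hfu₂.superset ⟨hb (hclose y hy), hρS y (hann c hc y hy)⟩).1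
    · exact Or.inl fun y hy => (hfu₁.superset ⟨hb (hclose y hy), hρS y (hann c hc y hy)⟩).1
  set Γ : (Fin k → ℤ) × Finset (Fin k) → Set X := fun c =>
    if c.2.card < k then {x ∈ G | (MapsTo (f ∘ ρ) (gridCell c) O₁ → x ∈ O₁) ∧
      (MapsTo (f ∘ ρ) (gridCell c) O₂ → x ∈ O₂)}
    else if MapsTo (f ∘ ρ) (gridCell c) O₁ then G ∩ O₁ else G ∩ O₂ with hΓ
  have hΓG : ∀ c, Γ c ⊆ G := by
    intro c
    simp only [hΓ]
    split_ifs
    exacts [fun x hx => hx.1, inter_subset_left, inter_subset_left]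
  have hmem : ∀ (c : (Fin k → ℤ) × Finset (Fin k)) (x : X), ¬ gridCell c ⊆ D → x ∈ G →
      (MapsTo (f ∘ ρ) (gridCell c) O₁ → x ∈ O₁) → (MapsTo (f ∘ ρ) (gridCell c) O₂ → x ∈ O₂) →
      x ∈ Γ c := by
    intro c x hc hx hx₁ hx₂
    simp only [hΓ]
    split_ifs with h h'
    · exact ⟨hx, hx₁, hx₂⟩
    · exact ⟨hx, hx₁ h'⟩
    · exact ⟨hx, hx₂ ((hsmall c hc).resolve_left h')⟩
  have hf₀G : MapsTo f₀ D G := by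
    intro y hy
    simp only [hf₀]
    split_ifs with h
    · exact hx₀G
    · exact hfG (hρS y (not_le.mp fun h' => h (mem_closedBall_zero_iff.mpr h')).le)
  obtain ⟨F, hF, hFf₀, hFΓ⟩ := exists_carried_extension
    (isClosed_closedBall.union isClosed_sphere) (Γ := Γ) hf₀c S
    (fun c hc c' hc' _ => mem_gridCells.mpr (hc'.trans (mem_gridCells.mp hc)))
    (by
      rintro c hc hcD y ⟨hy | hy, hyc⟩
      · exact mem_gridBoundary_of_mem_closedBall (fun h => hcD (h.trans subset_union_left)) hyc hy
      · exact mem_gridBoundary_of_mem_sphere (mem_gridCells.mp hc)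
          (fun h => hcD (h.trans subset_union_right)) (by omega) hyc hy)
    (by
      intro c hc hcD
      have hcard : c.2.card ≤ k := (Finset.card_le_univ _).trans_eq (Fintype.card_fin k)
      simp only [hΓ]
      split_ifs with h h'
      · by_cases hO₁ : MapsTo (f ∘ ρ) (gridCell c) O₁ <;>
          by_cases hO₂ : MapsTo (f ∘ ρ) (gridCell c) O₂
        · simp only [hO₁, hO₂, true_imp_iff]
          exact h₁₂ _ h
        · simp only [hO₁, hO₂, true_imp_iff, false_imp_iff, and_true]
          exact h₁ _ hcard
        · simp only [hO₁, hO₂, true_imp_iff, false_imp_iff, true_and]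
          exact h₂ _ hcard
        · exact ((hsmall c hcD).elim hO₁ hO₂).elim
      · exact h₁ _ hcard
      · exact h₂ _ hcard)
    (by
      rintro c hc hcD y ⟨hyD, hyc⟩
      refine hmem c _ hcD (hf₀G hyD) (fun h => ?_) fun h => ?_ <;>
      · simp only [hf₀]
        split_ifs
        · first | exact hx₀.1 | exact hx₀.2
        · exact h hyc)
    (by
      intro c hc c' hc' hcD hcD' hsub hlt x hx
      have hcard : c.2.card ≤ k := (Finset.card_le_univ _).trans_eq (Fintype.card_fin k)
      simp only [hΓ, if_pos (hlt.trans_le hcard)] at hx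
      exact hmem c x hcD hx.1 (fun h => hx.2.1 (h.mono_left hsub))
        fun h => hx.2.2 (h.mono_left hsub))
  have hscale : MapsTo (fun x : Fin k → ℝ => (2 * N : ℝ) • x) (closedBall 0 1)
      (closedBall 0 (2 * N : ℕ)) := by
    intro x hx
    rw [mem_closedBall_zero_iff] at hx ⊢
    rw [norm_smul, Real.norm_of_nonneg (by positivity)]
    push_cast
    nlinarith
  have hbox : closedBall (0 : Fin k → ℝ) (2 * N : ℕ) ⊆ D ∪ ⋃ c ∈ S, gridCell c :=
    closedBall_subset_biUnion_gridCells.trans subset_union_right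
  refine ⟨fun x => F ((2 * N : ℝ) • x), hF.comp (by fun_prop) (hscale.mono_right hbox), ?_, ?_⟩
  · intro x hx
    obtain ⟨c, hc, hxc⟩ := mem_iUnion₂.mp (closedBall_subset_biUnion_gridCells (hscale hx))
    by_cases hcD : gridCell c ⊆ D
    · change F ((2 * N : ℝ) • x) ∈ G
      rw [hFf₀ (hcD hxc)]
      exact hf₀G (hcD hxc)
    · exact hΓG c (hFΓ c hc hcD hxc)
  · intro x hx
    have hx1 : ‖x‖ = 1 := mem_sphere_zero_iff_norm.mp hx
    have hnorm : ‖(2 * N : ℝ) • x‖ = 2 * N := by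
      rw [norm_smul, hx1, mul_one, Real.norm_of_nonneg (by positivity)]
    have hxD : (2 * N : ℝ) • x ∈ D := Or.inr (by simp [norm_smul, hx1])
    have hxN : (2 * N : ℝ) • x ∉ closedBall (0 : Fin k → ℝ) N := by
      rw [mem_closedBall_zero_iff, hnorm]
      linarith
    have hρx : ρ ((2 * N : ℝ) • x) = x := by
      simp only [hρ]
      rw [hnorm, smul_smul, inv_mul_cancel₀ (by positivity), one_smul]
    change F ((2 * N : ℝ) • x) = f x
    rw [hFf₀ hxD]
    simp only [hf₀, if_neg hxN, hρx]

end Gluing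

end

section Polyhedron

variable {W : Type*}

/-- The functions that are barycentric coordinates of a point of the simplex with vertex set `s`. -/
def barycentric (s : Finset W) : Set (W → ℝ) :=
  {f | (∀ v ∉ s, f v = 0) ∧ (∀ v, 0 ≤ f v) ∧ ∑ v ∈ s, f v = 1}

variable {s t : Finset W} {f g : W → ℝ} {w : W}

theorem convex_barycentric : Convex ℝ (barycentric s) := by
  rintro f ⟨hf, hf0, hf1⟩ g ⟨hg, hg0, hg1⟩ a b ha hb hab
  refine ⟨fun v hv => ?_, fun v => ?_, ?_⟩
  · simp [hf v hv, hg v hv]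
  · have := hf0 v
    have := hg0 v
    simp only [Pi.add_apply, Pi.smul_apply, smul_eq_mul]
    positivity
  · simp [Finset.sum_add_distrib, ← Finset.mul_sum, hf1, hg1, hab]

theorem segment_mem_barycentric (hf : f ∈ barycentric s) (hg : g ∈ barycentric s) {t : ℝ}
    (ht : t ∈ Icc (0 : ℝ) 1) : (1 - t) • f + t • g ∈ barycentric s :=
  convex_barycentric hf hg (sub_nonneg.mpr ht.2) ht.1 (sub_add_cancel 1 t)

theorem barycentric_mono (h : s ⊆ t) : barycentric s ⊆ barycentric t := by
  rintro f ⟨hf, hf0, hf1⟩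
  exact ⟨fun v hv => hf v fun hs => hv (h hs), hf0,
    (Finset.sum_subset h fun v _ hv => hf v hv).symm.trans hf1⟩

theorem mem_of_barycentric (hf : f ∈ barycentric s) (hw : f w ≠ 0) : w ∈ s :=
  not_not.mp fun h => hw (hf.1 w h)

theorem sum_eq_one_of_barycentric (hf : f ∈ barycentric s) (h : ∀ v ∉ t, f v = 0) :
    ∑ v ∈ t, f v = 1 := by
  rw [← hf.2.2, Finset.sum_subset (Finset.subset_union_left (s₁ := t) (s₂ := s)),
    ← Finset.sum_subset (Finset.subset_union_right (s₁ := t) (s₂ := s))]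
  · exact fun v _ hv => hf.1 v hv
  · exact fun v _ hv => h v hv

theorem barycentric_of_support (hf : f ∈ barycentric s) (h : ∀ v ∉ t, f v = 0) :
    f ∈ barycentric t :=
  ⟨h, hf.2.1, sum_eq_one_of_barycentric hf h⟩

theorem sum_le_one_of_barycentric (hf : f ∈ barycentric s) (t : Finset W) :
    ∑ v ∈ t, f v ≤ 1 := by
  rw [← sum_eq_one_of_barycentric hf (t := t ∪ s)
    fun v hv => hf.1 v fun h => hv (Finset.mem_union_right _ h)]
  exact Finset.sum_le_sum_of_subset_of_nonneg Finset.subset_union_left fun v _ _ => hf.2.1 v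

theorem single_mem_barycentric [DecidableEq W] (hw : w ∈ s) : Pi.single w 1 ∈ barycentric s := by
  refine ⟨fun v hv => Pi.single_eq_of_ne (ne_of_mem_of_not_mem hw hv).symm 1, fun v => ?_, ?_⟩
  · by_cases h : v = w
    · subst h; simp
    · simp [Pi.single_eq_of_ne h]
  · simp [hw]

/-- The set of points of the geometric realization of `K`, as a subset of `W → ℝ`. -/
def AbsSC.polyhedron (K : AbsSC W) : Set (W → ℝ) :=
  {f | ∃ s ∈ K.faces, f ∈ barycentric s}

variable {K : AbsSC W}

/-- A map from a compact set to the realization of a finite-dimensional complex can be pushed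
into finitely many simplices, without leaving the carrier of any point. -/
theorem exists_finset_support {Y : Type*} [TopologicalSpace Y] {Z : Set Y} {F : Y → W → ℝ}
    {D : ℕ} (hZ : IsCompact Z) (hF : ContinuousOn F Z) (hFK : MapsTo F Z K.polyhedron)
    (hD : ∀ s ∈ K.faces, s.card ≤ D) :
    ∃ S : Finset W, ∃ G : Y → W → ℝ, ContinuousOn G Z ∧ ∀ z ∈ Z, (∀ a ∉ S, G z a = 0) ∧
      ∀ s, F z ∈ barycentric s → G z ∈ barycentric s := by
  have hFa : ∀ a, ContinuousOn (fun z => F z a) Z := fun a => continuousOn_pi.mp hF a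
  set ε : ℝ := 1 / (D + 1) with hε
  have hε0 : 0 < ε := by positivity
  obtain ⟨S, hS⟩ : ∃ S : Finset W, ∀ z ∈ Z, ∀ a ∉ S, F z a ≤ ε := by
    refine hZ.induction_on (p := fun T => ∃ S : Finset W, ∀ z ∈ T, ∀ a ∉ S, F z a ≤ ε)
      ⟨∅, by simp⟩ (fun T T' h ⟨S, hS⟩ => ⟨S, fun z hz => hS z (h hz)⟩) ?_ fun z hz => ?_
    · rintro T T' ⟨S, hS⟩ ⟨S', hS'⟩
      refine ⟨S ∪ S', ?_⟩
      rintro z (hz | hz) a ha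
      · exact hS z hz a fun h => ha (Finset.mem_union_left _ h)
      · exact hS' z hz a fun h => ha (Finset.mem_union_right _ h)
    · obtain ⟨s, -, hs⟩ := hFK hz
      have hc : ContinuousOn (fun y => ∑ a ∈ s, F y a) Z :=
        continuousOn_finsetSum s fun a _ => hFa a
      have hlt : 1 - ε < ∑ a ∈ s, F z a := by
        rw [hs.2.2]
        linarith
      refine ⟨{y | 1 - ε < ∑ a ∈ s, F y a} ∩ Z,
        Filter.inter_mem ((hc z hz).eventually (lt_mem_nhds hlt)) self_mem_nhdsWithin, s, ?_⟩
      rintro y ⟨hy, hyZ⟩ a ha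
      obtain ⟨s', -, hs'⟩ := hFK hyZ
      have := sum_le_one_of_barycentric hs' (insert a s)
      rw [Finset.sum_insert ha] at this
      have hy' : 1 - ε < ∑ a ∈ s, F y a := hy
      linarith
  set M : Y → W → ℝ := fun z a => max (F z a - ε) 0 with hM
  have hM0 : ∀ z a, 0 ≤ M z a := fun z a => le_max_right _ _
  have hMS : ∀ z ∈ Z, ∀ a ∉ S, M z a = 0 := fun z hz a ha =>
    max_eq_right (sub_nonpos.mpr (hS z hz a ha))
  have hMF : ∀ z a, F z a = 0 → M z a = 0 := fun z a h =>
    max_eq_right (by rw [h]; linarith)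
  have hpos : ∀ z ∈ Z, 0 < ∑ a ∈ S, M z a := by
    intro z hz
    obtain ⟨s, hsK, hs⟩ := hFK hz
    obtain ⟨a, -, ha⟩ : ∃ a ∈ s, ε < F z a := by
      by_contra! h
      have h1 := Finset.sum_le_card_nsmul s (F z) ε h
      rw [hs.2.2, nsmul_eq_mul] at h1
      have h2 : (s.card : ℝ) ≤ D := by exact_mod_cast hD s hsK
      have h3 : (D + 1) * ε = 1 := by rw [hε]; field_simp
      nlinarith
    have haM : 0 < M z a := lt_max_of_lt_left (sub_pos.mpr ha)
    have haS : a ∈ S := not_not.mp fun h => haM.ne' (hMS z hz a h)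
    exact haM.trans_le (Finset.single_le_sum (fun b _ => hM0 z b) haS)
  have hMc : ∀ a, ContinuousOn (fun z => M z a) Z := fun a =>
    ((hFa a).sub continuousOn_const).sup continuousOn_const
  refine ⟨S, fun z a => M z a / ∑ b ∈ S, M z b, continuousOn_pi.mpr fun a =>
    (hMc a).div (continuousOn_finsetSum S fun b _ => hMc b) fun z hz => (hpos z hz).ne',
    fun z hz => ⟨fun a ha => ?_, fun s hs => ⟨fun a ha => ?_, fun a => ?_, ?_⟩⟩⟩
  · simp [hMS z hz a ha]
  · simp [hMF z a (hs.1 a ha)]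
  · exact div_nonneg (hM0 z a) (hpos z hz).le
  · rw [← Finset.sum_div, div_eq_one_iff_eq (hpos z hz).ne',
      Finset.sum_subset (Finset.subset_union_left (s₁ := s) (s₂ := S)),
      ← Finset.sum_subset (Finset.subset_union_right (s₁ := s) (s₂ := S))]
    · exact fun a _ ha => hMS z hz a ha
    · exact fun a _ ha => hMF z a (hs.1 a ha)

theorem nConnected_realization_iff {W : Type u} {K : AbsSC W} {n : ℤ} :
    NConnected n K.realization ↔ ∀ k : ℕ, (k : ℤ) ≤ n + 1 → SphereFilling k K.polyhedron :=
  nConnected_coe_iff (G := K.polyhedron)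

end Polyhedron

/-- A set that is star-shaped with respect to one of its points has all sphere fillings. -/
theorem sphereFilling_of_star {E : Type*} [AddCommGroup E] [Module ℝ E] [TopologicalSpace E]
    [ContinuousAdd E] [ContinuousSMul ℝ E] {k : ℕ} {G : Set E} {x₀ : E} (hx₀ : x₀ ∈ G)
    (h : ∀ x ∈ G, ∀ t ∈ Icc (0 : ℝ) 1, (1 - t) • x + t • x₀ ∈ G) : SphereFilling k G :=
  fun _ hf hfG => exists_extension_of_segment hf (fun _ hx => h _ (hfG hx))
    continuousOn_const fun _ _ => hx₀

section Inflation

variable {V : Type u} {P : V → Type v} {K : AbsSC V}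

theorem AbsSC.mem_link {W : Type*} [hW : DecidableEq W] {K : AbsSC W} {σ τ : Finset W} :
    τ ∈ (K.link σ).faces ↔ τ ∪ σ ∈ K.faces ∧ Disjoint τ σ := by
  obtain rfl : hW = fun a b => Classical.propDecidable (a = b) := Subsingleton.elim _ _
  rw [Finset.disjoint_iff_inter_eq_empty]
  rfl

theorem AbsSC.ext_faces {K L : AbsSC V} (h : ∀ s, s ∈ K.faces ↔ s ∈ L.faces) : K = L := by
  cases K
  cases L
  congr
  exact Set.ext h

theorem AbsSC.link_link {σ τ : Finset V} (h : Disjoint τ σ) :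
    (K.link σ).link τ = K.link (τ ∪ σ) := by
  refine AbsSC.ext_faces fun ρ => ?_
  simp only [AbsSC.mem_link, Finset.union_assoc, Finset.disjoint_union_left,
    Finset.disjoint_union_right, h, and_true]
  tauto

theorem AbsSC.link_empty : K.link ∅ = K :=
  AbsSC.ext_faces fun ρ => by simp [AbsSC.mem_link]

theorem mem_inflation {τ : Finset ((v : V) × P v)} :
    τ ∈ (inflation K P).faces ↔ τ.image Sigma.fst ∈ K.faces ∧ Set.InjOn Sigma.fst (τ : Set ((v : V) × P v)) :=
  and_congr_right fun _ => ⟨fun h _ ha _ hb => h _ ha _ hb, fun h _ ha _ hb => h ha hb⟩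

/-- The lift of a set of vertices along a choice `q` of a copy of each vertex. -/
def sectionImage (q : ∀ v, P v) (σ : Finset V) : Finset ((v : V) × P v) :=
  σ.image fun v => ⟨v, q v⟩

theorem mem_sectionImage {q : ∀ v, P v} {σ : Finset V} {a : (v : V) × P v} :
    a ∈ sectionImage q σ ↔ a.1 ∈ σ ∧ a.2 = q a.1 := by
  obtain ⟨v, p⟩ := a
  simp only [sectionImage, Finset.mem_image, Sigma.mk.injEq]
  constructor
  · rintro ⟨v, hv, rfl, h⟩
    exact ⟨hv, (eq_of_heq h).symm⟩
  · rintro ⟨hv, rfl⟩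
    exact ⟨v, hv, rfl, HEq.rfl⟩

theorem sectionImage_injective (q : ∀ v, P v) :
    Function.Injective fun v => (⟨v, q v⟩ : (v : V) × P v) :=
  fun _ _ h => congrArg Sigma.fst h

theorem image_fst_sectionImage (q : ∀ v, P v) (σ : Finset V) :
    (sectionImage q σ).image Sigma.fst = σ := by
  simp [sectionImage, Finset.image_image, Function.comp_def]

theorem sectionImage_mem_inflation (q : ∀ v, P v) {σ : Finset V} (hσ : σ ∈ K.faces) :
    sectionImage q σ ∈ (inflation K P).faces := by
  rw [mem_inflation, image_fst_sectionImage]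
  refine ⟨hσ, ?_⟩
  rintro ⟨v, p⟩ ha ⟨w, p'⟩ hb (rfl : v = w)
  have hp : p = q v := (mem_sectionImage.mp ha).2
  have hp' : p' = q v := (mem_sectionImage.mp hb).2
  rw [hp, hp']

theorem card_sectionImage (q : ∀ v, P v) (σ : Finset V) : (sectionImage q σ).card = σ.card :=
  Finset.card_image_of_injective σ (sectionImage_injective q)

theorem exists_card_inflation (q : ∀ v, P v) {n : ℕ} :
    (∃ s ∈ (inflation K P).faces, s.card = n) ↔ ∃ s ∈ K.faces, s.card = n := by
  constructor
  · rintro ⟨s, hs, h⟩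
    rw [mem_inflation] at hs
    exact ⟨_, hs.1, (Finset.card_image_of_injOn hs.2).trans h⟩
  · rintro ⟨s, hs, h⟩
    exact ⟨_, sectionImage_mem_inflation q hs, (card_sectionImage q s).trans h⟩

theorem forall_card_inflation (q : ∀ v, P v) {p : ℕ → Prop} :
    (∀ s ∈ (inflation K P).faces, p s.card) ↔ ∀ s ∈ K.faces, p s.card := by
  constructor
  · intro h s hs
    exact card_sectionImage q s ▸ h _ (sectionImage_mem_inflation q hs)
  · intro h s hs
    obtain ⟨t, ht, hts⟩ := (exists_card_inflation q).mp ⟨s, hs, rfl⟩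
    exact hts ▸ h t ht

theorem link_inflation {σ : Finset ((v : V) × P v)} (hσ : σ ∈ (inflation K P).faces) :
    (inflation K P).link σ = inflation (K.link (σ.image Sigma.fst)) P := by
  refine AbsSC.ext_faces fun τ => ?_
  obtain ⟨hσ1, hσ2⟩ := mem_inflation.mp hσ
  simp only [AbsSC.mem_link, mem_inflation, Finset.image_union]
  constructor
  · rintro ⟨⟨h, hinj⟩, hdisj⟩
    have hτ : ∀ a ∈ τ, a ∈ ((τ ∪ σ : Finset _) : Set ((v : V) × P v)) := fun a ha => by
      simp [ha]
    refine ⟨⟨h, Finset.disjoint_left.mpr ?_⟩, hinj.mono hτ⟩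
    intro v hv hv'
    obtain ⟨a, ha, rfl⟩ := Finset.mem_image.mp hv
    obtain ⟨b, hb, hab⟩ := Finset.mem_image.mp hv'
    have hba : b = a := hinj (by simp [hb]) (hτ a ha) hab
    exact Finset.disjoint_left.mp hdisj ha (hba ▸ hb)
  · rintro ⟨⟨h, hdisj⟩, hinj⟩
    rw [Finset.disjoint_left] at hdisj
    have hne : ∀ a ∈ τ, ∀ b ∈ σ, a.1 ≠ b.1 := fun a ha b hb hab =>
      hdisj (Finset.mem_image_of_mem _ ha) (hab ▸ Finset.mem_image_of_mem _ hb)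
    refine ⟨⟨h, fun a ha b hb hab => ?_⟩, Finset.disjoint_left.mpr fun a ha hb => hne a ha a hb rfl⟩
    rw [Finset.mem_coe, Finset.mem_union] at ha hb
    rcases ha with ha | ha <;> rcases hb with hb | hb
    · exact hinj ha hb hab
    · exact (hne a ha b hb hab).elim
    · exact (hne b hb a ha hab.symm).elim
    · exact hσ2 ha hb hab

/-- The subcomplex of the inflation on the vertices that are either chosen by `q` or lie
in `A`. -/
def partialInflation (K : AbsSC V) (q : ∀ v, P v) (A : Finset ((v : V) × P v)) :
    AbsSC ((v : V) × P v) where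
  faces := {τ ∈ (inflation K P).faces | ∀ a ∈ τ, a.2 = q a.1 ∨ a ∈ A}
  down_closed := fun s hs t hts =>
    ⟨(inflation K P).down_closed s hs.1 t hts, fun a ha => hs.2 a (hts ha)⟩

/-- The affine embedding of the realization of `K` induced by a choice of a copy of each
vertex. -/
def sectionMap (q : ∀ v, P v) (x : V → ℝ) (a : (v : V) × P v) : ℝ :=
  if a.2 = q a.1 then x a.1 else 0

theorem continuous_sectionMap (q : ∀ v, P v) : Continuous (sectionMap q) := by
  refine continuous_pi fun a => ?_
  unfold sectionMap
  split_ifs <;> fun_prop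

theorem sectionMap_mem (q : ∀ v, P v) {x : V → ℝ} {σ : Finset V} (hx : x ∈ barycentric σ) :
    sectionMap q x ∈ barycentric (sectionImage q σ) := by
  refine ⟨fun a ha => ?_, fun a => ?_, ?_⟩
  · unfold sectionMap
    split_ifs with h
    · exact hx.1 _ fun h' => ha (mem_sectionImage.mpr ⟨h', h⟩)
    · rfl
  · unfold sectionMap
    split_ifs
    exacts [hx.2.1 _, le_rfl]
  · rw [sectionImage, Finset.sum_image (sectionImage_injective q).injOn]
    simpa [sectionMap] using hx.2.2

theorem sphereFilling_partialInflation_empty (q : ∀ v, P v) {j : ℕ}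
    (h : SphereFilling j K.polyhedron) :
    SphereFilling j (partialInflation K q ∅).polyhedron := by
  have key : ∀ f ∈ (partialInflation K q ∅).polyhedron,
      sectionMap q (fun v => f ⟨v, q v⟩) = f := by
    rintro f ⟨τ, hτ, hf⟩
    funext a
    unfold sectionMap
    split_ifs with ha
    · exact congrArg f (Sigma.ext rfl (heq_of_eq ha.symm))
    · exact (hf.1 a fun haτ => ha (by simpa using hτ.2 a haτ)).symm
  refine sphereFilling_of_homotopic h (fun f v => f ⟨v, q v⟩) (sectionMap q) (by fun_prop)
    (continuous_sectionMap q).continuousOn ?_ ?_ ?_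
  · rintro f ⟨τ, hτ, hf⟩
    refine ⟨τ.image Sigma.fst, (mem_inflation.mp hτ.1).1, fun v hv => ?_, fun v => hf.2.1 _, ?_⟩
    · exact hf.1 _ fun h => hv (Finset.mem_image_of_mem Sigma.fst h)
    · rw [Finset.sum_image (mem_inflation.mp hτ.1).2, ← hf.2.2]
      refine Finset.sum_congr rfl fun a ha => ?_
      have h2 : a.2 = q a.1 := by simpa using hτ.2 a ha
      exact congrArg f (Sigma.ext rfl (heq_of_eq h2.symm))
  · rintro x ⟨σ, hσ, hx⟩
    exact ⟨sectionImage q σ, ⟨sectionImage_mem_inflation q hσ,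
      fun a ha => Or.inl (mem_sectionImage.mp ha).2⟩, sectionMap_mem q hx⟩
  · intro f hf t ht
    rw [key f hf, ← add_smul, sub_add_cancel, one_smul]
    exact hf

/-- The map which pushes a point away from the vertex `w` onto the opposite face. -/
def eraseVertex {W : Type*} [DecidableEq W] (w : W) (x : W → ℝ) : W → ℝ :=
  (1 - x w)⁻¹ • (x - x w • (Pi.single w 1 : W → ℝ))

theorem continuousOn_eraseVertex {W : Type*} [DecidableEq W] (w : W) :
    ContinuousOn (eraseVertex w) {x | x w < 1} := by
  have h : ContinuousOn (fun x : W → ℝ => (1 - x w)⁻¹) {x | x w < 1} :=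
    ContinuousOn.inv₀ (by fun_prop) fun x hx => (sub_pos.mpr hx).ne'
  exact h.smul (by fun_prop)

theorem eraseVertex_apply_self {W : Type*} [DecidableEq W] (w : W) (x : W → ℝ) : eraseVertex w x w = 0 := by
  simp [eraseVertex]

theorem eraseVertex_mem {W : Type*} [DecidableEq W] {w : W} {x : W → ℝ} {τ : Finset W} (hx : x ∈ barycentric τ)
    (hw : x w < 1) : eraseVertex w x ∈ barycentric (τ.erase w) := by
  have happ : ∀ a, a ≠ w → eraseVertex w x a = (1 - x w)⁻¹ * x a := by
    intro a ha
    simp [eraseVertex, Pi.single_eq_of_ne ha]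
  have hpos : 0 < 1 - x w := sub_pos.mpr hw
  refine ⟨fun a ha => ?_, fun a => ?_, ?_⟩
  · by_cases h : a = w
    · rw [h, eraseVertex_apply_self]
    · rw [happ a h, hx.1 a fun h' => ha (Finset.mem_erase.mpr ⟨h, h'⟩), mul_zero]
  · by_cases h : a = w
    · rw [h, eraseVertex_apply_self]
    · rw [happ a h]
      exact mul_nonneg (inv_nonneg.mpr hpos.le) (hx.2.1 a)
  · rw [Finset.sum_congr rfl fun a ha => happ a (Finset.ne_of_mem_erase ha), ← Finset.mul_sum]
    have hsum : ∑ a ∈ τ.erase w, x a = 1 - x w := by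
      by_cases h : w ∈ τ
      · rw [Finset.sum_erase_eq_sub h, hx.2.2]
      · rw [Finset.erase_eq_of_notMem h, hx.2.2, hx.1 w h, sub_zero]
    rw [hsum, inv_mul_cancel₀ hpos.ne']

theorem sphereFilling_partialInflation (q : ∀ v, P v) (A : Finset ((v : V) × P v))
    {K : AbsSC V} (hK : ∅ ∈ K.faces) {d : ℤ}
    (h : ∀ σ ∈ K.faces, ∀ j : ℕ, (j : ℤ) ≤ d - σ.card → SphereFilling j (K.link σ).polyhedron)
    {j : ℕ} (hj : (j : ℤ) ≤ d) : SphereFilling j (partialInflation K q A).polyhedron := by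
  induction A using Finset.induction_on generalizing K d j with
  | empty =>
    have := h ∅ hK j (by simpa using hj)
    rw [AbsSC.link_empty] at this
    exact sphereFilling_partialInflation_empty q this
  | insert w A hwA ih =>
    by_cases hw : w.2 = q w.1 ∨ {w.1} ∉ K.faces
    · have : partialInflation K q (insert w A) = partialInflation K q A := by
        refine AbsSC.ext_faces fun τ => and_congr_right fun hτ => forall₂_congr fun a ha => ?_
        rw [Finset.mem_insert]
        constructor
        · rintro (h | rfl | h)
          · exact Or.inl h
          · exact Or.inl (hw.resolve_right fun h => h (K.down_closed _ (mem_inflation.mp hτ).1 _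
              (by simpa using ⟨a.2, ha⟩)))
          · exact Or.inr h
        · exact fun h => h.imp_right Or.inr
      rw [this]
      exact ih hK h hj
    · push Not at hw
      obtain ⟨hwq, hwK⟩ := hw
      have hsub : ∀ τ ∈ (partialInflation K q A).faces, w ∉ τ := fun τ hτ hwτ =>
        (hτ.2 w hwτ).elim hwq hwA
      have hwL : {w} ∈ (partialInflation K q (insert w A)).faces :=
        ⟨mem_inflation.mpr (by simpa using hwK), by simp⟩
      have herase : ∀ τ ∈ (partialInflation K q (insert w A)).faces,
          τ.erase w ∈ (partialInflation K q A).faces := fun τ hτ =>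
        ⟨(inflation K P).down_closed _ hτ.1 _ (Finset.erase_subset _ _), fun a ha =>
          (hτ.2 a (Finset.mem_of_mem_erase ha)).imp_right fun h =>
            (Finset.mem_insert.mp h).resolve_left (Finset.ne_of_mem_erase ha)⟩
      have herase_link : ∀ τ ∈ (partialInflation K q (insert w A)).faces, w ∈ τ →
          τ.erase w ∈ (partialInflation (K.link {w.1}) q A).faces := by
        intro τ hτ hwτ
        have hτ' := mem_inflation.mp hτ.1
        refine ⟨mem_inflation.mpr ⟨AbsSC.mem_link.mpr ⟨?_, ?_⟩, ?_⟩, (herase τ hτ).2⟩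
        · refine K.down_closed _ hτ'.1 _ (Finset.union_subset
            (Finset.image_subset_image (Finset.erase_subset _ _)) ?_)
          simpa using ⟨w.2, hwτ⟩
        · rw [Finset.disjoint_singleton_right, Finset.mem_image]
          rintro ⟨a, ha, haw⟩
          exact Finset.ne_of_mem_erase ha (hτ'.2 (Finset.mem_of_mem_erase ha) hwτ haw)
        · exact hτ'.2.mono (Finset.coe_subset.mpr (Finset.erase_subset _ _))
      have hinsert : ∀ τ ∈ (partialInflation (K.link {w.1}) q A).faces,
          insert w τ ∈ (partialInflation K q (insert w A)).faces := by
        rintro τ ⟨hτ, hτA⟩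
        obtain ⟨hτ1, hτ2⟩ := mem_inflation.mp hτ
        rw [AbsSC.mem_link, Finset.disjoint_singleton_right] at hτ1
        refine ⟨mem_inflation.mpr ⟨?_, ?_⟩, ?_⟩
        · rw [Finset.image_insert, Finset.insert_eq, Finset.union_comm]
          exact hτ1.1
        · rw [Finset.coe_insert, Set.injOn_insert]
          · exact ⟨hτ2, fun h => hτ1.2 (by simpa using h)⟩
          · exact fun h => hτ1.2 (Finset.mem_image_of_mem Sigma.fst h)
        · intro a ha
          rcases Finset.mem_insert.mp ha with rfl | ha
          · exact Or.inr (Finset.mem_insert_self _ _)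
          · exact (hτA a ha).imp_right (Finset.mem_insert_of_mem)
      have hinsert_sub : ∀ τ ∈ (partialInflation K q A).faces,
          τ ∈ (partialInflation K q (insert w A)).faces := fun τ hτ =>
        ⟨hτ.1, fun a ha => (hτ.2 a ha).imp_right Finset.mem_insert_of_mem⟩
      have hlink : ∀ j : ℕ, (j : ℤ) ≤ d - 1 →
          SphereFilling j (partialInflation (K.link {w.1}) q A).polyhedron := by
        intro j hj
        refine ih (AbsSC.mem_link.mpr (by simpa using hwK)) (fun σ hσ i hi => ?_) hj
        rw [AbsSC.mem_link] at hσ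
        rw [AbsSC.link_link hσ.2]
        refine h _ hσ.1 i ?_
        rw [Finset.card_union_of_disjoint hσ.2]
        push_cast [Finset.card_singleton]
        linarith
      refine sphereFilling_of_isOpen_cover (O₁ := {x | x w < 1}) (O₂ := {x | 0 < x w})
        (isOpen_lt (continuous_apply w) continuous_const)
        (isOpen_lt continuous_const (continuous_apply w)) ?_ ?_ ?_ ?_
      · intro x _
        rcases lt_or_ge (x w) 1 with hx | hx
        · exact Or.inl hx
        · exact Or.inr (zero_lt_one.trans_le hx)
      · intro i hi
        refine sphereFilling_of_homotopic (ih hK h ((Int.ofNat_le.mpr hi).trans hj))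
          (eraseVertex w) id ((continuousOn_eraseVertex w).mono inter_subset_right)
          continuousOn_id ?_ ?_ ?_
        · rintro x ⟨⟨τ, hτ, hx⟩, hxw⟩
          exact ⟨_, herase τ hτ, eraseVertex_mem hx hxw⟩
        · rintro x ⟨τ, hτ, hx⟩
          refine ⟨⟨τ, hinsert_sub τ hτ, hx⟩, ?_⟩
          change x w < 1
          rw [hx.1 w (hsub τ hτ)]
          exact zero_lt_one
        · rintro x ⟨⟨τ, hτ, hx⟩, hxw⟩ t ht
          refine ⟨⟨τ, hτ, segment_mem_barycentric hx (barycentric_mono (Finset.erase_subset w τ)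
            (eraseVertex_mem hx hxw)) ht⟩, ?_⟩
          have hxw' : x w < 1 := hxw
          have := hx.2.1 w
          simp only [mem_ofPred_eq, Pi.add_apply, Pi.smul_apply, id, eraseVertex_apply_self,
            smul_eq_mul, mul_zero, add_zero]
          nlinarith [ht.1]
      · intro i _
        refine sphereFilling_of_star (x₀ := Pi.single w 1) ⟨⟨{w}, hwL,
          single_mem_barycentric (Finset.mem_singleton_self w)⟩, by simp⟩ ?_
        rintro x ⟨⟨τ, hτ, hx⟩, hxw⟩ t ht
        have hxw' : 0 < x w := hxw
        refine ⟨⟨τ, hτ, segment_mem_barycentric hx (single_mem_barycentric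
          (mem_of_barycentric hx hxw'.ne')) ht⟩, ?_⟩
        simp only [mem_ofPred_eq, Pi.add_apply, Pi.smul_apply, Pi.single_eq_same, smul_eq_mul,
          mul_one]
        rcases ht.1.eq_or_lt with rfl | ht0
        · simpa using hxw'
        · exact add_pos_of_nonneg_of_pos (mul_nonneg (sub_nonneg.mpr ht.2) hxw'.le) ht0
      · intro i hi
        refine sphereFilling_of_homotopic (hlink i (by omega)) (eraseVertex w)
          (fun y => (1 - 1 / 2 : ℝ) • Pi.single w 1 + (1 / 2 : ℝ) • y)
          ((continuousOn_eraseVertex w).mono fun x hx => hx.2.1) (by fun_prop) ?_ ?_ ?_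
        · rintro x ⟨⟨τ, hτ, hx⟩, hxw, hxw'⟩
          exact ⟨_, herase_link τ hτ (mem_of_barycentric hx (ne_of_gt hxw')),
            eraseVertex_mem hx hxw⟩
        · rintro y ⟨τ, hτ, hy⟩
          refine ⟨⟨_, hinsert τ hτ, segment_mem_barycentric (t := 1 / 2)
            (single_mem_barycentric (Finset.mem_insert_self w τ))
            (barycentric_mono (Finset.subset_insert w τ) hy) (by norm_num)⟩, ?_⟩
          have hyw : y w = 0 := hy.1 w fun hwτ => (hτ.2 w hwτ).elim hwq hwA
          constructor <;> norm_num [hyw]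
        · rintro x ⟨⟨τ, hτ, hx⟩, hxw, hxw'⟩ t ht
          refine ⟨⟨τ, hτ, segment_mem_barycentric hx (segment_mem_barycentric (t := 1 / 2)
            (single_mem_barycentric (mem_of_barycentric hx (ne_of_gt hxw')))
            (barycentric_mono (Finset.erase_subset w τ) (eraseVertex_mem hx hxw))
            (by norm_num)) ht⟩, ?_⟩
          have h1 : x w < 1 := hxw
          have h0 : 0 < x w := hxw'
          obtain ⟨ht0, ht1⟩ := ht
          constructor
          · simp only [mem_ofPred_eq, Pi.add_apply, Pi.smul_apply, Pi.single_eq_same,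
              eraseVertex_apply_self, smul_eq_mul]
            nlinarith
          · simp only [mem_ofPred_eq, Pi.add_apply, Pi.smul_apply, Pi.single_eq_same,
              eraseVertex_apply_self, smul_eq_mul]
            nlinarith

theorem sphereFilling_inflation (q : ∀ v, P v) {D : ℕ} (hD : ∀ s ∈ K.faces, s.card ≤ D)
    (hK : ∅ ∈ K.faces) {d : ℤ}
    (h : ∀ σ ∈ K.faces, ∀ j : ℕ, (j : ℤ) ≤ d - σ.card → SphereFilling j (K.link σ).polyhedron)
    {j : ℕ} (hj : (j : ℤ) ≤ d) : SphereFilling j (inflation K P).polyhedron := by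
  intro f hf hfG
  obtain ⟨S, g, hg, hS⟩ := exists_finset_support (isCompact_sphere 0 1) hf hfG
    ((forall_card_inflation q (p := fun n => n ≤ D)).mpr hD)
  obtain ⟨g', hg', hg'L, hgg'⟩ := sphereFilling_partialInflation q S hK h hj g hg (by
    intro x hx
    obtain ⟨τ, hτ, hxτ⟩ := hfG hx
    refine ⟨{a ∈ τ | a ∈ S}, ⟨(inflation K P).down_closed _ hτ _ (Finset.filter_subset _ _),
      fun a ha => Or.inr (Finset.mem_filter.mp ha).2⟩,
      barycentric_of_support ((hS x hx).2 τ hxτ) fun a ha => ?_⟩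
    by_cases haS : a ∈ S
    · exact ((hS x hx).2 τ hxτ).1 a fun h => ha (Finset.mem_filter.mpr ⟨h, haS⟩)
    · exact (hS x hx).1 a haS)
  refine exists_extension_of_segment hf (fun x hx t ht => ?_) hg' fun x hx => ?_
  · obtain ⟨τ, hτ, hxτ⟩ := hfG hx
    rw [hgg' hx]
    exact ⟨τ, hτ, segment_mem_barycentric hxτ ((hS x hx).2 τ hxτ) ht⟩
  · obtain ⟨τ, hτ, hxτ⟩ := hg'L hx
    exact ⟨τ, hτ.1, hxτ⟩

theorem sphereFilling_of_inflation (q : ∀ v, P v) {D : ℕ} (hD : ∀ s ∈ K.faces, s.card ≤ D)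
    {j : ℕ} (h : SphereFilling j (inflation K P).polyhedron) : SphereFilling j K.polyhedron := by
  intro f hf hfK
  obtain ⟨g, hg, hgL, hgf⟩ := h (sectionMap q ∘ f) ((continuous_sectionMap q).comp_continuousOn hf)
    fun x hx => by
      obtain ⟨σ, hσ, hxσ⟩ := hfK hx
      exact ⟨_, sectionImage_mem_inflation q hσ, sectionMap_mem q hxσ⟩
  obtain ⟨S, g', hg', hS⟩ := exists_finset_support (isCompact_closedBall 0 1) hg hgL
    ((forall_card_inflation q (p := fun n => n ≤ D)).mpr hD)
  have hproj : ∀ x ∈ closedBall 0 1, ∀ τ, g x ∈ barycentric τ →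
      (fun v => ∑ a ∈ S with a.1 = v, g' x a) ∈ barycentric (τ.image Sigma.fst) := by
    intro x hx τ hxτ
    have hx' := (hS x hx).2 τ hxτ
    refine ⟨fun v hv => Finset.sum_eq_zero fun a ha => hx'.1 a fun haτ => hv ?_,
      fun v => Finset.sum_nonneg fun a _ => hx'.2.1 a, ?_⟩
    · exact (Finset.mem_filter.mp ha).2 ▸ Finset.mem_image_of_mem Sigma.fst haτ
    · refine (Finset.sum_fiberwise_eq_sum_filter S (τ.image Sigma.fst) Sigma.fst (g' x)).trans ?_
      refine sum_eq_one_of_barycentric hx' fun a ha => ?_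
      by_cases haS : a ∈ S
      · exact hx'.1 a fun h => ha (Finset.mem_filter.mpr ⟨haS, Finset.mem_image_of_mem _ h⟩)
      · exact (hS x hx).1 a haS
  refine exists_extension_of_segment (g := fun x v => ∑ a ∈ S with a.1 = v, g' x a) hf
    (fun x hx t ht => ?_) (continuousOn_pi.mpr fun v =>
      continuousOn_finsetSum _ fun a _ => continuousOn_pi.mp hg' a) fun x hx => ?_
  · obtain ⟨σ, hσ, hxσ⟩ := hfK hx
    have hxσ' := hproj x (sphere_subset_closedBall hx) (sectionImage q σ)
      (hgf hx ▸ sectionMap_mem q hxσ)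
    rw [image_fst_sectionImage] at hxσ'
    exact ⟨σ, hσ, segment_mem_barycentric hxσ hxσ' ht⟩
  · obtain ⟨τ, hτ, hxτ⟩ := hgL hx
    exact ⟨_, (mem_inflation.mp hτ).1, hproj x hx τ hxτ⟩

theorem isSphericalDim_iff {K : AbsSC V} {m : ℤ} :
    IsSphericalDim K m ↔ (∀ s ∈ K.faces, (s.card : ℤ) ≤ m + 1) ∧
      (∃ s ∈ K.faces, (s.card : ℤ) = m + 1) ∧
        ∀ j : ℕ, (j : ℤ) ≤ m → SphereFilling j K.polyhedron := by
  rw [IsSphericalDim, nConnected_realization_iff, sub_add_cancel]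

theorem exists_intCard_inflation (q : ∀ v, P v) {n : ℤ} :
    (∃ s ∈ (inflation K P).faces, (s.card : ℤ) = n) ↔ ∃ s ∈ K.faces, (s.card : ℤ) = n := by
  have := forall_card_inflation (K := K) q (p := fun m => (m : ℤ) ≠ n)
  simpa using not_congr this

theorem isSphericalDim_of_inflation (q : ∀ v, P v) {m : ℤ}
    (h : IsSphericalDim (inflation K P) m) : IsSphericalDim K m := by
  rw [isSphericalDim_iff] at h ⊢
  have hcard := (forall_card_inflation q (p := fun n => (n : ℤ) ≤ m + 1)).mp h.1
  exact ⟨hcard, (exists_intCard_inflation q).mp h.2.1, fun j hj => sphereFilling_of_inflation q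
    (D := (m + 1).toNat) (fun s hs => by have := hcard s hs; omega) (h.2.2 j hj)⟩

theorem isSphericalDim_inflation (q : ∀ v, P v) {m : ℤ} (hK : ∅ ∈ K.faces)
    (h : ∀ σ ∈ K.faces, IsSphericalDim (K.link σ) (m - σ.card)) :
    IsSphericalDim (inflation K P) m := by
  simp only [isSphericalDim_iff] at h ⊢
  have h0 := h ∅ hK
  rw [AbsSC.link_empty, Finset.card_empty, Nat.cast_zero, sub_zero] at h0
  exact ⟨(forall_card_inflation q (p := fun n => (n : ℤ) ≤ m + 1)).mpr h0.1,
    (exists_intCard_inflation q).mpr h0.2.1, fun j hj => sphereFilling_inflation q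
      (D := (m + 1).toNat) (fun s hs => by have := h0.1 s hs; omega) hK
      (fun σ hσ => (h σ hσ).2.2) hj⟩

end Inflation

end

/-- For a finite-dimensional simplicial complex `K` and a
family `P` of non-empty sets indexed by the vertices, the inflation `(K, P)` is
Cohen–Macaulay of dimension `d` if and only if `K` is. -/
theorem inflation_CM_iff
    {V : Type u} (K : AbsSC V) (P : V → Type v) (hP : ∀ v, Nonempty (P v))
    (hfin : ∃ D : ℕ, ∀ s ∈ K.faces, s.card ≤ D + 1) (d : ℕ) :
    IsCM (inflation K P) d ↔ IsCM K d := by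
  have q : ∀ v, P v := fun v => (hP v).some
  refine and_congr (forall_card_inflation q (p := fun n => n ≤ d + 1))
    (and_congr (exists_card_inflation q) ⟨fun h σ hσ => ?_, fun h σ hσ => ?_⟩)
  · have hσ' := sectionImage_mem_inflation q hσ
    have := h _ hσ'
    rw [link_inflation hσ', image_fst_sectionImage, card_sectionImage] at this
    exact isSphericalDim_of_inflation q this
  · have hσ' := mem_inflation.mp hσ
    rw [link_inflation hσ, ← Finset.card_image_of_injOn hσ'.2]
    refine isSphericalDim_inflation q (AbsSC.mem_link.mpr (by simpa using hσ'.1)) fun τ hτ => ?_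
    rw [AbsSC.mem_link] at hτ
    rw [AbsSC.link_link hτ.2]
    have := h _ hτ.1
    rwa [Finset.card_union_of_disjoint hτ.2, add_comm, Nat.cast_add, ← sub_sub] at this
end
end

section
/- Let X and Y be topological spaces such that X is m-connected and Y is n-connected (with m, n ≥ −1). Then the join X ∗ Y is (m + n + 2)-connected. -/
open scoped Classical

noncomputable section

universe u v

/-- The join `X ∗ Y` of two topological spaces: the quotient of
`X × Y × [0,1]` identifying `(x, y, 0) ∼ (x, y', 0)` and `(x, y, 1) ∼ (x', y, 1)`. -/
def TopJoin (X : Type u) (Y : Type v) [TopologicalSpace X] [TopologicalSpace Y] :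
    Type (max u v) :=
  Quot (fun a b : X × Y × unitInterval =>
    (a.2.2 = 0 ∧ b.2.2 = 0 ∧ a.1 = b.1) ∨ (a.2.2 = 1 ∧ b.2.2 = 1 ∧ a.2.1 = b.2.1))

instance (X : Type u) (Y : Type v) [TopologicalSpace X] [TopologicalSpace Y] :
    TopologicalSpace (TopJoin X Y) :=
  inferInstanceAs (TopologicalSpace (Quot _))

open Topology
open scoped unitInterval Homotopy

/-- The straight-line interpolation of two real numbers, clamped to the unit interval. -/
def clampedLerp (s a b : ℝ) : I :=
  Set.projIcc (0 : ℝ) 1 zero_le_one ((1 - s) * a + s * b)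

@[fun_prop]
theorem Continuous.clampedLerp {Z : Type*} [TopologicalSpace Z] {s a b : Z → ℝ}
    (hs : Continuous s) (ha : Continuous a) (hb : Continuous b) :
    Continuous fun z => clampedLerp (s z) (a z) (b z) :=
  continuous_projIcc.comp (by fun_prop)

@[simp]
theorem clampedLerp_zero (a : I) (b : ℝ) : clampedLerp 0 a b = a := by
  simp [clampedLerp]

@[simp]
theorem clampedLerp_one (a : ℝ) (b : I) : clampedLerp 1 a b = b := by
  simp [clampedLerp]

@[simp]
theorem clampedLerp_self (s : ℝ) (a : I) : clampedLerp s a a = a := by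
  have : (1 - s) * (a : ℝ) + s * a = a := by ring
  simp [clampedLerp, this]

namespace TopJoin

variable {X : Type u} {Y : Type v} [TopologicalSpace X] [TopologicalSpace Y]

/-- The point of the join with coordinates `a`, `b` and `t`. -/
def mk (a : X) (b : Y) (t : I) : TopJoin X Y := Quot.mk _ (a, b, t)

theorem isQuotientMap_mk :
    IsQuotientMap fun p : X × Y × I => mk p.1 p.2.1 p.2.2 :=
  isQuotientMap_quot_mk

@[fun_prop]
theorem continuous_mk : Continuous fun p : X × Y × I => mk p.1 p.2.1 p.2.2 :=
  isQuotientMap_mk.continuous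

theorem ind {P : TopJoin X Y → Prop} (h : ∀ a b t, P (mk a b t)) (w : TopJoin X Y) : P w :=
  Quot.ind (fun p => h p.1 p.2.1 p.2.2) w

theorem mk_zero (a : X) (b b' : Y) : mk a b 0 = mk a b' 0 :=
  Quot.sound (Or.inl ⟨rfl, rfl, rfl⟩)

theorem mk_one (a a' : X) (b : Y) : mk a b 1 = mk a' b 1 :=
  Quot.sound (Or.inr ⟨rfl, rfl, rfl⟩)

/-- The join coordinate. -/
def height : TopJoin X Y → I :=
  Quot.lift (fun p => p.2.2) (by rintro a b (h | h) <;> exact h.1.trans h.2.1.symm)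

@[simp]
theorem height_mk (a : X) (b : Y) (t : I) : height (mk a b t) = t := rfl

@[fun_prop]
theorem continuous_height : Continuous (height : TopJoin X Y → I) :=
  isQuotientMap_mk.continuous_iff.2 (by exact continuous_snd.comp continuous_snd)

/-- The first coordinate of a point of the join, with value `a₀` where it is undefined. -/
def fst (a₀ : X) : TopJoin X Y → X :=
  Quot.lift (fun p => if p.2.2 = 1 then a₀ else p.1) (by
    rintro a b (h | h)
    · simp [h.1, h.2.1, h.2.2]
    · simp [h.1, h.2.1])

/-- The second coordinate of a point of the join, with value `b₀` where it is undefined. -/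
def snd (b₀ : Y) : TopJoin X Y → Y :=
  Quot.lift (fun p => if p.2.2 = 0 then b₀ else p.2.1) (by
    rintro a b (h | h)
    · simp [h.1, h.2.1]
    · simp [h.1, h.2.1, h.2.2])

theorem fst_mk (a₀ a : X) (b : Y) {t : I} (ht : t ≠ 1) : fst a₀ (mk a b t) = a :=
  if_neg ht

theorem snd_mk (b₀ : Y) (a : X) (b : Y) {t : I} (ht : t ≠ 0) : snd b₀ (mk a b t) = b :=
  if_neg ht

theorem mk_fst_snd_height (a₀ : X) (b₀ : Y) (w : TopJoin X Y) :
    mk (fst a₀ w) (snd b₀ w) (height w) = w := by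
  induction w using ind with
  | h a b t =>
    rw [height_mk]
    rcases eq_or_ne t 0 with rfl | h0
    · rw [fst_mk _ _ _ zero_ne_one]
      exact mk_zero _ _ _
    · rw [snd_mk _ _ _ h0]
      rcases eq_or_ne t 1 with rfl | h1
      · exact mk_one _ _ _
      · rw [fst_mk _ _ _ h1]

theorem continuousOn_fst (a₀ : X) :
    ContinuousOn (fst a₀ : TopJoin X Y → X) {w | height w ≠ 1} := by
  refine (isQuotientMap_mk.continuousOn_isOpen_iff
    (isOpen_ne.preimage continuous_height)).2 ?_
  refine continuous_fst.continuousOn.congr fun p hp => ?_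
  exact fst_mk _ _ _ hp

theorem continuousOn_snd (b₀ : Y) :
    ContinuousOn (snd b₀ : TopJoin X Y → Y) {w | height w ≠ 0} := by
  refine (isQuotientMap_mk.continuousOn_isOpen_iff
    (isOpen_ne.preimage continuous_height)).2 ?_
  refine (continuous_fst.comp continuous_snd).continuousOn.congr fun p hp => ?_
  exact snd_mk _ _ _ hp

/-- A map into the join is continuous as soon as its join coordinate is continuous and its other
coordinates are continuous on closed sets off which they are irrelevant. -/
theorem continuous_mk_of_isClosed {Z : Type*} [TopologicalSpace Z] {E E' : Set Z}
    (hE : IsClosed E) (hE' : IsClosed E') {x : Z → X} {y : Z → Y} {t : Z → I}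
    (hx : ContinuousOn x E) (hy : ContinuousOn y E') (ht : Continuous t)
    (h1 : ∀ z ∉ E, t z = 1) (h0 : ∀ z ∉ E', t z = 0) :
    Continuous fun z => mk (x z) (y z) (t z) := by
  have c0 : ContinuousOn (fun z => mk (x z) (y z) (t z)) (closure E'ᶜ) := by
    have hsub : closure E'ᶜ ⊆ E := hE.closure_subset_iff.2 fun z hz => by
      by_contra h
      exact zero_ne_one ((h0 z hz).symm.trans (h1 z h))
    have ht0 : ∀ z ∈ closure E'ᶜ, t z = 0 := fun z hz =>
      (isClosed_singleton.preimage ht).closure_subset_iff.2 (fun z hz => h0 z hz) hz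
    intro z hz
    have hc : ContinuousOn (fun w => mk (x w) (y z) 0) (closure E'ᶜ) :=
      continuous_mk.comp_continuousOn
        ((hx.mono hsub).prodMk (continuousOn_const (c := (y z, (0 : I)))))
    refine (hc.congr fun w hw => ?_) z hz
    rw [ht0 w hw]
    exact mk_zero _ _ _
  have c1 : ContinuousOn (fun z => mk (x z) (y z) (t z)) (closure Eᶜ) := by
    have hsub : closure Eᶜ ⊆ E' := hE'.closure_subset_iff.2 fun z hz => by
      by_contra h
      exact zero_ne_one ((h0 z h).symm.trans (h1 z hz))
    have ht0 : ∀ z ∈ closure Eᶜ, t z = 1 := fun z hz =>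
      (isClosed_singleton.preimage ht).closure_subset_iff.2 (fun z hz => h1 z hz) hz
    intro z hz
    have hc : ContinuousOn (fun w => mk (x z) (y w) 1) (closure Eᶜ) :=
      continuous_mk.comp_continuousOn
        ((continuousOn_const (c := x z)).prodMk
          ((hy.mono hsub).prodMk (continuousOn_const (c := (1 : I)))))
    refine (hc.congr fun w hw => ?_) z hz
    rw [ht0 w hw]
    exact mk_one _ _ _
  have c2 : ContinuousOn (fun z => mk (x z) (y z) (t z)) (E ∩ E') :=
    continuous_mk.comp_continuousOn ((hx.mono Set.inter_subset_left).prodMk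
      ((hy.mono Set.inter_subset_right).prodMk ht.continuousOn))
  rw [← continuousOn_univ]
  refine ((c2.union_of_isClosed c0 (hE.inter hE') isClosed_closure).union_of_isClosed c1
    ((hE.inter hE').union isClosed_closure) isClosed_closure).mono fun z _ => ?_
  by_cases hz : z ∈ E
  · by_cases hz' : z ∈ E'
    · exact Or.inl (Or.inl ⟨hz, hz'⟩)
    · exact Or.inl (Or.inr (subset_closure hz'))
  · exact Or.inr (subset_closure hz)

/-- Change of the join coordinate by a family of self-maps of the interval fixing the ends. -/
def reparam (h : I → I → I) (h0 : ∀ s, h s 0 = 0) (h1 : ∀ s, h s 1 = 1) (s : I) :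
    TopJoin X Y → TopJoin X Y :=
  Quot.lift (fun p => mk p.1 p.2.1 (h s p.2.2)) (by
    rintro ⟨a, b, t⟩ ⟨a', b', t'⟩ (⟨rfl, rfl, rfl⟩ | ⟨rfl, rfl, rfl⟩)
    · simp only [h0]
      exact mk_zero _ _ _
    · simp only [h1]
      exact mk_one _ _ _)

theorem reparam_mk (h : I → I → I) (h0 : ∀ s, h s 0 = 0) (h1 : ∀ s, h s 1 = 1) (s : I)
    (a : X) (b : Y) (t : I) : reparam h h0 h1 s (mk a b t) = mk a b (h s t) := rfl

theorem continuous_reparam (h : I → I → I) (h0 : ∀ s, h s 0 = 0) (h1 : ∀ s, h s 1 = 1)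
    (hc : Continuous fun p : I × I => h p.1 p.2) :
    Continuous fun p : I × TopJoin X Y => reparam h h0 h1 p.1 p.2 := by
  have key : Continuous fun p : (X × Y × I) × I =>
      (mk p.1.1 p.1.2.1 (h p.2 p.1.2.2) : TopJoin X Y) :=
    continuous_mk.comp (continuous_fst.fst.prodMk (continuous_fst.snd.fst.prodMk
      (hc.comp (continuous_snd.prodMk continuous_fst.snd.snd))))
  have hs : ∀ w : TopJoin X Y, Continuous fun s : I => reparam h h0 h1 s w := by
    intro w
    induction w using ind with
    | h a b t => exact key.comp ((continuous_const (y := (a, b, t))).prodMk continuous_id)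
  let g : TopJoin X Y → C(I, TopJoin X Y) := fun w => ⟨fun s => reparam h h0 h1 s w, hs w⟩
  have hg : Continuous g :=
    isQuotientMap_mk.continuous_iff.2 (ContinuousMap.curry ⟨_, key⟩).continuous
  have := ContinuousMap.continuous_uncurry_of_continuous ⟨g, hg⟩
  exact this.comp continuous_swap

end TopJoin

section SphereExtension

variable {X : Type u} [TopologicalSpace X]

theorem norm_finCons_s12 {j : ℕ} (b : ℝ) (v : Fin j → ℝ) :
    ‖(Fin.cons b v : Fin (j + 1) → ℝ)‖ = max |b| ‖v‖ := by
  refine le_antisymm ?_ (max_le ?_ ?_)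
  · refine (pi_norm_le_iff_of_nonneg (le_max_of_le_left (abs_nonneg b))).2 fun i => ?_
    refine Fin.cases ?_ (fun i => ?_) i
    · simp
    · simpa using Or.inr (norm_le_pi_norm v i)
  · simpa using norm_le_pi_norm (Fin.cons b v : Fin (j + 1) → ℝ) 0
  · refine (pi_norm_le_iff_of_nonneg (norm_nonneg _)).2 fun i => ?_
    simpa using norm_le_pi_norm (Fin.cons b v : Fin (j + 1) → ℝ) i.succ

/-- The map wrapping the unit ball of `Fin j → ℝ` around the unit sphere of `Fin (j + 1) → ℝ`,
collapsing the boundary of the ball to the south pole. -/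
def wrapBall {j : ℕ} (v : Fin j → ℝ) : Fin (j + 1) → ℝ :=
  Fin.cons (max (-1) (min 1 (3 - 6 * ‖v‖))) ((min 1 (3 * (1 - ‖v‖)) / max ‖v‖ (1 / 3)) • v)

theorem continuous_wrapBall {j : ℕ} : Continuous (wrapBall : (Fin j → ℝ) → Fin (j + 1) → ℝ) := by
  refine continuous_pi fun i => Fin.cases ?_ (fun i => ?_) i
  · simp only [wrapBall, Fin.cons_zero]
    fun_prop
  · simp only [wrapBall, Fin.cons_succ]
    have : ∀ v : Fin j → ℝ, max ‖v‖ (1 / 3) ≠ 0 := fun v =>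
      (lt_max_of_lt_right (by norm_num : (0 : ℝ) < 1 / 3)).ne'
    have h : Continuous fun v : Fin j → ℝ =>
        (min 1 (3 * (1 - ‖v‖)) / max ‖v‖ (1 / 3)) • v :=
      (Continuous.div (by fun_prop) (by fun_prop) this).smul continuous_id
    exact (continuous_apply i).comp h

theorem norm_wrapBall {j : ℕ} {v : Fin j → ℝ} (hv : ‖v‖ ≤ 1) : ‖wrapBall v‖ = 1 := by
  have h0 := norm_nonneg v
  rw [wrapBall, norm_finCons_s12, norm_smul, Real.norm_eq_abs]
  rcases le_total ‖v‖ (1 / 3) with h | h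
  · rw [max_eq_right h, min_eq_left (by linarith), min_eq_left (by linarith)]
    norm_num
    linarith
  · rw [max_eq_left h]
    rcases le_total ‖v‖ (2 / 3) with h' | h'
    · have hp : 0 < ‖v‖ := by linarith
      rw [min_eq_left (by linarith : (1 : ℝ) ≤ 3 * (1 - ‖v‖)),
        abs_of_pos (by positivity : 0 < 1 / ‖v‖),
        one_div_mul_cancel hp.ne']
      refine max_eq_right (abs_le.2 ⟨le_max_left _ _, max_le (by norm_num) (min_le_left _ _)⟩)
    · have hp : ‖v‖ ≠ 0 := by linarith
      rw [min_eq_right (by linarith : 3 * (1 - ‖v‖) ≤ 1), min_eq_right (by linarith),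
        max_eq_left (by linarith : 3 - 6 * ‖v‖ ≤ -1),
        abs_of_nonneg (div_nonneg (by linarith) h0 : 0 ≤ 3 * (1 - ‖v‖) / ‖v‖),
        div_mul_cancel₀ _ hp]
      norm_num
      linarith

theorem wrapBall_of_norm_eq_one {j : ℕ} {v : Fin j → ℝ} (hv : ‖v‖ = 1) :
    wrapBall v = Fin.cons (-1) 0 := by
  rw [wrapBall, hv]
  norm_num

theorem wrapBall_injective {j : ℕ} {v w : Fin j → ℝ} (hv : ‖v‖ ≤ 1) (hw : ‖w‖ ≤ 1)
    (h : wrapBall v = wrapBall w) : v = w ∨ ‖v‖ = 1 ∧ ‖w‖ = 1 := by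
  obtain ⟨hβ, hα⟩ := Fin.cons_inj.1 h
  have hnorm : ‖v‖ = ‖w‖ := by
    have hα' := congrArg norm hα
    have e : ∀ u : Fin j → ℝ, ‖u‖ ≤ 1 →
        ‖(min 1 (3 * (1 - ‖u‖)) / max ‖u‖ (1 / 3)) • u‖
          = min 1 (3 * (1 - ‖u‖)) * min 1 (3 * ‖u‖) := by
      intro u hu
      have h0 := norm_nonneg u
      rw [norm_smul, Real.norm_eq_abs, abs_of_nonneg (div_nonneg
        (le_min zero_le_one (by linarith)) (le_max_of_le_left h0)), div_mul_eq_mul_div, mul_div_assoc]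
      congr 1
      rcases le_total ‖u‖ (1 / 3) with h | h
      · rw [max_eq_right h, min_eq_right (by linarith)]
        ring
      · rw [max_eq_left h, min_eq_left (by linarith), div_self (by linarith)]
    rw [e v hv, e w hw] at hα'
    have r : ∀ a : ℝ,
        (a ≤ 1 / 3 ∧ max (-1) (min 1 (3 - 6 * a)) = 1 ∧
          min 1 (3 * (1 - a)) * min 1 (3 * a) = 3 * a) ∨
        (1 / 3 ≤ a ∧ a ≤ 2 / 3 ∧ max (-1) (min 1 (3 - 6 * a)) = 3 - 6 * a ∧
          min 1 (3 * (1 - a)) * min 1 (3 * a) = 1) ∨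
        (2 / 3 ≤ a ∧ max (-1) (min 1 (3 - 6 * a)) = -1 ∧
          min 1 (3 * (1 - a)) * min 1 (3 * a) = 3 * (1 - a)) := by
      intro a
      rcases le_total a (1 / 3) with h | h
      · left
        rw [min_eq_left (by linarith), min_eq_left (by linarith), min_eq_right (by linarith)]
        exact ⟨h, by norm_num, one_mul _⟩
      · rcases le_total a (2 / 3) with h' | h'
        · right; left
          rw [min_eq_right (by linarith), min_eq_left (by linarith), min_eq_left (by linarith)]
          exact ⟨h, h', max_eq_right (by linarith), one_mul _⟩
        · right; right
          rw [min_eq_right (by linarith), min_eq_right (by linarith), min_eq_left (by linarith)]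
          exact ⟨h', max_eq_left (by linarith), mul_one _⟩
    rcases r ‖v‖ with h1 | h1 | h1 <;> rcases r ‖w‖ with h2 | h2 | h2 <;> linarith
  rcases eq_or_lt_of_le hv with h1 | h1
  · exact Or.inr ⟨h1, hnorm ▸ h1⟩
  · left
    rw [← hnorm] at hα
    refine smul_right_injective _ (ne_of_gt ?_) hα
    exact div_pos (lt_min one_pos (by linarith)) (lt_max_of_lt_right (by norm_num))

theorem exists_wrapBall_eq {j : ℕ} {w : Fin (j + 2) → ℝ} (hw : ‖w‖ = 1) :
    ∃ v : Fin (j + 1) → ℝ, ‖v‖ ≤ 1 ∧ wrapBall v = w := by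
  obtain ⟨b, u, rfl⟩ : ∃ b u, w = Fin.cons b u := ⟨w 0, Fin.tail w, (Fin.cons_self_tail w).symm⟩
  rw [norm_finCons_s12] at hw
  have hb : |b| ≤ 1 := hw ▸ le_max_left _ _
  have hu : ‖u‖ ≤ 1 := hw ▸ le_max_right _ _
  have hu0 := norm_nonneg u
  obtain ⟨hb1, hb2⟩ := abs_le.1 hb
  rcases eq_or_lt_of_le hb2 with rfl | hb2
  · refine ⟨(1 / 3 : ℝ) • u, ?_, ?_⟩
    · rw [norm_smul]
      norm_num
      linarith
    · have : ‖(1 / 3 : ℝ) • u‖ = ‖u‖ / 3 := by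
        rw [norm_smul]
        norm_num
        ring
      rw [wrapBall, this, min_eq_left (by linarith), max_eq_right (by norm_num),
        min_eq_left (by linarith), max_eq_right (by linarith), smul_smul]
      norm_num
  rcases eq_or_lt_of_le hb1 with rfl | hb1
  · rcases eq_or_ne u 0 with rfl | hune
    · have h1 : ‖(fun _ => 1 : Fin (j + 1) → ℝ)‖ = 1 := by simp
      exact ⟨fun _ => 1, h1.le, wrapBall_of_norm_eq_one h1⟩
    · have hup : 0 < ‖u‖ := norm_pos_iff.2 hune
      have : ‖((1 - ‖u‖ / 3) / ‖u‖) • u‖ = 1 - ‖u‖ / 3 := by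
        rw [norm_smul, Real.norm_eq_abs, abs_of_nonneg (div_nonneg (by linarith) hu0),
          div_mul_cancel₀ _ hup.ne']
      refine ⟨((1 - ‖u‖ / 3) / ‖u‖) • u, by rw [this]; linarith, ?_⟩
      rw [wrapBall, this, min_eq_right (by linarith), max_eq_left (by linarith),
        min_eq_right (by linarith), max_eq_left (by linarith), smul_smul]
      have h2 : 1 - ‖u‖ / 3 ≠ 0 := by linarith
      have : 3 * (1 - (1 - ‖u‖ / 3)) / (1 - ‖u‖ / 3) * ((1 - ‖u‖ / 3) / ‖u‖) = 1 := by
        rw [div_mul_div_cancel₀ h2, div_eq_one_iff_eq hup.ne']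
        ring
      rw [this, one_smul]
  · have hun : ‖u‖ = 1 := by
      rcases max_choice |b| ‖u‖ with h | h
      · have := abs_lt.2 ⟨hb1, hb2⟩
        linarith
      · exact h.symm.trans hw
    have : ‖((3 - b) / 6) • u‖ = (3 - b) / 6 := by
      rw [norm_smul, hun, Real.norm_eq_abs, abs_of_nonneg (by linarith), mul_one]
    refine ⟨((3 - b) / 6) • u, by rw [this]; linarith, ?_⟩
    rw [wrapBall, this, min_eq_right (by linarith), max_eq_right (by linarith),
      min_eq_left (by linarith), max_eq_left (by linarith), smul_smul,
      one_div_mul_cancel (by linarith), one_smul]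
    congr 1
    ring

/-- The affine map from the unit cube to the unit ball of the sup norm. -/
def cubeToBall {j : ℕ} (c : Fin j → I) : Fin j → ℝ := fun i => 2 * c i - 1

theorem continuous_cubeToBall {j : ℕ} : Continuous (cubeToBall : (Fin j → I) → _) := by
  unfold cubeToBall
  fun_prop

theorem norm_cubeToBall_le {j : ℕ} (c : Fin j → I) : ‖cubeToBall c‖ ≤ 1 :=
  (pi_norm_le_iff_of_nonneg zero_le_one).2 fun i => by
    rw [Real.norm_eq_abs, abs_le, cubeToBall]
    constructor <;> linarith [(c i).2.1, (c i).2.2]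

theorem norm_cubeToBall_eq_one_iff {j : ℕ} (c : Fin j → I) :
    ‖cubeToBall c‖ = 1 ↔ c ∈ Cube.boundary (Fin j) := by
  constructor
  · intro h
    by_contra hc
    refine h.not_lt ((pi_norm_lt_iff one_pos).2 fun i => ?_)
    have h0 : c i ≠ 0 := fun h => hc ⟨i, Or.inl h⟩
    have h1 : c i ≠ 1 := fun h => hc ⟨i, Or.inr h⟩
    have h0' := unitInterval.pos_iff_ne_zero.2 h0
    have h1' := unitInterval.lt_one_iff_ne_one.2 h1
    have h0'' : (0 : ℝ) < c i := h0'
    have h1'' : (c i : ℝ) < 1 := h1'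
    exact abs_lt.2 ⟨by simp only [cubeToBall]; linarith, by simp only [cubeToBall]; linarith⟩
  · rintro ⟨i, hi⟩
    refine le_antisymm (norm_cubeToBall_le c) (le_trans (le_of_eq ?_) (norm_le_pi_norm _ i))
    rcases hi with hi | hi <;> norm_num [cubeToBall, hi]

theorem exists_cubeToBall_eq {j : ℕ} {v : Fin j → ℝ} (hv : ‖v‖ ≤ 1) :
    ∃ c, cubeToBall c = v := by
  have h : ∀ i, |v i| ≤ 1 := fun i => (norm_le_pi_norm v i).trans hv
  refine ⟨fun i => ⟨(v i + 1) / 2, ?_, ?_⟩, ?_⟩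
  · linarith [(abs_le.1 (h i)).1]
  · linarith [(abs_le.1 (h i)).2]
  · ext i
    simp only [cubeToBall]
    ring

theorem cubeToBall_injective {j : ℕ} : Function.Injective (cubeToBall : (Fin j → I) → _) := by
  intro c c' h
  ext i
  have := congrFun h i
  simp only [cubeToBall] at this
  linarith

theorem exists_extension_of_subsingleton_homotopyGroup {j : ℕ}
    (hX : ∀ x : X, Subsingleton (HomotopyGroup (Fin (j + 1)) X x))
    (g : (Fin (j + 2) → ℝ) → X) (hg : ContinuousOn g (Metric.sphere 0 1)) :
    ∃ G : (Fin (j + 2) → ℝ) → X, ContinuousOn G (Metric.closedBall 0 1) ∧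
      Set.EqOn G g (Metric.sphere 0 1) := by
  have hmem : ∀ c : Fin (j + 1) → I, wrapBall (cubeToBall c) ∈ Metric.sphere (0 : Fin (j + 2) → ℝ) 1 :=
    fun c => mem_sphere_zero_iff_norm.2 (norm_wrapBall (norm_cubeToBall_le c))
  let ℓ : GenLoop (Fin (j + 1)) X (g (Fin.cons (-1) 0)) :=
    ⟨⟨fun c => g (wrapBall (cubeToBall c)), hg.comp_continuous
      (continuous_wrapBall.comp continuous_cubeToBall) hmem⟩, fun c hc => by
        change g _ = _
        rw [wrapBall_of_norm_eq_one ((norm_cubeToBall_eq_one_iff c).2 hc)]⟩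
  obtain ⟨H⟩ : GenLoop.Homotopic ℓ GenLoop.const :=
    Quotient.exact ((hX _).elim (Quotient.mk _ ℓ) (Quotient.mk _ GenLoop.const))
  let q : C(I × (Fin (j + 1) → I), Metric.closedBall (0 : Fin (j + 2) → ℝ) 1) :=
    ⟨fun p => ⟨(1 - (p.1 : ℝ)) • wrapBall (cubeToBall p.2), by
      rw [mem_closedBall_zero_iff, norm_smul, norm_wrapBall (norm_cubeToBall_le _), mul_one,
        Real.norm_eq_abs, abs_of_nonneg (by linarith [p.1.2.2])]
      linarith [p.1.2.1]⟩, by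
      have := (continuous_wrapBall (j := j + 1)).comp continuous_cubeToBall
      exact Continuous.subtype_mk ((by fun_prop : Continuous fun p : I × (Fin (j + 1) → I) =>
        1 - (p.1 : ℝ)).smul (this.comp continuous_snd)) _⟩
  have hnorm : ∀ p, ‖(q p : Fin (j + 2) → ℝ)‖ = 1 - p.1 := fun p => by
    change ‖(1 - (p.1 : ℝ)) • wrapBall (cubeToBall p.2)‖ = _
    rw [norm_smul, norm_wrapBall (norm_cubeToBall_le _), mul_one,
        Real.norm_eq_abs, abs_of_nonneg (by linarith [p.1.2.2])]
  have hsurj : Function.Surjective q := by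
    rintro ⟨w, hw⟩
    rw [mem_closedBall_zero_iff] at hw
    have key : ∀ u : Fin (j + 2) → ℝ, ‖u‖ = 1 → w = ‖w‖ • u →
        ∃ p, q p = ⟨w, by simpa using hw⟩ := by
      intro u hu hwu
      obtain ⟨v, hv, rfl⟩ := exists_wrapBall_eq hu
      obtain ⟨c, rfl⟩ := exists_cubeToBall_eq hv
      refine ⟨(⟨1 - ‖w‖, by linarith, by linarith [norm_nonneg w]⟩, c), Subtype.ext ?_⟩
      change (1 - (1 - ‖w‖)) • wrapBall (cubeToBall c) = w
      rw [sub_sub_cancel, ← hwu]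
    rcases eq_or_ne w 0 with rfl | hw0
    · exact key (fun _ => 1) (by simp) (by simp)
    · exact key (‖w‖⁻¹ • w) (norm_smul_inv_norm hw0)
        (by rw [smul_smul, mul_inv_cancel₀ (norm_ne_zero_iff.2 hw0), one_smul])
  have hquot : IsQuotientMap q := q.continuous.isClosedMap.isQuotientMap q.continuous hsurj
  have hfib : Function.FactorsThrough H.toContinuousMap q := by
    rintro ⟨s, c⟩ ⟨s', c'⟩ h
    have hs : s = s' := by
      have := (hnorm (s, c)).symm.trans ((congrArg (fun z => ‖Subtype.val z‖) h).trans
        (hnorm (s', c')))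
      exact Subtype.ext (by simpa using this)
    subst hs
    change H (s, c) = H (s, c')
    rcases eq_or_ne s 1 with rfl | hs
    · rw [H.apply_one, H.apply_one]
      rfl
    · have h1 : (1 - (s : ℝ)) ≠ 0 := fun h =>
        hs (Subtype.ext (by simpa using (sub_eq_zero.1 h).symm))
      have h2 : wrapBall (cubeToBall c) = wrapBall (cubeToBall c') :=
        smul_right_injective _ h1 (congrArg Subtype.val h)
      rcases wrapBall_injective (norm_cubeToBall_le c) (norm_cubeToBall_le c') h2 with h3 | ⟨h3, h4⟩
      · rw [cubeToBall_injective h3]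
      · rw [H.eq_snd s ((norm_cubeToBall_eq_one_iff c).1 h3),
          H.eq_snd s ((norm_cubeToBall_eq_one_iff c').1 h4)]
        rfl
  let G := hquot.lift H.toContinuousMap hfib
  have hG : ∀ p, G (q p) = H p := fun p =>
    DFunLike.congr_fun (hquot.lift_comp H.toContinuousMap hfib) p
  refine ⟨fun w => if h : w ∈ Metric.closedBall 0 1 then G ⟨w, h⟩ else g w, ?_, ?_⟩
  · rw [continuousOn_iff_continuous_domRestrict]
    refine G.continuous.congr fun w => ?_
    simp only [Set.domRestrict_apply]
    rw [dif_pos w.2]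
  · intro w hw
    have hw' := Metric.sphere_subset_closedBall hw
    obtain ⟨⟨s, c⟩, hp⟩ := hsurj ⟨w, hw'⟩
    have hs : s = 0 := by
      have h := hnorm (s, c)
      rw [hp] at h
      rw [mem_sphere_zero_iff_norm] at hw
      exact Subtype.ext (by rw [Set.Icc.coe_zero]; linarith)
    subst hs
    have hwc : wrapBall (cubeToBall c) = w := by
      have := congrArg Subtype.val hp
      simpa [q] using this
    simp only [dif_pos hw', ← hp, hG]
    rw [H.apply_zero]
    exact congrArg g hwc

theorem exists_extension_of_pathConnectedSpace [PathConnectedSpace X]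
    (g : (Fin 1 → ℝ) → X) :
    ∃ G : (Fin 1 → ℝ) → X, ContinuousOn G (Metric.closedBall 0 1) ∧
      Set.EqOn G g (Metric.sphere 0 1) := by
  let γ := PathConnectedSpace.somePath (g fun _ => -1) (g fun _ => 1)
  refine ⟨fun z => γ.extend ((z 0 + 1) / 2), ?_, fun z hz => ?_⟩
  · exact (γ.continuous_extend.comp (by fun_prop)).continuousOn
  · have hz0 : |z 0| = 1 := by
      rw [mem_sphere_zero_iff_norm] at hz
      rw [← hz]
      refine le_antisymm (norm_le_pi_norm z 0) ((pi_norm_le_iff_of_nonneg (abs_nonneg _)).2 ?_)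
      intro i
      rw [Subsingleton.elim i 0, Real.norm_eq_abs]
    rcases eq_or_eq_neg_of_abs_eq hz0 with h | h
    · have : z = fun _ => 1 := funext fun i => by rw [Subsingleton.elim i 0, h]
      subst this
      norm_num
    · have : z = fun _ => -1 := funext fun i => by rw [Subsingleton.elim i 0, h]
      subst this
      norm_num

theorem subsingleton_homotopyGroup_zero_iff (x : X) :
    Subsingleton (HomotopyGroup (Fin 0) X x) ↔ PathConnectedSpace X := by
  rw [pathConnectedSpace_iff_zerothHomotopy,
    (HomotopyGroup.pi0EquivZerothHomotopy (X := X) (x := x)).subsingleton_congr]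
  exact ⟨fun h => ⟨⟨Quotient.mk _ x⟩, h⟩, fun h => h.2⟩

/-- Maps from spheres into an `m`-connected space extend over balls of dimension at most
`m + 1`. -/
theorem NConnected.exists_extension {m : ℤ} (hX : NConnected m X) {ι : Type*} [Fintype ι]
    (hι : (Fintype.card ι : ℤ) ≤ m + 1) (g : (ι → ℝ) → X)
    (hg : ContinuousOn g (Metric.sphere 0 1)) :
    ∃ G : (ι → ℝ) → X, ContinuousOn G (Metric.closedBall 0 1) ∧
      Set.EqOn G g (Metric.sphere 0 1) := by
  have hfin : ∀ k : ℕ, (k : ℤ) ≤ m + 1 → ∀ g : (Fin k → ℝ) → X,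
      ContinuousOn g (Metric.sphere 0 1) →
      ∃ G : (Fin k → ℝ) → X, ContinuousOn G (Metric.closedBall 0 1) ∧
        Set.EqOn G g (Metric.sphere 0 1) := by
    intro k hk g hg
    match k with
    | 0 => exact ⟨g, continuous_of_discreteTopology.continuousOn, fun _ _ => rfl⟩
    | 1 =>
      have := (subsingleton_homotopyGroup_zero_iff (g 0)).1 (hX.2 0 (by push_cast at *; omega) (g 0))
      exact exists_extension_of_pathConnectedSpace g
    | j + 2 =>
      exact exists_extension_of_subsingleton_homotopyGroup
        (hX.2 (j + 1) (by push_cast at *; omega)) g hg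
  let e := Fintype.equivFin ι
  have hnorm : ∀ z : ι → ℝ, ‖z ∘ e.symm‖ = ‖z‖ := fun z => by
    refine le_antisymm ((pi_norm_le_iff_of_nonneg (norm_nonneg _)).2 fun i =>
      norm_le_pi_norm z _) ((pi_norm_le_iff_of_nonneg (norm_nonneg _)).2 fun i => ?_)
    simpa using norm_le_pi_norm (z ∘ e.symm) (e i)
  obtain ⟨G, hG, hGg⟩ := hfin _ hι (fun z => g (z ∘ e)) (hg.comp (by fun_prop) fun z hz => by
    rw [mem_sphere_zero_iff_norm] at hz ⊢
    rw [← hnorm, ← hz]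
    congr 1
    ext i
    simp)
  refine ⟨fun z => G (z ∘ e.symm), hG.comp (by fun_prop) fun z hz => ?_, fun z hz => ?_⟩
  · rw [mem_closedBall_zero_iff] at hz ⊢
    rwa [hnorm]
  · rw [mem_sphere_zero_iff_norm] at hz
    change G (z ∘ e.symm) = _
    rw [hGg (mem_sphere_zero_iff_norm.2 ((hnorm z).trans hz))]
    exact congrArg g (funext fun i => by simp)

end SphereExtension

section Skeleton

variable {X : Type u} [TopologicalSpace X] {ι : Type*}

/-- A set of points of `ℝ^ι` is cellular if it is a union of closed cells of the cell structure on
`ℝ^ι` given by the unit cubes with integral vertices. -/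
def IsCellular (K : Set (ι → ℝ)) : Prop :=
  ∀ z ∈ K, ∀ w : ι → ℝ, (∀ i, (⌊z i⌋ : ℝ) ≤ w i ∧ w i ≤ ⌈z i⌉) → w ∈ K

/-- The closed cell with lowest vertex `l` and with directions the elements of `S`. -/
def unitCell (l : ι → ℤ) (S : Finset ι) : Set (ι → ℝ) :=
  {z | ∀ i, (l i : ℝ) ≤ z i ∧ z i ≤ if i ∈ S then (l i : ℝ) + 1 else l i}

theorem isClosed_unitCell (l : ι → ℤ) (S : Finset ι) : IsClosed (unitCell l S) := by
  simp only [unitCell, Set.ofPred_forall]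
  refine isClosed_iInter fun i => IsClosed.inter
    (isClosed_le (f := fun _ => (l i : ℝ)) (g := fun z : ι → ℝ => z i) ?_ ?_)
    (isClosed_le (f := fun z : ι → ℝ => z i)
      (g := fun _ => if i ∈ S then (l i : ℝ) + 1 else l i) ?_ ?_) <;> fun_prop

theorem isCellular_unitCell (l : ι → ℤ) (S : Finset ι) : IsCellular (unitCell l S) := by
  intro z hz w hw i
  refine ⟨le_trans (Int.cast_le.2 (Int.le_floor.2 (hz i).1)) (hw i).1, (hw i).2.trans ?_⟩
  have h := (hz i).2
  split_ifs at h ⊢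
  · exact_mod_cast Int.ceil_le.2 (by exact_mod_cast h)
  · exact_mod_cast Int.ceil_le.2 h

theorem IsCellular.union {K L : Set (ι → ℝ)} (hK : IsCellular K) (hL : IsCellular L) :
    IsCellular (K ∪ L) :=
  fun z hz w hw => hz.imp (fun h => hK z h w hw) fun h => hL z h w hw

/-- Extension over a single cell whose boundary belongs to the domain of definition. -/
theorem NConnected.exists_extension_unitCell {m : ℤ} (hX : NConnected m X)
    {A : Set (ι → ℝ)} (hA : IsClosed A) (hA' : IsCellular A) {x : (ι → ℝ) → X}
    (hx : ContinuousOn x A) (l : ι → ℤ) (S : Finset ι) (hS : (S.card : ℤ) ≤ m + 1)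
    (hbd : ∀ z ∈ unitCell l S, (∃ i ∈ S, z i = l i ∨ z i = l i + 1) → z ∈ A) :
    ∃ x' : (ι → ℝ) → X, ContinuousOn x' (A ∪ unitCell l S) ∧ Set.EqOn x' x A := by
  by_cases hsub : unitCell l S ⊆ A
  · exact ⟨x, by rwa [Set.union_eq_self_of_subset_right hsub], fun _ _ => rfl⟩
  have hint : ∀ z ∈ unitCell l S, z ∈ A → ∃ i ∈ S, z i = l i ∨ z i = l i + 1 := by
    intro z hz hzA
    by_contra! h
    refine hsub fun w hw => hA' z hzA w fun i => ?_
    have h1 := hz i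
    have h2 := hw i
    by_cases hi : i ∈ S
    · simp only [hi, if_true] at h1 h2
      have h3 := h i hi
      have hf : ⌊z i⌋ = l i := Int.floor_eq_iff.2 ⟨h1.1, lt_of_le_of_ne h1.2 h3.2⟩
      have hc : ⌈z i⌉ = l i + 1 := Int.ceil_eq_iff.2
        ⟨by push_cast; linarith [lt_of_le_of_ne h1.1 h3.1.symm], by push_cast; exact h1.2⟩
      rw [hf, hc]
      push_cast
      exact h2
    · simp only [hi, if_false] at h1 h2
      have h4 : z i = l i := le_antisymm h1.2 h1.1
      rw [h4, Int.floor_intCast, Int.ceil_intCast]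
      exact h2
  let φ : (ι → ℝ) → (S → ℝ) := fun z i => 2 * (z i - l i) - 1
  let ψ : (S → ℝ) → (ι → ℝ) := fun v i =>
    if h : i ∈ S then (l i : ℝ) + (v ⟨i, h⟩ + 1) / 2 else l i
  have hφ : Continuous φ := by fun_prop
  have hψ : Continuous ψ := by
    refine continuous_pi fun i => ?_
    by_cases h : i ∈ S
    · simp only [ψ, h, dif_pos]
      fun_prop
    · simp only [ψ, h, dif_neg, not_false_eq_true]
      fun_prop
  have hψφ : ∀ z ∈ unitCell l S, ψ (φ z) = z := by
    intro z hz
    funext i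
    have h1 := hz i
    by_cases hi : i ∈ S
    · simp only [ψ, φ, hi, dif_pos]
      ring
    · simp only [hi, if_false] at h1
      simp only [ψ, hi, dif_neg, not_false_eq_true]
      exact le_antisymm h1.1 h1.2
  have hφmem : ∀ z ∈ unitCell l S, φ z ∈ Metric.closedBall 0 1 := by
    intro z hz
    rw [mem_closedBall_zero_iff, pi_norm_le_iff_of_nonneg zero_le_one]
    intro i
    have h1 := hz i
    simp only [i.2, if_true] at h1
    rw [Real.norm_eq_abs, abs_le]
    constructor <;> simp only [φ] <;> linarith
  have hφsph : ∀ z ∈ unitCell l S, z ∈ A → φ z ∈ Metric.sphere 0 1 := by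
    intro z hz hzA
    obtain ⟨i, hi, h⟩ := hint z hz hzA
    have h1 := hφmem z hz
    rw [mem_closedBall_zero_iff] at h1
    rw [mem_sphere_zero_iff_norm]
    refine le_antisymm h1 (le_trans ?_ (norm_le_pi_norm (φ z) ⟨i, hi⟩))
    rcases h with h | h <;> simp [φ, h]
    norm_num
  have hψmem : ∀ v ∈ Metric.sphere (0 : S → ℝ) 1, ψ v ∈ A := by
    intro v hv
    rw [mem_sphere_zero_iff_norm] at hv
    have hle : ∀ i, |v i| ≤ 1 := fun i => (norm_le_pi_norm v i).trans hv.le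
    have hex : ∃ i, |v i| = 1 := by
      by_contra! h
      have h' : ∀ i, ‖v i‖ < 1 := fun i => lt_of_le_of_ne (hle i) (h i)
      exact ((pi_norm_lt_iff one_pos).2 h').ne hv
    refine hbd _ (fun i => ?_) ?_
    · by_cases hi : i ∈ S
      · have := abs_le.1 (hle ⟨i, hi⟩)
        simp only [ψ, hi, dif_pos, if_true]
        constructor <;> linarith
      · simp [ψ, hi]
    · obtain ⟨⟨i, hi⟩, h⟩ := hex
      refine ⟨i, hi, ?_⟩
      simp only [ψ, hi, dif_pos]
      rcases eq_or_eq_neg_of_abs_eq h with h | h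
      · right; rw [h]; norm_num
      · left; rw [h]; norm_num
  obtain ⟨G, hG, hGx⟩ := hX.exists_extension (ι := S) (by simpa using hS) (fun v => x (ψ v))
    (hx.comp hψ.continuousOn hψmem)
  have hEq : Set.EqOn (fun z => if z ∈ A then x z else G (φ z)) (fun z => G (φ z))
      (unitCell l S) := by
    intro z hz
    by_cases hzA : z ∈ A
    · simp only [hzA, if_true]
      exact ((hGx (hφsph z hz hzA)).trans (congrArg x (hψφ z hz))).symm
    · simp only [hzA, if_false]
  refine ⟨fun z => if z ∈ A then x z else G (φ z), ?_, fun z hz => if_pos hz⟩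
  exact (hx.congr fun z hz => if_pos hz).union_of_isClosed
    ((hG.comp hφ.continuousOn hφmem).congr hEq) hA (isClosed_unitCell l S)

/-- Extension of a map into an `m`-connected space over a finite collection of cells of dimension
at most `m + 1`. -/
theorem NConnected.exists_extension_iUnion_unitCell {m : ℤ} (hX : NConnected m X)
    {K : Set (ι → ℝ)} (hK : IsClosed K) (hK' : IsCellular K) {x : (ι → ℝ) → X}
    (hx : ContinuousOn x K) (T : Finset ((ι → ℤ) × Finset ι))
    (hT : ∀ c ∈ T, (c.2.card : ℤ) ≤ m + 1)
    (hbd : ∀ c ∈ T, ∀ z ∈ unitCell c.1 c.2, (∃ i ∈ c.2, z i = c.1 i ∨ z i = c.1 i + 1) →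
      z ∈ K ∨ ∃ c' ∈ T, c'.2.card < c.2.card ∧ z ∈ unitCell c'.1 c'.2) :
    ∃ (E : Set (ι → ℝ)) (x' : (ι → ℝ) → X), IsClosed E ∧ IsCellular E ∧ K ⊆ E ∧
      (∀ c ∈ T, unitCell c.1 c.2 ⊆ E) ∧ ContinuousOn x' E ∧ Set.EqOn x' x K := by
  induction T using Finset.induction_on_max_value
    (f := fun c : (ι → ℤ) × Finset ι => c.2.card) with
  | empty => exact ⟨K, x, hK, hK', subset_rfl, by simp, hx, fun _ _ => rfl⟩
  | insert c T hc hmax ih =>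
    obtain ⟨E, x', hE, hE', hKE, hTE, hx', hxx'⟩ := ih
      (fun c hc => hT c (Finset.mem_insert_of_mem hc)) (by
        intro c₁ hc₁ z hz hi
        refine (hbd c₁ (Finset.mem_insert_of_mem hc₁) z hz hi).imp_right ?_
        rintro ⟨c', hc', hlt, hz'⟩
        rcases Finset.mem_insert.1 hc' with rfl | hc'
        · exact absurd (hmax c₁ hc₁) (not_le.2 hlt)
        · exact ⟨c', hc', hlt, hz'⟩)
    obtain ⟨x'', hx'', hxx''⟩ := hX.exists_extension_unitCell hE hE' hx' c.1 c.2
      (hT c (Finset.mem_insert_self c T)) (by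
        intro z hz hi
        rcases hbd c (Finset.mem_insert_self c T) z hz hi with h | ⟨c', hc', hlt, hz'⟩
        · exact hKE h
        · rcases Finset.mem_insert.1 hc' with rfl | hc'
          · exact absurd hlt (lt_irrefl _)
          · exact hTE c' hc' hz')
    refine ⟨E ∪ unitCell c.1 c.2, x'', hE.union (isClosed_unitCell _ _),
      hE'.union (isCellular_unitCell _ _), hKE.trans Set.subset_union_left, ?_, hx'',
      fun z hz => (hxx'' (hKE hz)).trans (hxx' hz)⟩
    intro c' hc'
    rcases Finset.mem_insert.1 hc' with rfl | hc'
    · exact Set.subset_union_right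
    · exact (hTE c' hc').trans Set.subset_union_left

/-- Extension of a map into an `m`-connected space over the `p`-skeleton of a cube, for
`p ≤ m + 1`. -/
theorem NConnected.exists_extension_skeleton {m : ℤ} (hX : NConnected m X) [Fintype ι]
    {p : ℕ} (hp : (p : ℤ) ≤ m + 1) {N : ℕ} {K : Set (ι → ℝ)} (hK : IsClosed K)
    (hK' : IsCellular K) (hKN : ∀ z : ι → ℝ, (∃ i, z i ≤ 0 ∨ N ≤ z i) → z ∈ K)
    {x : (ι → ℝ) → X} (hx : ContinuousOn x K) :
    ∃ (E : Set (ι → ℝ)) (x' : (ι → ℝ) → X), IsClosed E ∧ K ⊆ E ∧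
      (∀ z : ι → ℝ, (Finset.univ.filter fun i => Int.fract (z i) ≠ 0).card ≤ p → z ∈ E) ∧
      ContinuousOn x' E ∧ Set.EqOn x' x K := by
  let T : Finset ((ι → ℤ) × Finset ι) :=
    (Fintype.piFinset fun _ => Finset.Icc 0 (N : ℤ)) ×ˢ (Finset.univ.filter fun S => S.card ≤ p)
  let S : (ι → ℝ) → Finset ι := fun z => Finset.univ.filter fun i => Int.fract (z i) ≠ 0
  have hself : ∀ z : ι → ℝ, z ∈ unitCell (fun i => ⌊z i⌋) (S z) := by
    intro z i
    refine ⟨Int.floor_le _, ?_⟩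
    split_ifs with h
    · exact (Int.lt_floor_add_one _).le
    · have : Int.fract (z i) = 0 := by simpa [S] using h
      linarith [Int.self_sub_floor (z i)]
  have hmem : ∀ z : ι → ℝ, z ∉ K → (S z).card ≤ p → ((fun i => ⌊z i⌋), S z) ∈ T := by
    intro z hz hzp
    have hz' : ∀ i, 0 < z i ∧ z i < N := by
      intro i
      by_contra h
      refine hz (hKN z ⟨i, ?_⟩)
      by_contra! h'
      exact h h'
    simp only [T, Finset.mem_product, Fintype.mem_piFinset, Finset.mem_Icc, Finset.mem_filter,
      Finset.mem_univ, true_and]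
    exact ⟨fun i => ⟨Int.floor_nonneg.2 (hz' i).1.le,
      Int.cast_le.1 ((Int.floor_le _).trans (hz' i).2.le : ((⌊z i⌋ : ℤ) : ℝ) ≤ ((N : ℤ) : ℝ))⟩, hzp⟩
  obtain ⟨E, x', hE, -, hKE, hTE, hx', hxx'⟩ := hX.exists_extension_iUnion_unitCell hK hK' hx T
    (by
      intro c hc
      have : c.2.card ≤ p := by simpa [T] using (Finset.mem_product.1 hc).2
      omega)
    (by
      rintro c hc z hz ⟨i, hi, hzi⟩
      by_cases hzK : z ∈ K
      · exact Or.inl hzK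
      have hcp : c.2.card ≤ p := by simpa [T] using (Finset.mem_product.1 hc).2
      have hlt : (S z).card < c.2.card := by
        refine Finset.card_lt_card ((Finset.ssubset_iff_of_subset fun j hj => ?_).2 ⟨i, hi, ?_⟩)
        · by_contra hjc
          have h := hz j
          simp only [hjc, if_false] at h
          have h' : z j = c.1 j := le_antisymm h.2 h.1
          simp [S, h'] at hj
        · rcases hzi with h | h <;> simp [S, h]
      exact Or.inr ⟨_, hmem z hzK (hlt.le.trans hcp), hlt, hself z⟩)
  refine ⟨E, x', hE, hKE, fun z hz => ?_, hx', hxx'⟩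
  by_cases hzK : z ∈ K
  · exact hKE hzK
  · exact hTE _ (hmem z hzK hz) (hself z)

end Skeleton

section Pinch

variable {ι : Type*}

/-- The points all of whose closed unit cells are contained in `U`. -/
def cellularCore (U : Set (ι → ℝ)) : Set (ι → ℝ) :=
  {z | ∀ w : ι → ℝ, (∀ i, (⌊z i⌋ : ℝ) ≤ w i ∧ w i ≤ ⌈z i⌉) → w ∈ U}

theorem cellularCore_subset (U : Set (ι → ℝ)) : cellularCore U ⊆ U :=
  fun z hz => hz z fun _ => ⟨Int.floor_le _, Int.le_ceil _⟩

theorem isCellular_cellularCore (U : Set (ι → ℝ)) : IsCellular (cellularCore U) := by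
  intro z hz w hw v hv
  refine hz v fun i => ⟨le_trans ?_ (hv i).1, (hv i).2.trans ?_⟩
  · exact_mod_cast Int.le_floor.2 (hw i).1
  · exact_mod_cast Int.ceil_le.2 (hw i).2

theorem isClosed_cellularCore [Finite ι] (U : Set (ι → ℝ)) : IsClosed (cellularCore U) := by
  rw [← isOpen_compl_iff, isOpen_iff_mem_nhds]
  intro z hz
  have hz' : ∃ w : ι → ℝ, (∀ i, (⌊z i⌋ : ℝ) ≤ w i ∧ w i ≤ ⌈z i⌉) ∧ w ∉ U := by
    by_contra! h
    exact hz h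
  obtain ⟨w, hw, hwU⟩ := hz'
  have hnear : ∀ᶠ z' : ι → ℝ in 𝓝 z, ∀ i, z' i ∈ Set.Ioo ((⌈z i⌉ : ℝ) - 1) (⌊z i⌋ + 1) :=
    Filter.eventually_all.2 fun i => (continuous_apply i).continuousAt.eventually_mem
      (Ioo_mem_nhds (by linarith [Int.ceil_lt_add_one (z i)]) (Int.lt_floor_add_one _))
  filter_upwards [hnear] with z' hz' h
  refine hwU (h w fun i => ⟨le_trans ?_ (hw i).1, (hw i).2.trans ?_⟩)
  · exact_mod_cast Int.lt_add_one_iff.1 (Int.floor_lt.2 (by exact_mod_cast (hz' i).2))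
  · have : ⌈z i⌉ - 1 < ⌈z' i⌉ := Int.lt_ceil.2 (by exact_mod_cast (hz' i).1)
    exact_mod_cast Int.sub_one_lt_iff.1 this

/-- The complement of an open cube with edges of length `N`. -/
def cubeExterior (ι : Type*) (N : ℕ) : Set (ι → ℝ) :=
  {z | ∃ i, z i ≤ 0 ∨ N ≤ z i}

theorem isClosed_cubeExterior [Finite ι] (N : ℕ) : IsClosed (cubeExterior ι N) := by
  simp only [cubeExterior, Set.ofPred_exists]
  refine isClosed_iUnion_of_finite fun i => IsClosed.union
    (isClosed_le (f := fun z : ι → ℝ => z i) (g := fun _ => (0 : ℝ)) ?_ ?_)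
    (isClosed_le (f := fun _ => (N : ℝ)) (g := fun z : ι → ℝ => z i) ?_ ?_) <;> fun_prop

theorem isCellular_cubeExterior (N : ℕ) : IsCellular (cubeExterior ι N) := by
  rintro z ⟨i, hi⟩ w hw
  refine ⟨i, hi.imp (fun h => (hw i).2.trans ?_) fun h => le_trans ?_ (hw i).1⟩
  · exact_mod_cast Int.ceil_le.2 (by exact_mod_cast h)
  · have : (N : ℤ) ≤ ⌊z i⌋ := Int.le_floor.2 (by exact_mod_cast h)
    exact_mod_cast this

/-- Projection of the reals to the unit interval. -/
def clamp (t : ℝ) : ℝ := max 0 (min 1 t)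

@[fun_prop]
theorem Continuous.clamp {Z : Type*} [TopologicalSpace Z] {f : Z → ℝ} (hf : Continuous f) :
    Continuous fun z => clamp (f z) :=
  continuous_const.max (continuous_const.min hf)

theorem clamp_mem (t : ℝ) : clamp t ∈ I := ⟨le_max_left _ _, max_le zero_le_one (min_le_left _ _)⟩

theorem clamp_of_nonpos {t : ℝ} (h : t ≤ 0) : clamp t = 0 := by
  rw [clamp, min_eq_right (by linarith), max_eq_left h]

theorem clamp_of_one_le {t : ℝ} (h : 1 ≤ t) : clamp t = 1 := by
  rw [clamp, min_eq_left h, max_eq_right zero_le_one]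

/-- A deformation, with parameter `r`, of the real line which preserves the unit intervals with
integral ends, and which finally stretches the middle part `[δ / 3, (δ + 1) / 3]` of any such
interval over the whole interval. -/
def stretch (δ r s : ℝ) : ℝ := s + r * (clamp (3 * Int.fract s - δ) - Int.fract s)

theorem continuous_stretch {Z : Type*} [TopologicalSpace Z] {δ : ℝ} (h0 : 0 ≤ δ) (h2 : δ ≤ 2)
    {r s : Z → ℝ} (hr : Continuous r) (hs : Continuous s) :
    Continuous fun z => stretch δ (r z) (s z) := by
  refine hs.add (ContinuousOn.comp_fract (f := fun z u => r z * (clamp (3 * u - δ) - u))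
    (Continuous.continuousOn ?_) hs fun z => ?_)
  · simp only [Function.uncurry_def]
    fun_prop
  · rw [clamp_of_nonpos (by linarith), clamp_of_one_le (by linarith)]
    ring

@[simp]
theorem stretch_zero (δ s : ℝ) : stretch δ 0 s = s := by simp [stretch]

theorem stretch_mem {δ r : ℝ} (h0 : 0 ≤ δ) (hr : r ∈ I) (s : ℝ) :
    (⌊s⌋ : ℝ) ≤ stretch δ r s ∧ stretch δ r s ≤ ⌈s⌉ := by
  have hs := Int.floor_add_fract s
  obtain ⟨hr0, hr1⟩ := hr
  have hc := clamp_mem (3 * Int.fract s - δ)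
  have hu0 := Int.fract_nonneg s
  have hu1 := (Int.fract_lt_one s).le
  have heq : stretch δ r s = ⌊s⌋ + ((1 - r) * Int.fract s + r * clamp (3 * Int.fract s - δ)) := by
    rw [stretch]
    linarith
  have hl1 := mul_nonneg (sub_nonneg.2 hr1) hu0
  have hl2 := mul_nonneg hr0 hc.1
  refine ⟨by linarith, ?_⟩
  rcases eq_or_ne (Int.fract s) 0 with h | h
  · rw [heq, h, clamp_of_nonpos (by linarith)]
    have := Int.floor_le_ceil s
    have : (⌊s⌋ : ℝ) ≤ ⌈s⌉ := by exact_mod_cast this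
    linarith
  · have h1 : (⌈s⌉ : ℝ) = ⌊s⌋ + 1 := by
      have := Int.ceil_eq_add_one_sub_fract h
      linarith
    have hl3 := mul_le_mul_of_nonneg_left hu1 (sub_nonneg.2 hr1)
    have hl4 := mul_le_mul_of_nonneg_left hc.2 hr0
    linarith

theorem lt_fract_of_fract_stretch_ne_zero {δ s : ℝ} (h : Int.fract (stretch δ 1 s) ≠ 0) :
    δ < 3 * Int.fract s ∧ 3 * Int.fract s < δ + 1 := by
  have heq : stretch δ 1 s = clamp (3 * Int.fract s - δ) + (⌊s⌋ : ℤ) := by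
    rw [stretch]
    linarith [Int.floor_add_fract s]
  rw [heq, Int.fract_add_intCast] at h
  constructor
  · by_contra! h'
    exact h (by rw [clamp_of_nonpos (by linarith), Int.fract_zero])
  · by_contra! h'
    exact h (by rw [clamp_of_one_le (by linarith), Int.fract_one])

/-- After stretching the cells, a map into an `m`-connected space extends over all the points with
at most `m + 1` coordinates in the middle part of the unit intervals. -/
theorem NConnected.exists_extension_stretch {X : Type u} [TopologicalSpace X] {m : ℤ}
    (hX : NConnected m X) [Fintype ι] {p : ℕ} (hp : (p : ℤ) ≤ m + 1) {N : ℕ} {K : Set (ι → ℝ)}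
    (hK : IsClosed K) (hK' : IsCellular K) (hKN : cubeExterior ι N ⊆ K)
    {x : (ι → ℝ) → X} (hx : ContinuousOn x K) {δ : ℝ} (h0 : 0 ≤ δ) (h2 : δ ≤ 2) :
    ∃ (E : Set (ι → ℝ)) (x' : (ι → ℝ) → X), IsClosed E ∧ K ⊆ E ∧ ContinuousOn x' E ∧
      (∀ z ∈ K, x' z = x fun i => stretch δ 1 (z i)) ∧
      ∀ z ∉ E, p < (Finset.univ.filter fun i =>
        δ < 3 * Int.fract (z i) ∧ 3 * Int.fract (z i) < δ + 1).card := by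
  obtain ⟨E, x', hE, hKE, hpE, hx', hxx'⟩ := hX.exists_extension_skeleton hp hK hK' hKN hx
  have hc : Continuous fun (z : ι → ℝ) i => stretch δ 1 (z i) :=
    continuous_pi fun i => continuous_stretch h0 h2 continuous_const (continuous_apply i)
  have hcK : ∀ z ∈ K, (fun i => stretch δ 1 (z i)) ∈ K := fun z hz =>
    hK' z hz _ fun i => stretch_mem h0 (Set.right_mem_Icc.2 zero_le_one) (z i)
  refine ⟨(fun z i => stretch δ 1 (z i)) ⁻¹' E, fun z => x' fun i => stretch δ 1 (z i),
    hE.preimage hc, fun z hz => hKE (hcK z hz), hx'.comp hc.continuousOn fun z hz => hz,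
    fun z hz => hxx' (hcK z hz), fun z hz => ?_⟩
  by_contra! h
  refine hz (hpE _ ((Finset.card_le_card fun i hi => ?_).trans h))
  simp only [Finset.mem_filter, Finset.mem_univ, true_and] at hi ⊢
  exact lt_fract_of_fract_stretch_ne_zero hi

/-- A periodic function with value one near `1 / 4` and value zero near `3 / 4`. -/
def bump (s : ℝ) : ℝ := clamp (1 / 2 + Real.sin (2 * Real.pi * s))

@[fun_prop]
theorem continuous_bump : Continuous bump := by
  unfold bump
  fun_prop

theorem sin_two_pi_mul_fract (s : ℝ) :
    Real.sin (2 * Real.pi * Int.fract s) = Real.sin (2 * Real.pi * s) := by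
  rw [← Real.sin_sub_int_mul_two_pi (2 * Real.pi * s) ⌊s⌋, ← Int.self_sub_floor]
  congr 1
  ring

theorem bump_eq_one {s : ℝ} (h : 1 / 4 < 3 * Int.fract s ∧ 3 * Int.fract s < 1 / 4 + 1) :
    bump s = 1 := by
  have hpi := Real.pi_pos
  refine clamp_of_one_le ?_
  rw [← sin_two_pi_mul_fract, ← Real.cos_sub_pi_div_two, ← Real.cos_abs]
  have := Real.cos_le_cos_of_nonneg_of_le_pi
    (abs_nonneg (2 * Real.pi * Int.fract s - Real.pi / 2)) (y := Real.pi / 3) (by linarith)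
    (abs_le.2 ⟨by nlinarith, by nlinarith⟩)
  rw [Real.cos_pi_div_three] at this
  linarith

theorem bump_eq_zero {s : ℝ} (h : 7 / 4 < 3 * Int.fract s ∧ 3 * Int.fract s < 7 / 4 + 1) :
    bump s = 0 := by
  have hpi := Real.pi_pos
  refine clamp_of_nonpos ?_
  rw [← sin_two_pi_mul_fract, ← neg_neg (Real.sin _), ← Real.sin_sub_pi,
    ← Real.cos_sub_pi_div_two, ← Real.cos_abs]
  have := Real.cos_le_cos_of_nonneg_of_le_pi
    (abs_nonneg (2 * Real.pi * Int.fract s - Real.pi - Real.pi / 2)) (y := Real.pi / 3)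
    (by linarith) (abs_le.2 ⟨by nlinarith, by nlinarith⟩)
  rw [Real.cos_pi_div_three] at this
  linarith

/-- A function of the coordinates of positive index which separates the points with many
coordinates near `1 / 4` from the points with many coordinates near `3 / 4`. -/
def separator {k : ℕ} (p : ℕ) (z : Fin (k + 1) → ℝ) : ℝ :=
  clamp (∑ i : Fin k, bump (z i.succ) - p + 1)

@[fun_prop]
theorem continuous_separator {k : ℕ} (p : ℕ) :
    Continuous (separator p : (Fin (k + 1) → ℝ) → ℝ) := by
  unfold separator
  fun_prop

theorem separator_update {k : ℕ} (p : ℕ) (z : Fin (k + 1) → ℝ) (r : ℝ) :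
    separator p (Function.update z 0 r) = separator p z := by
  simp [separator]

theorem card_filter_fin_succ_le {k : ℕ} (P : Fin (k + 1) → Prop) [DecidablePred P] :
    (Finset.univ.filter P).card ≤ (Finset.univ.filter fun i : Fin k => P i.succ).card + 1 := by
  rw [Fin.card_filter_univ_succ]
  split_ifs <;> simp

theorem separator_eq_one {k p : ℕ} {z : Fin (k + 1) → ℝ}
    (h : p < (Finset.univ.filter fun i =>
      1 / 4 < 3 * Int.fract (z i) ∧ 3 * Int.fract (z i) < 1 / 4 + 1).card) :
    separator p z = 1 := by
  refine clamp_of_one_le ?_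
  have h1 := Nat.lt_succ_iff.1 (h.trans_le (card_filter_fin_succ_le _))
  have h2 : (p : ℝ) ≤ ∑ i : Fin k, bump (z i.succ) := by
    refine le_trans (Nat.cast_le.2 h1) ?_
    rw [Finset.card_eq_sum_ones, Nat.cast_sum, Finset.sum_filter]
    refine Finset.sum_le_sum fun i _ => ?_
    split_ifs with hi
    · simp [bump_eq_one hi]
    · exact (clamp_mem _).1
  linarith

theorem separator_eq_zero {k p q : ℕ} (hk : k + 1 ≤ p + q) {z : Fin (k + 1) → ℝ}
    (h : q < (Finset.univ.filter fun i =>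
      7 / 4 < 3 * Int.fract (z i) ∧ 3 * Int.fract (z i) < 7 / 4 + 1).card) :
    separator p z = 0 := by
  refine clamp_of_nonpos ?_
  have h1 := Nat.lt_succ_iff.1 (h.trans_le (card_filter_fin_succ_le _))
  have h2 : (q : ℝ) ≤ ∑ i : Fin k, (1 - bump (z i.succ)) := by
    refine le_trans (Nat.cast_le.2 h1) ?_
    rw [Finset.card_eq_sum_ones, Nat.cast_sum, Finset.sum_filter]
    refine Finset.sum_le_sum fun i _ => ?_
    split_ifs with hi
    · simp [bump_eq_zero hi]
    · exact sub_nonneg.2 (clamp_mem _).2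
  rw [Finset.sum_sub_distrib] at h2
  have h3 : (k : ℝ) + 1 ≤ p + q := by exact_mod_cast hk
  simp only [Finset.sum_const, Finset.card_univ, Fintype.card_fin, nsmul_eq_mul, mul_one] at h2
  linarith

end Pinch

section Deformation

variable {X : Type u} {Y : Type v} [TopologicalSpace X] [TopologicalSpace Y]

/-- Two maps into a join are homotopic through maps sending every point of `O` to the segment
over `(x₀, y₀)`. -/
def SegHomotopic {Z : Type*} [TopologicalSpace Z] (O : Set Z) (x₀ : X) (y₀ : Y)
    (f g : Z → TopJoin X Y) : Prop :=
  ∃ (hf : Continuous f) (hg : Continuous g), ContinuousMap.HomotopicWith ⟨f, hf⟩ ⟨g, hg⟩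
    fun h => ∀ z ∈ O, ∃ t, h z = TopJoin.mk x₀ y₀ t

namespace SegHomotopic

variable {Z : Type*} [TopologicalSpace Z] {O : Set Z} {x₀ : X} {y₀ : Y}

theorem trans {f g h : Z → TopJoin X Y} (hfg : SegHomotopic O x₀ y₀ f g)
    (hgh : SegHomotopic O x₀ y₀ g h) : SegHomotopic O x₀ y₀ f h := by
  obtain ⟨hf, hg, h₁⟩ := hfg
  obtain ⟨hg', hh, h₂⟩ := hgh
  exact ⟨hf, hh, h₁.trans h₂⟩

theorem of_continuous {H : I × Z → TopJoin X Y} (hH : Continuous H)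
    (hO : ∀ s, ∀ z ∈ O, ∃ t, H (s, z) = TopJoin.mk x₀ y₀ t) :
    SegHomotopic O x₀ y₀ (fun z => H (0, z)) fun z => H (1, z) :=
  ⟨by fun_prop, by fun_prop, ⟨{
    toFun := H
    continuous_toFun := hH
    map_zero_left := fun _ => rfl
    map_one_left := fun _ => rfl
    prop' := hO }⟩⟩

theorem of_isClosed {E E' : Set (I × Z)} (hE : IsClosed E) (hE' : IsClosed E')
    {x : I × Z → X} {y : I × Z → Y} {t : I × Z → I}
    (hx : ContinuousOn x E) (hy : ContinuousOn y E') (ht : Continuous t)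
    (h1 : ∀ z ∉ E, t z = 1) (h0 : ∀ z ∉ E', t z = 0)
    (hxO : ∀ s, ∀ z ∈ O, x (s, z) = x₀) (hyO : ∀ s, ∀ z ∈ O, y (s, z) = y₀) :
    SegHomotopic O x₀ y₀ (fun z => TopJoin.mk (x (0, z)) (y (0, z)) (t (0, z)))
      fun z => TopJoin.mk (x (1, z)) (y (1, z)) (t (1, z)) :=
  of_continuous (H := fun z => TopJoin.mk (x z) (y z) (t z))
    (TopJoin.continuous_mk_of_isClosed hE hE' hx hy ht h1 h0)
    fun s z hz => ⟨t (s, z), by simp only [hxO s z hz, hyO s z hz]⟩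

end SegHomotopic

/-- Extension of a partially defined map, first by a constant outside of a cube and then, after
stretching the cells, to all the points with few coordinates in the middle part of the unit
intervals. -/
theorem NConnected.exists_extension_cubeExterior {m : ℤ} (hX : NConnected m X) {ι : Type*}
    [Fintype ι] {p : ℕ} (hp : (p : ℤ) ≤ m + 1) (N : ℕ) {U : Set (ι → ℝ)} {x : (ι → ℝ) → X}
    (hx : ContinuousOn x U) {x₀ : X} (hx₀ : ∀ z ∈ cubeExterior ι N, z ∈ U → x z = x₀)
    {δ : ℝ} (h0 : 0 ≤ δ) (h2 : δ ≤ 2) :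
    ∃ (K E : Set (ι → ℝ)) (x' x'' : (ι → ℝ) → X), IsClosed K ∧ IsCellular K ∧
      cubeExterior ι N ⊆ K ∧ cellularCore U ⊆ K ∧ ContinuousOn x' K ∧
      (∀ z ∈ cubeExterior ι N, x' z = x₀) ∧ (∀ z ∉ cubeExterior ι N, x' z = x z) ∧
      IsClosed E ∧ K ⊆ E ∧ ContinuousOn x'' E ∧
      (∀ z ∈ K, x'' z = x' fun i => stretch δ 1 (z i)) ∧
      ∀ z ∉ E, p < (Finset.univ.filter fun i =>
        δ < 3 * Int.fract (z i) ∧ 3 * Int.fract (z i) < δ + 1).card := by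
  let x' : (ι → ℝ) → X := fun z => if z ∈ cubeExterior ι N then x₀ else x z
  have hx'O : ∀ z ∈ cubeExterior ι N, x' z = x₀ := fun z hz => if_pos hz
  have hx' : ∀ z ∉ cubeExterior ι N, x' z = x z := fun z hz => if_neg hz
  have hO := isClosed_cubeExterior (ι := ι) N
  have hU := isClosed_cellularCore U
  have hc : ContinuousOn x' (cubeExterior ι N ∪ cellularCore U) := by
    refine ContinuousOn.union_of_isClosed (continuousOn_const.congr hx'O)
      ((hx.mono (cellularCore_subset U)).congr fun z hz => ?_) hO hU
    by_cases hzO : z ∈ cubeExterior ι N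
    · rw [hx'O z hzO, hx₀ z hzO (cellularCore_subset U hz)]
    · exact hx' z hzO
  have hcell := (isCellular_cubeExterior (ι := ι) N).union (isCellular_cellularCore U)
  obtain ⟨E, x'', h⟩ := hX.exists_extension_stretch hp (hO.union hU) hcell
    Set.subset_union_left hc h0 h2
  exact ⟨_, E, x', x'', hO.union hU, hcell, Set.subset_union_left, Set.subset_union_right, hc,
    hx'O, hx', h⟩

/-- A map from a cube of dimension at most `p + q` to the join, which is sufficiently uniform on
the unit cells, can be deformed into a segment. -/
theorem exists_segHomotopic {m n : ℤ} (hX : NConnected m X) (hY : NConnected n Y) {p q k N : ℕ}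
    (hp : (p : ℤ) ≤ m + 1) (hq : (q : ℤ) ≤ n + 1) (hk : k + 1 ≤ p + q) (hN : 0 < N)
    {F : (Fin (k + 1) → ℝ) → TopJoin X Y} (hF : Continuous F) {x₀ : X} {y₀ : Y} {t₀ : I}
    (hF₀ : ∀ z ∈ cubeExterior (Fin (k + 1)) N, F z = TopJoin.mk x₀ y₀ t₀)
    (hosc : ∀ z w : Fin (k + 1) → ℝ, (∀ i, (⌊z i⌋ : ℝ) ≤ w i ∧ w i ≤ ⌈z i⌉) →
      |((F z).height : ℝ) - (F w).height| < 1 / 4) :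
    ∃ G, SegHomotopic (cubeExterior (Fin (k + 1)) N) x₀ y₀ F G ∧
      ∀ z, ∃ t, G z = TopJoin.mk x₀ y₀ t := by
  set O := cubeExterior (Fin (k + 1)) N with hOdef
  have hht : Continuous fun z => (F z).height := TopJoin.continuous_height.comp hF
  obtain ⟨K, E, x, x', hK, hK', hOK, hUK, hx, hxO, hxF, hE, hKE, hx', hxx', hEcard⟩ :=
    hX.exists_extension_cubeExterior hp N
      (U := {z | (F z).height ≠ 1}) (x := fun z => TopJoin.fst x₀ (F z)) (x₀ := x₀)
      ((TopJoin.continuousOn_fst x₀).comp hF.continuousOn fun z hz => hz) (by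
        intro z hz hzU
        rw [Set.mem_ofPred_eq, hF₀ z hz] at hzU
        rw [hF₀ z hz]
        exact TopJoin.fst_mk _ _ _ hzU) (δ := 1 / 4) (by norm_num) (by norm_num)
  obtain ⟨L, E', y, y', hL, hL', hOL, hUL, hy, hyO, hyF, hE', hLE, hy', hyy', hEcard'⟩ :=
    hY.exists_extension_cubeExterior hq N
      (U := {z | (F z).height ≠ 0}) (x := fun z => TopJoin.snd y₀ (F z)) (x₀ := y₀)
      ((TopJoin.continuousOn_snd y₀).comp hF.continuousOn fun z hz => hz) (by
        intro z hz hzU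
        rw [Set.mem_ofPred_eq, hF₀ z hz] at hzU
        rw [hF₀ z hz]
        exact TopJoin.snd_mk _ _ _ hzU) (δ := 7 / 4) (by norm_num) (by norm_num)
  have hsO : ∀ {δ : ℝ}, 0 ≤ δ → ∀ s : I, ∀ z ∈ O, (fun i => stretch δ s (z i)) ∈ O :=
    fun h s z hz => isCellular_cubeExterior N z hz _ fun i => stretch_mem h s.2 (z i)
  have hx'O : ∀ z ∈ O, x' z = x₀ := fun z hz =>
    (hxx' z (hOK hz)).trans (hxO _ (hsO (by norm_num) 1 z hz))
  have hy'O : ∀ z ∈ O, y' z = y₀ := fun z hz =>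
    (hyy' z (hOL hz)).trans (hyO _ (hsO (by norm_num) 1 z hz))
  have hFxy : ∀ z, F z = TopJoin.mk (x z) (y z) (F z).height := by
    intro z
    by_cases hz : z ∈ O
    · rw [hxO z hz, hyO z hz, hF₀ z hz, TopJoin.height_mk]
    · rw [hxF z hz, hyF z hz, TopJoin.mk_fst_snd_height]
  let e : I → I := fun t => Set.projIcc 0 1 zero_le_one (2 * (t : ℝ) - 1 / 2)
  have he : Continuous e := continuous_projIcc.comp (by fun_prop)
  have he1 : ∀ t : I, 3 / 4 ≤ (t : ℝ) → e t = 1 := fun t ht =>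
    Set.projIcc_of_right_le _ (by linarith)
  have he0 : ∀ t : I, (t : ℝ) ≤ 1 / 4 → e t = 0 := fun t ht =>
    Set.projIcc_of_le_left _ (by linarith)
  have hhK : ∀ z ∉ K, e (F z).height = 1 := by
    intro z hz
    have : ∃ w : Fin (k + 1) → ℝ, (∀ i, (⌊z i⌋ : ℝ) ≤ w i ∧ w i ≤ ⌈z i⌉) ∧
        (F w).height = 1 := by
      by_contra! h
      exact hz (hUK h)
    obtain ⟨w, hw, hw1⟩ := this
    have h := abs_lt.1 (hosc z w hw)
    rw [hw1, Set.Icc.coe_one] at h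
    exact he1 _ (by linarith)
  have hhL : ∀ z ∉ L, e (F z).height = 0 := by
    intro z hz
    have : ∃ w : Fin (k + 1) → ℝ, (∀ i, (⌊z i⌋ : ℝ) ≤ w i ∧ w i ≤ ⌈z i⌉) ∧
        (F w).height = 0 := by
      by_contra! h
      exact hz (hUL h)
    obtain ⟨w, hw, hw1⟩ := this
    have h := abs_lt.1 (hosc z w hw)
    rw [hw1, Set.Icc.coe_zero] at h
    exact he0 _ (by linarith)
  let τ : (Fin (k + 1) → ℝ) → I := fun z => ⟨separator p z, clamp_mem _⟩
  have hτ : Continuous τ := by fun_prop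
  have hτE : ∀ z ∉ E, τ z = 1 := fun z hz => Subtype.ext (separator_eq_one (hEcard z hz))
  have hτE' : ∀ z ∉ E', τ z = 0 := fun z hz => Subtype.ext (separator_eq_zero hk (hEcard' z hz))
  have hτu : ∀ z r, τ (Function.update z 0 r) = τ z := fun z r =>
    Subtype.ext (separator_update p z r)
  have h1 : SegHomotopic O x₀ y₀ F fun z => TopJoin.mk (x z) (y z) (e (F z).height) := by
    let h : I → I → I := fun s t => clampedLerp s t (e t)
    have hh0 : ∀ s, h s 0 = 0 := fun s => by
      simp only [h]
      rw [he0 0 (by norm_num)]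
      exact clampedLerp_self _ _
    have hh1 : ∀ s, h s 1 = 1 := fun s => by
      simp only [h]
      rw [he1 1 (by norm_num)]
      exact clampedLerp_self _ _
    have hhc : Continuous fun p : I × I => h p.1 p.2 := by
      simp only [h]
      fun_prop
    have hval : ∀ s z, TopJoin.reparam h hh0 hh1 s (F z) =
        TopJoin.mk (x z) (y z) (h s (F z).height) := by
      intro s z
      conv_lhs => rw [hFxy z]
      rw [TopJoin.reparam_mk]
    have := SegHomotopic.of_continuous (O := O) (x₀ := x₀) (y₀ := y₀)
      (H := fun z => TopJoin.reparam h hh0 hh1 z.1 (F z.2))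
      ((TopJoin.continuous_reparam h hh0 hh1 hhc).comp (continuous_fst.prodMk
        (hF.comp continuous_snd))) fun s z hz =>
        ⟨h s t₀, by simp only [hF₀ z hz, TopJoin.reparam_mk]⟩
    convert this using 1
    · funext z
      rw [hval, hFxy z]
      simp [h]
    · funext z
      rw [hval]
      simp [h]
  have h2 : SegHomotopic O x₀ y₀ (fun z => TopJoin.mk (x z) (y z) (e (F z).height)) fun z =>
      TopJoin.mk (x fun i => stretch (1 / 4) 1 (z i)) (y fun i => stretch (7 / 4) 1 (z i))
        (e (F z).height) := by
    have hc : ∀ δ : ℝ, 0 ≤ δ → δ ≤ 2 →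
        Continuous fun (z : I × (Fin (k + 1) → ℝ)) i => stretch δ z.1 (z.2 i) :=
      fun δ h h' => continuous_pi fun i => continuous_stretch h h' (by fun_prop) (by fun_prop)
    have := SegHomotopic.of_isClosed (O := O) (x₀ := x₀) (y₀ := y₀)
      (E := Prod.snd ⁻¹' K) (E' := Prod.snd ⁻¹' L)
      (x := fun z : I × (Fin (k + 1) → ℝ) => x fun i => stretch (1 / 4) z.1 (z.2 i))
      (y := fun z : I × (Fin (k + 1) → ℝ) => y fun i => stretch (7 / 4) z.1 (z.2 i))
      (t := fun z : I × (Fin (k + 1) → ℝ) => e (F z.2).height)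
      (hK.preimage continuous_snd) (hL.preimage continuous_snd)
      (hx.comp (hc _ (by norm_num) (by norm_num)).continuousOn fun z hz =>
        hK' _ hz _ fun i => stretch_mem (by norm_num) z.1.2 (z.2 i))
      (hy.comp (hc _ (by norm_num) (by norm_num)).continuousOn fun z hz =>
        hL' _ hz _ fun i => stretch_mem (by norm_num) z.1.2 (z.2 i))
      (he.comp (hht.comp continuous_snd)) (fun z hz => hhK _ hz) (fun z hz => hhL _ hz)
      (fun s z hz => hxO _ (hsO (by norm_num) s z hz))
      (fun s z hz => hyO _ (hsO (by norm_num) s z hz))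
    simpa using this
  have h3 : SegHomotopic O x₀ y₀ (fun z =>
      TopJoin.mk (x fun i => stretch (1 / 4) 1 (z i)) (y fun i => stretch (7 / 4) 1 (z i))
        (e (F z).height)) fun z => TopJoin.mk (x' z) (y' z) (τ z) := by
    have := SegHomotopic.of_isClosed (O := O) (x₀ := x₀) (y₀ := y₀)
      (E := Prod.snd ⁻¹' E) (E' := Prod.snd ⁻¹' E')
      (x := fun z : I × (Fin (k + 1) → ℝ) => x' z.2)
      (y := fun z : I × (Fin (k + 1) → ℝ) => y' z.2)
      (t := fun z : I × (Fin (k + 1) → ℝ) => clampedLerp z.1 (e (F z.2).height) (τ z.2))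
      (hE.preimage continuous_snd) (hE'.preimage continuous_snd)
      (hx'.comp continuousOn_snd fun z hz => hz) (hy'.comp continuousOn_snd fun z hz => hz)
      (by fun_prop)
      (fun z hz => by
        rw [hhK _ fun h => hz (hKE h), hτE _ hz, clampedLerp_self])
      (fun z hz => by
        rw [hhL _ fun h => hz (hLE h), hτE' _ hz, clampedLerp_self])
      (fun s z hz => hx'O z hz) (fun s z hz => hy'O z hz)
    convert this using 1
    · funext z
      simp only [Set.Icc.coe_zero, clampedLerp_zero]
      by_cases hz : z ∈ K
      · by_cases hz' : z ∈ L
        · rw [hxx' z hz, hyy' z hz']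
        · rw [hxx' z hz, hhL z hz']
          exact TopJoin.mk_zero _ _ _
      · by_cases hz' : z ∈ L
        · rw [hyy' z hz', hhK z hz]
          exact TopJoin.mk_one _ _ _
        · exact absurd ((hhL z hz').symm.trans (hhK z hz)) zero_ne_one
    · funext z
      simp
  have huO : ∀ s : I, ∀ z ∈ O, Function.update z 0 ((1 + 2 * (s : ℝ)) * z 0) ∈ O ∧
      Function.update z 0 ((1 + 2 * (s : ℝ)) * z 0 - 2 * s * N) ∈ O := by
    rintro s z ⟨i, hi⟩
    have hs := s.2.1
    have hN' : (0 : ℝ) < N := Nat.cast_pos.2 hN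
    rcases eq_or_ne i 0 with rfl | hi0
    · constructor
      · refine ⟨0, hi.imp (fun h => ?_) fun h => ?_⟩ <;> simp only [Function.update_self] <;>
          nlinarith
      · refine ⟨0, hi.imp (fun h => ?_) fun h => ?_⟩ <;> simp only [Function.update_self] <;>
          nlinarith
    · exact ⟨⟨i, by simpa [hi0] using hi⟩, ⟨i, by simpa [hi0] using hi⟩⟩
  have hu : Continuous fun z : I × (Fin (k + 1) → ℝ) =>
      Function.update z.2 0 ((1 + 2 * (z.1 : ℝ)) * z.2 0) :=
    continuous_snd.update 0 (by fun_prop)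
  have hu' : Continuous fun z : I × (Fin (k + 1) → ℝ) =>
      Function.update z.2 0 ((1 + 2 * (z.1 : ℝ)) * z.2 0 - 2 * z.1 * N) :=
    continuous_snd.update 0 (by fun_prop)
  let ux : (Fin (k + 1) → ℝ) → X := fun z => x' (Function.update z 0 (3 * z 0))
  let uy : (Fin (k + 1) → ℝ) → Y := fun z => y' (Function.update z 0 (3 * z 0 - 2 * N))
  have h4 : SegHomotopic O x₀ y₀ (fun z => TopJoin.mk (x' z) (y' z) (τ z)) fun z =>
      TopJoin.mk (ux z) (uy z) (τ z) := by
    have := SegHomotopic.of_isClosed (O := O) (x₀ := x₀) (y₀ := y₀)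
      (x := fun z : I × (Fin (k + 1) → ℝ) => x' (Function.update z.2 0 ((1 + 2 * (z.1 : ℝ)) * z.2 0)))
      (y := fun z : I × (Fin (k + 1) → ℝ) =>
        y' (Function.update z.2 0 ((1 + 2 * (z.1 : ℝ)) * z.2 0 - 2 * z.1 * N)))
      (t := fun z : I × (Fin (k + 1) → ℝ) => τ z.2)
      (hE.preimage hu) (hE'.preimage hu')
      (hx'.comp hu.continuousOn fun z hz => hz) (hy'.comp hu'.continuousOn fun z hz => hz)
      (by fun_prop) (fun z hz => (hτu _ _).symm.trans (hτE _ hz))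
      (fun z hz => (hτu _ _).symm.trans (hτE' _ hz))
      (fun s z hz => hx'O _ (huO s z hz).1) (fun s z hz => hy'O _ (huO s z hz).2)
    have h3 : (1 + 2 : ℝ) = 3 := by norm_num
    simpa [h3, ux, uy] using this
  let T : (Fin (k + 1) → ℝ) → I := fun z => ⟨clamp (2 - 3 * z 0 / N), clamp_mem _⟩
  have hT : Continuous T := by fun_prop
  have hN' : (0 : ℝ) < N := Nat.cast_pos.2 hN
  have hT1 : ∀ z : Fin (k + 1) → ℝ, Function.update z 0 (3 * z 0) ∉ O → T z = 1 := by
    intro z hz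
    refine Subtype.ext (clamp_of_one_le ?_)
    have : 3 * z 0 / N ≤ 1 := by
      rw [div_le_one hN']
      by_contra! h
      exact hz ⟨0, Or.inr (by simpa using h.le)⟩
    linarith
  have hT0 : ∀ z : Fin (k + 1) → ℝ, Function.update z 0 (3 * z 0 - 2 * N) ∉ O → T z = 0 := by
    intro z hz
    refine Subtype.ext (clamp_of_nonpos ?_)
    have : 2 ≤ 3 * z 0 / N := by
      rw [le_div_iff₀ hN']
      by_contra! h
      exact hz ⟨0, Or.inl (by simpa using h.le)⟩
    linarith
  have hv : Continuous fun z : I × (Fin (k + 1) → ℝ) => Function.update z.2 0 (3 * z.2 0) :=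
    continuous_snd.update 0 (by fun_prop)
  have hv' : Continuous fun z : I × (Fin (k + 1) → ℝ) =>
      Function.update z.2 0 (3 * z.2 0 - 2 * N) :=
    continuous_snd.update 0 (by fun_prop)
  have hvO : ∀ z ∈ O, Function.update z 0 (3 * z 0) ∈ O ∧
      Function.update z 0 (3 * z 0 - 2 * N) ∈ O := by
    intro z hz
    have := huO 1 z hz
    norm_num at this
    exact this
  have h5 : SegHomotopic O x₀ y₀ (fun z => TopJoin.mk (ux z) (uy z) (τ z)) fun z =>
      TopJoin.mk (ux z) (uy z) (T z) := by
    have := SegHomotopic.of_isClosed (O := O) (x₀ := x₀) (y₀ := y₀)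
      (x := fun z : I × (Fin (k + 1) → ℝ) => ux z.2)
      (y := fun z : I × (Fin (k + 1) → ℝ) => uy z.2)
      (t := fun z : I × (Fin (k + 1) → ℝ) => clampedLerp z.1 (τ z.2) (T z.2))
      (hE.preimage hv) (hE'.preimage hv')
      (hx'.comp hv.continuousOn fun z hz => hz) (hy'.comp hv'.continuousOn fun z hz => hz)
      (by fun_prop)
      (fun z hz => by
        rw [← hτu z.2, hτE _ hz, hT1 z.2 fun h => hz (hKE (hOK h)), clampedLerp_self])
      (fun z hz => by
        rw [← hτu z.2, hτE' _ hz, hT0 z.2 fun h => hz (hLE (hOL h)), clampedLerp_self])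
      (fun s z hz => hx'O _ (hvO z hz).1) (fun s z hz => hy'O _ (hvO z hz).2)
    simpa using this
  refine ⟨_, h1.trans (h2.trans (h3.trans (h4.trans h5))), fun z => ⟨T z, ?_⟩⟩
  by_cases hz : Function.update z 0 (3 * z 0) ∈ O
  · rw [show ux z = x₀ from hx'O _ hz]
    by_cases hz' : Function.update z 0 (3 * z 0 - 2 * N) ∈ O
    · rw [show uy z = y₀ from hy'O _ hz']
    · rw [hT0 z hz']
      exact TopJoin.mk_zero _ _ _
  · rw [hT1 z hz]
    by_cases hz' : Function.update z 0 (3 * z 0 - 2 * N) ∈ O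
    · rw [show uy z = y₀ from hy'O _ hz']
      exact TopJoin.mk_one _ _ _
    · exact absurd ((hT0 z hz').symm.trans (hT1 z hz)) zero_ne_one

end Deformation

section Loops

variable {X : Type u} {Y : Type v} [TopologicalSpace X] [TopologicalSpace Y]

/-- The extension to `ℝ^k` of a loop, rescaled to a cube with edges of length `N`. -/
def GenLoop.rescale {W ι : Type*} [TopologicalSpace W] {w : W} (f : GenLoop ι W w) (N : ℕ) :
    (ι → ℝ) → W :=
  fun z => f fun i => Set.projIcc 0 1 zero_le_one (z i / N)

theorem GenLoop.continuous_rescale {W ι : Type*} [TopologicalSpace W] {w : W}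
    (f : GenLoop ι W w) (N : ℕ) : Continuous (GenLoop.rescale f N) :=
  f.1.continuous.comp (continuous_pi fun i => continuous_projIcc.comp (by fun_prop))

theorem GenLoop.rescale_of_mem_cubeExterior {W ι : Type*} [TopologicalSpace W] {w : W}
    (f : GenLoop ι W w) {N : ℕ} (hN : 0 < N) {z : ι → ℝ} (hz : z ∈ cubeExterior ι N) :
    GenLoop.rescale f N z = w := by
  have hN' : (0 : ℝ) < N := Nat.cast_pos.2 hN
  obtain ⟨i, hi⟩ := hz
  refine f.2 _ ⟨i, hi.imp (fun h => ?_) fun h => ?_⟩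
  · exact Set.projIcc_of_le_left _ (div_nonpos_of_nonpos_of_nonneg h hN'.le)
  · exact Set.projIcc_of_right_le _ ((one_le_div hN').2 h)

theorem GenLoop.exists_rescale_dist_lt {W ι : Type*} [TopologicalSpace W] [Finite ι] {w : W}
    (f : GenLoop ι W w) {h : W → ℝ} (hh : Continuous h) {ε : ℝ} (hε : 0 < ε) :
    ∃ N : ℕ, 0 < N ∧ ∀ z w : ι → ℝ, (∀ i, (⌊z i⌋ : ℝ) ≤ w i ∧ w i ≤ ⌈z i⌉) →
      |h (GenLoop.rescale f N z) - h (GenLoop.rescale f N w)| < ε := by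
  have := Fintype.ofFinite ι
  have hu : UniformContinuous fun u : ι → I => h (f u) :=
    CompactSpace.uniformContinuous_of_continuous (hh.comp f.1.continuous)
  obtain ⟨δ, hδ, hδ'⟩ := Metric.uniformContinuous_iff.1 hu ε hε
  obtain ⟨N, hN⟩ := exists_nat_gt (1 / δ)
  have hN' : (0 : ℝ) < N := (one_div_pos.2 hδ).trans hN
  refine ⟨N, Nat.cast_pos.1 hN', fun z w hw => ?_⟩
  refine hδ' (lt_of_le_of_lt ((dist_pi_le_iff (r := 1 / (N : ℝ)) (by positivity)).2 fun i => ?_)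
    ((one_div_lt hδ hN').1 hN))
  refine le_trans (Set.abs_projIcc_sub_projIcc zero_le_one) ?_
  rw [← sub_div, abs_div, abs_of_pos hN']
  gcongr
  have h1 := Int.floor_le (z i)
  have h2 := Int.le_ceil (z i)
  have h3 : (⌈z i⌉ : ℝ) ≤ ⌊z i⌋ + 1 := by exact_mod_cast Int.ceil_le_floor_add_one (z i)
  rw [abs_le]
  constructor <;> linarith [(hw i).1, (hw i).2]

/-- A loop is null-homotopic as soon as its rescaling can be deformed into a segment. -/
theorem GenLoop.homotopicRel_const_of_segHomotopic {ι : Type*} [Fintype ι] {x₀ : X} {y₀ : Y}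
    {t₀ : I} (f : GenLoop ι (TopJoin X Y) (TopJoin.mk x₀ y₀ t₀)) {N : ℕ} (hN : 0 < N)
    {G : (ι → ℝ) → TopJoin X Y}
    (hG : SegHomotopic (cubeExterior ι N) x₀ y₀ (GenLoop.rescale f N) G)
    (hG₀ : ∀ z, ∃ t, G z = TopJoin.mk x₀ y₀ t) :
    f.1.HomotopicRel (ContinuousMap.const _ (TopJoin.mk x₀ y₀ t₀)) (Cube.boundary ι) := by
  have hN' : (0 : ℝ) < N := Nat.cast_pos.2 hN
  obtain ⟨hFc, hGc, ⟨H⟩⟩ := hG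
  have hHO : ∀ s, ∀ z ∈ cubeExterior ι N, H (s, z) = TopJoin.mk x₀ y₀ (H (s, z)).height := by
    intro s z hz
    obtain ⟨t, ht⟩ := H.prop' s z hz
    have ht' : H (s, z) = TopJoin.mk x₀ y₀ t := ht
    rw [ht', TopJoin.height_mk]
  have hG₁ : ∀ z, G z = TopJoin.mk x₀ y₀ (G z).height := by
    intro z
    obtain ⟨t, ht⟩ := hG₀ z
    rw [ht, TopJoin.height_mk]
  let ζ : (ι → I) → (ι → ℝ) := fun u i => 3 * N * u i - N
  have hζ : Continuous ζ := by fun_prop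
  have hζO : ∀ u ∈ Cube.boundary ι, ζ u ∈ cubeExterior ι N := by
    rintro u ⟨i, hi⟩
    refine ⟨i, hi.imp (fun h => ?_) fun h => ?_⟩
    · simp [ζ, h]
    · simp only [ζ, h, Set.Icc.coe_one]
      linarith
  let b : (ι → I) → ℝ := fun u => ∏ i, clamp (3 * min (u i : ℝ) (1 - u i))
  have hb : Continuous b := by fun_prop
  have hb0 : ∀ u ∈ Cube.boundary ι, b u = 0 := by
    rintro u ⟨i, hi⟩
    refine Finset.prod_eq_zero (Finset.mem_univ i) (clamp_of_nonpos ?_)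
    rcases hi with hi | hi <;> simp [hi]
  have hb1 : ∀ u, (∀ i, 0 ≤ ζ u i ∧ ζ u i ≤ N) → b u = 1 := by
    intro u hu
    refine Finset.prod_eq_one fun i _ => clamp_of_one_le ?_
    obtain ⟨h1, h2⟩ := hu i
    simp only [ζ] at h1 h2
    have h3 : 1 / 3 ≤ (u i : ℝ) := by nlinarith
    have h4 : 1 / 3 ≤ 1 - (u i : ℝ) := by nlinarith
    linarith [le_min h3 h4]
  let f₁ : C(ι → I, TopJoin X Y) := ⟨fun u => GenLoop.rescale f N (ζ u), hFc.comp hζ⟩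
  have h1 : f.1.HomotopicRel f₁ (Cube.boundary ι) := by
    refine ⟨{
      toFun := fun z => f fun i => clampedLerp z.1 (z.2 i) (3 * (z.2 i : ℝ) - 1)
      continuous_toFun := f.1.continuous.comp (by fun_prop)
      map_zero_left := fun u => by simp
      map_one_left := fun u => ?_
      prop' := fun s u hu => ?_ }⟩
    · change f _ = f _
      congr 1
      funext i
      have : (3 * N * (u i : ℝ) - N) / N = 3 * u i - 1 := by field_simp
      simp [clampedLerp, ζ, this]
    · refine (f.2 _ ?_).trans (f.2 u hu).symm
      obtain ⟨i, hi⟩ := hu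
      have hs := s.2.1
      refine ⟨i, hi.imp (fun h => ?_) fun h => ?_⟩
      · exact Set.projIcc_of_le_left _ (by simp only [h, Set.Icc.coe_zero]; linarith)
      · exact Set.projIcc_of_right_le _ (by simp only [h, Set.Icc.coe_one]; linarith)
  let A : I × (ι → I) → TopJoin X Y := fun z => H (z.1, ζ z.2)
  let B : I × (ι → I) → TopJoin X Y := fun z =>
    TopJoin.mk x₀ y₀ (clampedLerp (b z.2) t₀ (H (z.1, ζ z.2)).height)
  have hA : Continuous A := by fun_prop
  have hB : Continuous B := TopJoin.continuous_mk.comp (continuous_const.prodMk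
    (continuous_const.prodMk (by fun_prop)))
  let M : I × (ι → I) → TopJoin X Y := fun z =>
    if ζ z.2 ∈ cubeExterior ι N then B z else A z
  have hMO : ∀ z : I × (ι → I), ζ z.2 ∈ cubeExterior ι N → M z = B z := fun z hz => if_pos hz
  have hMO' : ∀ z : I × (ι → I), ζ z.2 ∉ cubeExterior ι N → M z = A z := fun z hz => if_neg hz
  have hM : Continuous M := by
    rw [← continuousOn_univ]
    have hcl : IsClosed {z : I × (ι → I) | ζ z.2 ∈ Set.Icc (0 : ι → ℝ) fun _ => (N : ℝ)} :=
      isClosed_Icc.preimage (hζ.comp continuous_snd)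
    refine ((hB.continuousOn.congr (s := {z : I × (ι → I) | ζ z.2 ∈ cubeExterior ι N})
      fun z hz => hMO z hz).union_of_isClosed
      (hA.continuousOn.congr (s := {z : I × (ι → I) | ζ z.2 ∈ Set.Icc (0 : ι → ℝ) fun _ => (N : ℝ)})
        fun z hz => ?_)
      ((isClosed_cubeExterior N).preimage (hζ.comp continuous_snd)) hcl).mono fun z _ => ?_
    · by_cases hzO : ζ z.2 ∈ cubeExterior ι N
      · rw [hMO z hzO]
        simp only [A, B]
        rw [hb1 _ fun i => ⟨hz.1 i, hz.2 i⟩, clampedLerp_one]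
        exact (hHO _ _ hzO).symm
      · exact hMO' z hzO
    · by_cases hzO : ζ z.2 ∈ cubeExterior ι N
      · exact Or.inl hzO
      · refine Or.inr ⟨fun i => ?_, fun i => ?_⟩
        · by_contra! h
          exact hzO ⟨i, Or.inl h.le⟩
        · by_contra! h
          exact hzO ⟨i, Or.inr h.le⟩
  have hM0 : ∀ u, M (0, u) = f₁ u := by
    intro u
    have hH0 : H (0, ζ u) = GenLoop.rescale f N (ζ u) := H.apply_zero _
    by_cases hu : ζ u ∈ cubeExterior ι N
    · rw [hMO _ hu]
      simp only [B, f₁, ContinuousMap.coe_mk]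
      rw [hH0, GenLoop.rescale_of_mem_cubeExterior f hN hu, TopJoin.height_mk, clampedLerp_self]
    · rw [hMO' _ hu]
      exact hH0
  have hMb : ∀ s, ∀ u ∈ Cube.boundary ι, M (s, u) = TopJoin.mk x₀ y₀ t₀ := by
    intro s u hu
    rw [hMO _ (hζO u hu)]
    simp only [B]
    rw [hb0 u hu, clampedLerp_zero]
  have hM1 : ∀ u, M (1, u) = TopJoin.mk x₀ y₀ (M (1, u)).height := by
    intro u
    by_cases hu : ζ u ∈ cubeExterior ι N
    · rw [hMO _ hu]
      rfl
    · rw [hMO' _ hu]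
      have hH1 : H (1, ζ u) = G (ζ u) := H.apply_one _
      simp only [A]
      rw [hH1]
      exact hG₁ _
  let f₂ : C(ι → I, TopJoin X Y) := ⟨fun u => M (1, u), by fun_prop⟩
  have h2 : f₁.HomotopicRel f₂ (Cube.boundary ι) := ⟨{
    toFun := M
    continuous_toFun := hM
    map_zero_left := hM0
    map_one_left := fun u => rfl
    prop' := fun s u hu => (hMb s u hu).trans ((hMb 0 u hu).symm.trans (hM0 u)) }⟩
  have h3 : f₂.HomotopicRel (ContinuousMap.const _ (TopJoin.mk x₀ y₀ t₀)) (Cube.boundary ι) := by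
    refine ⟨{
      toFun := fun z => TopJoin.mk x₀ y₀ (clampedLerp z.1 (M (1, z.2)).height t₀)
      continuous_toFun := TopJoin.continuous_mk.comp (continuous_const.prodMk
        (continuous_const.prodMk (by fun_prop)))
      map_zero_left := fun u => ?_
      map_one_left := fun u => ?_
      prop' := fun s u hu => ?_ }⟩
    · simp only [Set.Icc.coe_zero, clampedLerp_zero]
      exact (hM1 u).symm
    · simp
    · change TopJoin.mk x₀ y₀ (clampedLerp s (M (1, u)).height t₀) = M (1, u)
      rw [hMb 1 u hu, TopJoin.height_mk, clampedLerp_self]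
  exact h1.trans (h2.trans h3)

theorem TopJoin.pathConnectedSpace [Nonempty X] [Nonempty Y] :
    PathConnectedSpace (TopJoin X Y) := by
  have hI : PathConnectedSpace I := isPathConnected_iff_pathConnectedSpace.1
    ((convex_Icc (0 : ℝ) 1).isPathConnected ⟨0, by simp⟩)
  have hj : ∀ (a : X) (b : Y) (t t' : I), Joined (TopJoin.mk a b t) (TopJoin.mk a b t') :=
    fun a b t t' => (PathConnectedSpace.joined t t').map (f := fun s => TopJoin.mk a b s)
      (TopJoin.continuous_mk.comp (continuous_const.prodMk (continuous_const.prodMk continuous_id)))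
  have ⟨a⟩ := ‹Nonempty X›
  have ⟨b⟩ := ‹Nonempty Y›
  refine ⟨⟨TopJoin.mk a b 0⟩, fun w w' => ?_⟩
  induction w using TopJoin.ind with
  | h a b t =>
    induction w' using TopJoin.ind with
    | h a' b' t' =>
      have h := (hj a b t 0).trans (TopJoin.mk_zero a b b' ▸ hj a b' 0 1)
      exact h.trans (TopJoin.mk_one a a' b' ▸ hj a' b' 1 t')

end Loops

/-- If `X` is `m`-connected and `Y` is `n`-connected (with
`m, n ≥ -1`), then the join `X ∗ Y` is `(m + n + 2)`-connected. -/
theorem topJoin_connectivity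
    {X : Type u} {Y : Type v} [TopologicalSpace X] [TopologicalSpace Y]
    (m n : ℤ) (hm : -1 ≤ m) (hn : -1 ≤ n)
    (hX : NConnected m X) (hY : NConnected n Y) :
    NConnected (m + n + 2) (TopJoin X Y) := by
  have := hX.1 hm
  have := hY.1 hn
  have hpath : PathConnectedSpace (TopJoin X Y) := TopJoin.pathConnectedSpace
  refine ⟨fun _ => hpath.nonempty, fun j hj w => ?_⟩
  match j with
  | 0 => exact (subsingleton_homotopyGroup_zero_iff w).2 hpath
  | k + 1 =>
    induction w using TopJoin.ind with
    | h x₀ y₀ t₀ =>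
      have hnull : ∀ f : GenLoop (Fin (k + 1)) (TopJoin X Y) (TopJoin.mk x₀ y₀ t₀),
          f.1.HomotopicRel (ContinuousMap.const _ (TopJoin.mk x₀ y₀ t₀))
            (Cube.boundary (Fin (k + 1))) := by
        intro f
        obtain ⟨N, hN, hosc⟩ := GenLoop.exists_rescale_dist_lt f
          (h := fun w => (w.height : ℝ)) (by fun_prop) (ε := 1 / 4) (by norm_num)
        obtain ⟨G, hG, hG₀⟩ := exists_segHomotopic hX hY (p := (m + 1).toNat)
          (q := (n + 1).toNat) (by omega) (by omega) (by push_cast at hj; omega) hN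
          (GenLoop.continuous_rescale f N)
          (fun z hz => GenLoop.rescale_of_mem_cubeExterior f hN hz) hosc
        exact GenLoop.homotopicRel_const_of_segHomotopic f hN hG hG₀
      refine ⟨fun α β => ?_⟩
      induction α using Quotient.inductionOn with
      | h f =>
        induction β using Quotient.inductionOn with
        | h g => exact Quotient.sound ((hnull f).trans (hnull g).symm)
end
end
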